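/- arXiv:2404.02341 — 3 statements merged into one kernel-verified Lean document; each statement's English description precedes it below -/
import Mathlib

section
/- Let f be a homeomorphism of T² homotopic to the identity such that ρ(f) has nonempty interior, and let f̂ be a lift. Then there exists M > 0 such that for every ẑ ∈ ℝ², the equivalence class [ẑ]_{f̂} = {ẑ' ∈ ℝ² : ẑ' ∼_{f̂} ẑ} has Euclidean diameter less than M. -/
open Metric Filter Topology MeasureTheory Set ENNReal

noncomputable section

abbrev R2 : Type := ℝ × ℝ

abbrev Torus : Type := AddCircle (1 : ℝ) × AddCircle (1 : ℝ)

instance : Fact ((0:ℝ) < 1) := ⟨one_pos⟩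

/-- The covering projection `ℝ² → T²`. -/
def proj : R2 → Torus := fun p => ((p.1 : AddCircle (1:ℝ)), (p.2 : AddCircle (1:ℝ)))

/-- `F : ℝ² → ℝ²` is a lift of `f : T² → T²` (commutes with the projection and
with the integer translations). -/
def IsLiftFun (f : Torus → Torus) (F : R2 → R2) : Prop :=
  (∀ x : R2, proj (F x) = f (proj x)) ∧
  ∀ (x : R2) (v : ℤ × ℤ), F (x + ((v.1 : ℝ), (v.2 : ℝ))) = F x + ((v.1 : ℝ), (v.2 : ℝ))

/-- Iteration of a homeomorphism indexed by `ℤ`. -/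
def iterZ {X : Type*} [TopologicalSpace X] (F : X ≃ₜ X) : ℤ → X → X
  | Int.ofNat n => (⇑F)^[n]
  | Int.negSucc n => (⇑F.symm)^[n+1]

/-- The rotation set of a lift. -/
def rotSet (F : R2 ≃ₜ R2) : Set R2 :=
  {v | ∃ (z : ℕ → R2) (n : ℕ → ℕ), Tendsto n atTop atTop ∧
    Tendsto (fun k => ((n k : ℝ))⁻¹ • ((⇑F)^[n k] (z k) - z k)) atTop (nhds v)}

/-- A continuum: a nonempty compact connected set. -/
def IsContinuum {X : Type*} [TopologicalSpace X] (K : Set X) : Prop :=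
  IsCompact K ∧ IsConnected K

/-- Dynamical diameter of a set under a homeomorphism of the plane. -/
def dynDiam (F : R2 ≃ₜ R2) (K : Set R2) : ℝ≥0∞ :=
  ⨆ j : ℤ, EMetric.diam (iterZ F j '' K)

/-- Topological mixing. -/
def TopologicallyMixing {X : Type*} [TopologicalSpace X] (h : X → X) : Prop :=
  ∀ U V : Set X, IsOpen U → IsOpen V → U.Nonempty → V.Nonempty →
    ∃ n₀ : ℕ, ∀ n, n₀ ≤ n → ((h^[n]) '' U ∩ V).Nonempty

/-- Maximal cardinality of a `(±n, ε)`-separated subset of `K`. -/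
def sepCount (g : Torus ≃ₜ Torus) (n : ℕ) (ε : ℝ) (K : Set Torus) : ℕ :=
  sSup {m : ℕ | ∃ Y : Finset Torus, ↑Y ⊆ K ∧ Y.card = m ∧
    ∀ y ∈ Y, ∀ y' ∈ Y, y ≠ y' →
      ∃ i : ℤ, |i| ≤ (n : ℤ) ∧ ε < dist (iterZ g i y) (iterZ g i y')}

/-- The two-sided entropy `h_±(g, K)` carried by `K`. -/
def entropyPM (g : Torus ≃ₜ Torus) (K : Set Torus) : EReal :=
  ⨆ (ε : ℝ) (_ : 0 < ε),
    limsup (fun n : ℕ => ((Real.log (sepCount g n ε K) / n : ℝ) : EReal)) atTop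

/-- Connected component of the `ε`-stable set of `z` containing `z`. -/
def stableComp (G : R2 ≃ₜ R2) (ε : ℝ) (z : R2) : Set R2 :=
  connectedComponentIn {z' : R2 | ∀ j : ℕ, dist ((⇑G)^[j] z') ((⇑G)^[j] z) ≤ ε} z

/-- The stable set of `z`. -/
def stableSet (G : R2 ≃ₜ R2) (z : R2) : Set R2 := ⋃ ε > 0, stableComp G ε z

/-- Connected component of the `ε`-unstable set of `z` containing `z`. -/
def unstableComp (G : R2 ≃ₜ R2) (ε : ℝ) (z : R2) : Set R2 :=
  connectedComponentIn {z' : R2 | ∀ j : ℕ, dist ((⇑G.symm)^[j] z') ((⇑G.symm)^[j] z) ≤ ε} z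

/-- The unstable set of `z`. -/
def unstableSet (G : R2 ≃ₜ R2) (z : R2) : Set R2 := ⋃ ε > 0, unstableComp G ε z

/-- Two points are dynamically related if some dynamically bounded continuum contains both. -/
def dynRel (F : R2 ≃ₜ R2) (z z' : R2) : Prop :=
  ∃ K : Set R2, IsContinuum K ∧ z ∈ K ∧ z' ∈ K ∧ dynDiam F K ≠ ⊤

/-- The equivalence class of `z` under the dynamically-bounded relation. -/
def dynClass (F : R2 ≃ₜ R2) (z : R2) : Set R2 := {z' | dynRel F z z'}


namespace UBC

/-- a continuous function with constant exponential on a preconnected set is constant -/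
lemma exp_const {X : Type*} [TopologicalSpace X] {S : Set X} (hS : IsPreconnected S) {H : X → ℂ}
    (hH : ContinuousOn H S) {c : ℂ} (hc : ∀ x ∈ S, Complex.exp (H x) = c) {x y : X}
    (hx : x ∈ S) (hy : y ∈ S) : H x = H y := by
  have key : ∀ y ∈ S, ∃ n : ℤ, H y = H x + n * (2 * Real.pi * Complex.I) := by
    intro y hy
    have := (hc y hy).trans (hc x hx).symm
    exact Complex.exp_eq_exp_iff_exists_int.1 this
  set f : X → ℝ := fun y => ((H y).im - (H x).im) / (2 * Real.pi) with hf
  have hpi := Real.pi_pos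
  have hfc : ContinuousOn f S := by
    have : ContinuousOn (fun y => (H y).im) S := Complex.continuous_im.comp_continuousOn hH
    exact (this.sub continuousOn_const).div_const _
  have hfn : ∀ y ∈ S, ∃ n : ℤ, f y = n ∧ H y = H x + n * (2 * Real.pi * Complex.I) := by
    intro y hy
    obtain ⟨n, hn⟩ := key y hy
    refine ⟨n, ?_, hn⟩
    simp only [hf, hn]
    simp
  obtain ⟨n, hn, hn'⟩ := hfn y hy
  have hfx : f x = 0 := by simp [hf]
  have hpre := hS.image f hfc
  have hoc := hpre.ordConnected
  have h0 : (0:ℝ) ∈ f '' S := ⟨x, hx, hfx⟩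
  have h1 : (n:ℝ) ∈ f '' S := ⟨y, hy, hn⟩
  have nohalf : ∀ m : ℤ, ((m:ℝ) + 1/2) ∉ f '' S := by
    rintro m ⟨w, hw, hwm⟩
    obtain ⟨k, hk, -⟩ := hfn w hw
    rw [hk] at hwm
    have : (2 * k : ℤ) = 2 * m + 1 := by
      have : (2 * k : ℝ) = 2 * m + 1 := by linarith
      exact_mod_cast this
    omega
  have hn0 : n = 0 := by
    rcases lt_trichotomy n 0 with h | h | h
    · exfalso
      have h' : (n:ℝ) ≤ -1 := by exact_mod_cast (by omega : n ≤ -1)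
      exact nohalf (-1) (hoc.out h1 h0 ⟨by push_cast; linarith, by push_cast; linarith⟩)
    · exact h
    · exfalso
      have h' : (1:ℝ) ≤ n := by exact_mod_cast (by omega : 1 ≤ n)
      exact nohalf 0 (hoc.out h0 h1 ⟨by push_cast; linarith, by push_cast; linarith⟩)
  rw [hn', hn0]; simp

lemma exists_log {h : ℂ → ℂ} (hc : Continuous h) (h0 : ∀ u, h u ≠ 0) :
    ∃ H : ℂ → ℂ, Continuous H ∧ ∀ u, Complex.exp (H u) = h u := by
  have hs : IsSimplyConnected (univ : Set ℂ) := by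
    have : ContractibleSpace (univ : Set ℂ) := (Homeomorph.Set.univ ℂ).contractibleSpace
    exact (inferInstance : SimplyConnectedSpace (univ : Set ℂ))
  obtain ⟨H, hH, hHe⟩ := Complex.exists_continuousOn_eqOn_exp_comp hs isOpen_univ hc.continuousOn
    (by rintro ⟨u, -, hu⟩; exact h0 u hu)
  exact ⟨H, continuousOn_univ.1 hH, fun u => hHe (mem_univ u)⟩

lemma near_one {q : ℂ} (hq : ‖q - 1‖ ≤ 1/4) : q ∈ Complex.slitPlane ∧ |q.arg| ≤ Real.pi / 4 := by
  have hre : 3/4 ≤ q.re := by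
    have := (Complex.abs_re_le_norm (q - 1)).trans hq
    simp at this
    linarith [(abs_le.1 this).1]
  have him : |q.im| ≤ 1/4 := by
    have := (Complex.abs_im_le_norm (q - 1)).trans hq
    simpa using this
  refine ⟨Or.inl (by linarith), ?_⟩
  have h1 : |q.arg| < Real.pi / 2 := Complex.abs_arg_lt_pi_div_two_iff.2 (Or.inl (by linarith))
  have hq0 : q ≠ 0 := by rintro rfl; simp at hre; linarith
  have ht : Real.tan q.arg = q.im / q.re := Complex.tan_arg q
  have hpi := Real.pi_pos
  have h1' := abs_lt.1 h1
  have htl : |q.im / q.re| ≤ 1 := by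
    rw [abs_div, div_le_one (by positivity)]
    rw [abs_of_pos (by linarith : 0 < q.re)]; linarith
  rw [abs_le]
  have ha := abs_le.1 htl
  constructor
  · by_contra hcon
    push Not at hcon
    have := Real.tan_lt_tan_of_lt_of_lt_pi_div_two (x := q.arg) (y := -(Real.pi/4)) (by linarith)
      (by linarith) (by linarith)
    rw [ht, Real.tan_neg, Real.tan_pi_div_four] at this
    linarith
  · by_contra hcon
    push Not at hcon
    have := Real.tan_lt_tan_of_lt_of_lt_pi_div_two (x := Real.pi/4) (y := q.arg) (by linarith)
      (by linarith) (by linarith)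
    rw [ht, Real.tan_pi_div_four] at this
    linarith

lemma quot_near {C : ℝ} {a b a' b' : ℂ} (ha : ‖a' - a‖ ≤ C) (hb : ‖b' - b‖ ≤ C)
    (hC : 1 ≤ C) (hab : 8 * C ≤ ‖a - b‖) : ‖(a' - b') / (a - b) - 1‖ ≤ 1/4 := by
  have hpos : 0 < ‖a - b‖ := by linarith
  have hne : a - b ≠ 0 := norm_pos_iff.1 hpos
  have : (a' - b') / (a - b) - 1 = ((a' - a) - (b' - b)) / (a - b) := by field_simp; ring
  rw [this, norm_div, div_le_iff₀ hpos]
  calc _ ≤ ‖a' - a‖ + ‖b' - b‖ := norm_sub_le _ _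
    _ ≤ _ := by linarith

lemma log_lemma {G : ℂ → ℂ} (hG : Continuous G) (hinj : Function.Injective G) {C : ℝ} (hC : 1 ≤ C)
    (hb : ∀ z, ‖G z - z‖ ≤ C) (p : ℂ) :
    ∃ L : ℂ → ℂ, ContinuousOn L {p}ᶜ ∧ (∀ y, y ≠ p → Complex.exp (L y) = (G y - G p) / (y - p)) ∧
      ∀ y, 8 * C ≤ ‖y - p‖ → L y = Complex.log ((G y - G p) / (y - p)) := by
  set h : ℂ → ℂ := fun u => (G (p + Complex.exp u) - G p) / Complex.exp u with hh
  have hhc : Continuous h := by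
    have : Continuous fun u => G (p + Complex.exp u) :=
      hG.comp (continuous_const.add Complex.continuous_exp)
    exact (this.sub continuous_const).div Complex.continuous_exp (fun u => Complex.exp_ne_zero u)
  have h0 : ∀ u, h u ≠ 0 := by
    intro u
    refine div_ne_zero ?_ (Complex.exp_ne_zero u)
    rw [sub_ne_zero]
    intro hcon
    have := hinj hcon
    exact Complex.exp_ne_zero u (by simp at this)
  obtain ⟨H, hHc, hHe⟩ := exists_log hhc h0
  set R : Set ℂ := {u | Real.log (8 * C) ≤ u.re} with hR
  have hRconv : Convex ℝ R := convex_halfSpace_re_ge _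
  have hRpre : IsPreconnected R := hRconv.isPreconnected
  have hnear : ∀ u ∈ R, ‖h u - 1‖ ≤ 1/4 := by
    intro u hu
    have h1 : 8 * C ≤ ‖Complex.exp u‖ := by
      rw [Complex.norm_exp]
      calc 8 * C = Real.exp (Real.log (8*C)) := (Real.exp_log (by linarith)).symm
        _ ≤ _ := Real.exp_le_exp.2 hu
    have := quot_near (a := p + Complex.exp u) (b := p) (hb (p + Complex.exp u)) (hb p) hC (by simpa using h1)
    simpa [hh] using this
  -- normalise
  have hlogc : ContinuousOn (fun u => Complex.log (h u)) R := by
    intro u hu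
    exact (hhc.continuousAt.clog (near_one (hnear u hu)).1).continuousWithinAt
  have hu0 : ((Real.log (8*C) : ℝ) : ℂ) ∈ R := by simp [hR]
  set c0 : ℂ := H (Real.log (8*C) : ℝ) - Complex.log (h (Real.log (8*C) : ℝ)) with hc0
  have hc0e : Complex.exp c0 = 1 := by
    rw [hc0, Complex.exp_sub, hHe, Complex.exp_log (h0 _), div_self (h0 _)]
  have hdiff : ∀ u ∈ R, H u - Complex.log (h u) = c0 := by
    intro u hu
    refine exp_const (c := 1) hRpre (H := fun u => H u - Complex.log (h u)) (hHc.continuousOn.sub hlogc) ?_ hu hu0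
    intro w hw
    rw [Complex.exp_sub, hHe, Complex.exp_log (h0 _), div_self (h0 _)]
  set H' : ℂ → ℂ := fun u => H u - c0 with hH'
  have hH'c : Continuous H' := hHc.sub continuous_const
  have hH'e : ∀ u, Complex.exp (H' u) = h u := by
    intro u; rw [hH']; simp only; rw [Complex.exp_sub, hc0e, div_one, hHe]
  have hH'R : ∀ u ∈ R, H' u = Complex.log (h u) := by
    intro u hu
    have := hdiff u hu
    simp only [hH', ← this]; ring
  have hper_h : ∀ u, h (u + 2 * Real.pi * Complex.I) = h u := by
    intro u; simp only [hh]; rw [Complex.exp_periodic u]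
  have hper : ∀ u, H' (u + 2 * Real.pi * Complex.I) = H' u := by
    intro u
    have h1 : ∀ u, Complex.exp (H' (u + 2 * Real.pi * Complex.I) - H' u) = 1 := by
      intro u
      rw [Complex.exp_sub, hH'e, hH'e, hper_h, div_self (h0 _)]
    have := exp_const (c := 1) (isPreconnected_univ (α := ℂ)) (H := fun u => H' (u + 2 * Real.pi * Complex.I) - H' u)
      ((by fun_prop : Continuous _).continuousOn) (fun x _ => h1 x) (mem_univ u)
      (mem_univ ((Real.log (8*C) : ℝ) : ℂ))
    have h2 : ((Real.log (8*C) : ℝ) : ℂ) + 2 * Real.pi * Complex.I ∈ R := by simp [hR]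
    rw [hH'R _ h2, hH'R _ hu0, hper_h, sub_self] at this
    exact sub_eq_zero.1 this
  have hper' : ∀ u, H' (u - 2 * Real.pi * Complex.I) = H' u := by
    intro u; rw [← hper (u - 2 * Real.pi * Complex.I)]; congr 1; ring
  have hexplog : ∀ y, y ≠ p → h (Complex.log (y - p)) = (G y - G p) / (y - p) := by
    intro y hy
    simp only [hh]
    rw [Complex.exp_log (sub_ne_zero.2 hy)]; simp
  have hexpinv : ∀ u v, Complex.exp u = Complex.exp v → H' u = H' v := by
    intro u v huv
    obtain ⟨n, rfl⟩ := Complex.exp_eq_exp_iff_exists_int.1 huv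
    induction n using Int.induction_on with
    | zero => simp
    | succ k ih =>
      have e : v + ((k + 1 : ℤ) : ℂ) * (2 * Real.pi * Complex.I) = (v + ((k : ℤ) : ℂ) * (2 * Real.pi * Complex.I)) + 2 * Real.pi * Complex.I := by
        push_cast; ring
      rw [e, hper]
      refine ih ?_
      exact Complex.exp_eq_exp_iff_exists_int.2 ⟨k, rfl⟩
    | pred k ih =>
      have e : v + ((-(k:ℤ) - 1 : ℤ) : ℂ) * (2 * Real.pi * Complex.I) = (v + ((-(k:ℤ) : ℤ) : ℂ) * (2 * Real.pi * Complex.I)) - 2 * Real.pi * Complex.I := by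
        push_cast; ring
      rw [e, hper']
      refine ih ?_
      exact Complex.exp_eq_exp_iff_exists_int.2 ⟨-k, rfl⟩
  refine ⟨fun y => H' (Complex.log (y - p)), ?_, ?_, ?_⟩
  · intro y hy
    have hy' : y - p ≠ 0 := sub_ne_zero.2 hy
    apply ContinuousAt.continuousWithinAt
    by_cases hs : y - p ∈ Complex.slitPlane
    · exact hH'c.continuousAt.comp ((continuousAt_id.sub continuousAt_const).clog hs)
    · have hs' : p - y ∈ Complex.slitPlane := by
        rw [Complex.mem_slitPlane_iff] at hs ⊢
        push Not at hs
        left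
        have h1 : (y - p).re ≠ 0 := by
          intro h; exact hy' (Complex.ext h hs.2)
        have : (p - y).re = - (y - p).re := by simp
        rw [this]
        have := lt_of_le_of_ne hs.1 h1
        linarith
      have hca : ContinuousAt (fun y => H' (Complex.log (p - y) + Real.pi * Complex.I)) y :=
        hH'c.continuousAt.comp (((continuousAt_const.sub continuousAt_id).clog hs').add continuousAt_const)
      refine hca.congr ?_
      have hne : ∀ᶠ w in 𝓝 y, w ≠ p := isOpen_ne.mem_nhds hy
      filter_upwards [hne] with w hw
      apply hexpinv
      rw [Complex.exp_add, Complex.exp_log (sub_ne_zero.2 hw), Complex.exp_log (sub_ne_zero.2 hw.symm),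
        Complex.exp_pi_mul_I]; ring
  · intro y hy
    simp only
    rw [hH'e, hexplog y hy]
  · intro y hy
    have hyp : y ≠ p := by rintro rfl; simp at hy; linarith
    simp only
    rw [hH'R, hexplog y hyp]
    rw [hR, mem_ofPred_eq, Complex.log_re]
    exact Real.log_le_log (by linarith) hy

end UBC

namespace UBC

structure TFlow (φ : ℤ → ℂ → ℂ) (C : ℝ) : Prop where
  zero : ∀ z, φ 0 z = z
  add : ∀ i j z, φ (i + j) z = φ i (φ j z)
  cont : ∀ j, Continuous (φ j)
  lat : ∀ j z (a b : ℤ), φ j (z + (a + b * Complex.I)) = φ j z + (a + b * Complex.I)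
  one_le : 1 ≤ C
  bd : ∀ z, ‖φ 1 z - z‖ ≤ C

lemma TFlow.inj {φ : ℤ → ℂ → ℂ} {C : ℝ} (h : TFlow φ C) (j : ℤ) : Function.Injective (φ j) := by
  intro x y hxy
  have := congrArg (φ (-j)) hxy
  rwa [← h.add, ← h.add, neg_add_cancel, h.zero, h.zero] at this

lemma ball_one {q : ℂ} (h : ‖q - 1‖ < 1) : 0 < q.re := by
  have := (Complex.abs_re_le_norm (q - 1)).trans_lt h
  simp at this
  linarith [(abs_lt.1 this).1]

lemma W1 {φ : ℤ → ℂ → ℂ} {C : ℝ} (h : TFlow φ C) {K : Set ℂ} (hK : IsPreconnected K) {X : ℂ} (N : ℕ)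
    {c0 c1 : ℂ} (h0 : ∀ Y ∈ K, ‖(Y - X) / c0 - 1‖ < 1)
    (h1 : ∀ Y ∈ K, ‖(φ N Y - φ N X) / c1 - 1‖ < 1) {y y' : ℂ} (hy : y ∈ K) (hy' : y' ∈ K)
    (far : ∀ k : ℕ, k < N → 8 * C ≤ ‖φ k y - φ k X‖)
    (far' : ∀ k : ℕ, k < N → 8 * C ≤ ‖φ k y' - φ k X‖) :
    (∑ k ∈ Finset.range N, Complex.log ((φ (k + 1) y - φ (k + 1) X) / (φ k y - φ k X)))
      - Complex.log ((φ N y - φ N X) / c1) + Complex.log ((y - X) / c0) =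
    (∑ k ∈ Finset.range N, Complex.log ((φ (k + 1) y' - φ (k + 1) X) / (φ k y' - φ k X)))
      - Complex.log ((φ N y' - φ N X) / c1) + Complex.log ((y' - X) / c0) := by
  choose L hLc hLe hLf using fun k : ℕ =>
    log_lemma (h.cont 1) (h.inj 1) h.one_le h.bd (φ k X)
  have hs : ∀ (k : ℕ) (Y : ℂ), φ (k + 1) Y = φ 1 (φ k Y) := by
    intro k Y; rw [← h.add, add_comm]
  have hne : ∀ Y ∈ K, Y ≠ X := by
    rintro Y hY rfl
    have := h0 Y hY
    simp at this
  have hc0 : c0 ≠ 0 := by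
    rintro rfl
    have := h0 y hy
    simp at this
  have hc1 : c1 ≠ 0 := by
    rintro rfl
    have := h1 y hy
    simp at this
  have hnek : ∀ (k : ℤ), ∀ Y ∈ K, φ k Y ≠ φ k X := fun k Y hY hcon => hne Y hY (h.inj k hcon)
  set F : ℂ → ℂ := fun Y => (∑ k ∈ Finset.range N, L k (φ k Y))
      - Complex.log ((φ N Y - φ N X) / c1) + Complex.log ((Y - X) / c0) with hF
  have hFc : ContinuousOn F K := by
    refine ContinuousOn.add (ContinuousOn.sub ?_ ?_) ?_
    · refine continuousOn_finsetSum _ fun k _ => ?_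
      exact (hLc k).comp (h.cont k).continuousOn (fun Y hY => hnek k Y hY)
    · intro Y hY
      refine ContinuousWithinAt.clog ?_ (Or.inl (ball_one (h1 Y hY)))
      exact (((h.cont N).sub continuous_const).div_const _).continuousWithinAt
    · intro Y hY
      refine ContinuousWithinAt.clog ?_ (Or.inl (ball_one (h0 Y hY)))
      exact ((continuous_id.sub continuous_const).div_const _).continuousWithinAt
  have hFe : ∀ Y ∈ K, Complex.exp (F Y) = c1 / c0 := by
    intro Y hY
    have tel : ∀ n : ℕ, Complex.exp (∑ k ∈ Finset.range n, L k (φ k Y)) = (φ n Y - φ n X) / (Y - X) := by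
      intro n
      have d0 : Y - X ≠ 0 := sub_ne_zero.2 (hne Y hY)
      induction n with
      | zero => simp [h.zero, d0]
      | succ n ih =>
        rw [Finset.sum_range_succ, Complex.exp_add, ih, hLe n _ (hnek n Y hY)]
        push_cast
        rw [hs, hs]
        have d1 : φ n Y - φ n X ≠ 0 := sub_ne_zero.2 (hnek n Y hY)
        field_simp
    have d0 : Y - X ≠ 0 := sub_ne_zero.2 (hne Y hY)
    have d1 : φ N Y - φ N X ≠ 0 := sub_ne_zero.2 (hnek N Y hY)
    simp only [hF]
    rw [Complex.exp_add, Complex.exp_sub, tel, Complex.exp_log (div_ne_zero d1 hc1),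
      Complex.exp_log (div_ne_zero d0 hc0)]
    field_simp
  have hfin : ∀ Y, (∀ k : ℕ, k < N → 8 * C ≤ ‖φ k Y - φ k X‖) → F Y =
    (∑ k ∈ Finset.range N, Complex.log ((φ (k + 1) Y - φ (k + 1) X) / (φ k Y - φ k X)))
      - Complex.log ((φ N Y - φ N X) / c1) + Complex.log ((Y - X) / c0) := by
    intro Y hf
    simp only [hF]
    congr 2
    refine Finset.sum_congr rfl fun k hk => ?_
    rw [hLf k _ (hf k (Finset.mem_range.1 hk)), hs, hs]
  rw [← hfin y far, ← hfin y' far']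
  exact exp_const hK hFc hFe hy hy'

lemma arg_div_of_re_pos {u v : ℂ} (hu : 0 < u.re) (hv : 0 < v.re) : u.arg - v.arg = (u / v).arg := by
  have h1 := abs_lt.1 (Complex.abs_arg_lt_pi_div_two_iff.2 (Or.inl hu))
  have h2 := abs_lt.1 (Complex.abs_arg_lt_pi_div_two_iff.2 (Or.inl hv))
  have hu0 : u ≠ 0 := by rintro rfl; simp at hu
  have hv0 : v ≠ 0 := by rintro rfl; simp at hv
  have h3 : ((u/v).arg : Real.Angle) = ((u.arg - v.arg : ℝ) : Real.Angle) := by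
    rw [Complex.arg_div_coe_angle hu0 hv0]; rfl
  have := congrArg Real.Angle.toReal h3
  rw [Complex.arg_coe_angle_toReal_eq_arg, Real.Angle.toReal_coe_eq_self_iff.2 ⟨by linarith, by linarith⟩] at this
  exact this.symm

lemma telescope {w : ℕ → ℂ} {a σ : ℂ} (N : ℕ) (hσ : σ ≠ 0) (hp : ∀ k ≤ N, w k - a ≠ 0) (hm : ∀ k ≤ N, w k + a ≠ 0)
    (hqp : ∀ k < N, |((w (k+1) - a) / (w k - a)).arg| ≤ Real.pi / 4)
    (hqm : ∀ k < N, |((w (k+1) + a) / (w k + a)).arg| ≤ Real.pi / 4)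
    (hd : ∀ k < N, |(σ * ((w (k+1) - a) / (w (k+1) + a))).arg - (σ * ((w k - a) / (w k + a))).arg| < 3 * Real.pi / 2) :
    ∑ k ∈ Finset.range N, (((w (k+1) - a) / (w k - a)).arg - ((w (k+1) + a) / (w k + a)).arg)
      = (σ * ((w N - a) / (w N + a))).arg - (σ * ((w 0 - a) / (w 0 + a))).arg := by
  rw [← Finset.sum_range_sub (fun k => (σ * ((w k - a) / (w k + a))).arg)]
  refine Finset.sum_congr rfl fun k hk => ?_
  have hk' := Finset.mem_range.1 hk
  have a1 := hp k hk'.le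
  have a2 := hp (k+1) hk'
  have b1 := hm k hk'.le
  have b2 := hm (k+1) hk'
  have c1 := abs_le.1 (hqp k hk')
  have c2 := abs_le.1 (hqm k hk')
  have c3 := abs_lt.1 (hd k hk')
  have hpi := Real.pi_pos
  set p := (w (k+1) - a) / (w k - a)
  set m := (w (k+1) + a) / (w k + a)
  have key : ((σ * ((w (k+1) - a) / (w (k+1) + a))).arg : Real.Angle) =
      (((σ * ((w k - a) / (w k + a))).arg + (p.arg - m.arg) : ℝ) : Real.Angle) := by
    have e : σ * ((w (k+1) - a) / (w (k+1) + a)) = (σ * ((w k - a) / (w k + a))) * (p / m) := by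
      simp only [p, m]; field_simp
    have p0 : p ≠ 0 := div_ne_zero a2 a1
    have m0 : m ≠ 0 := div_ne_zero b2 b1
    rw [e, Complex.arg_mul_coe_angle (mul_ne_zero hσ (div_ne_zero a1 b1)) (div_ne_zero p0 m0),
      Complex.arg_div_coe_angle p0 m0]
    rfl
  obtain ⟨n, hn⟩ := Real.Angle.angle_eq_iff_two_pi_dvd_sub.1 key
  have hn0 : n = 0 := by
    by_contra hne
    have : (1:ℝ) ≤ |(n:ℝ)| := by exact_mod_cast Int.one_le_abs hne
    have hlt : |2 * Real.pi * (n:ℝ)| < 2 * Real.pi := by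
      rw [← hn, abs_lt]; constructor <;> linarith
    rw [abs_mul, abs_of_pos (by positivity)] at hlt
    nlinarith
  rw [hn0] at hn
  simp at hn
  linarith

lemma g_re {w a : ℂ} : ((w - a) / (w + a)).re = (‖w‖^2 - ‖a‖^2) / ‖w + a‖^2 := by
  rw [Complex.div_re, ← Complex.normSq_eq_norm_sq, ← Complex.normSq_eq_norm_sq, ← Complex.normSq_eq_norm_sq,
    ← add_div]
  congr 1
  simp [Complex.normSq_apply]; ring

lemma g_im {w a : ℂ} : ((w - a) / (w + a)).im = 2 * (w * (starRingEnd ℂ) a).im / ‖w + a‖^2 := by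
  rw [Complex.div_im, ← Complex.normSq_eq_norm_sq, ← sub_div]
  congr 1
  simp; ring

lemma arg_range_pos {g : ℂ} (hg : 0 < g.re ∨ 0 < g.im) : -(Real.pi/2) < g.arg ∧ g.arg ≤ Real.pi := by
  refine ⟨?_, Complex.arg_le_pi g⟩
  have hpi := Real.pi_pos
  rcases hg with h | h
  · exact (abs_lt.1 (Complex.abs_arg_lt_pi_div_two_iff.2 (Or.inl h))).1
  · have := Complex.arg_nonneg_iff.2 h.le
    linarith

lemma arg_range_neg {g : ℂ} (hg : 0 < g.re ∨ g.im < 0) : -Real.pi < g.arg ∧ g.arg < Real.pi/2 := by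
  refine ⟨Complex.neg_pi_lt_arg g, ?_⟩
  have hpi := Real.pi_pos
  rcases hg with h | h
  · exact (abs_lt.1 (Complex.abs_arg_lt_pi_div_two_iff.2 (Or.inl h))).2
  · have := Complex.arg_neg_iff.2 h
    linarith

end UBC

namespace UBC

/-- The winding argument. -/
lemma W2core {φ : ℤ → ℂ → ℂ} {C : ℝ} (h : TFlow φ C) {K : Set ℂ} (hK : IsPreconnected K)
    {z z' : ℂ} (hz : z ∈ K) (hz' : z' ∈ K) (x : ℂ) (a : ℂ) (a0 b0 : ℤ) (ha : a = a0 + b0 * Complex.I)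
    (s e : ℕ)
    (far : ∀ j : ℤ, -s ≤ j → j ≤ e → 8 * C ≤ ‖φ j z - φ j x - a‖ ∧ 8 * C ≤ ‖φ j z - φ j x + a‖)
    (far' : ∀ j : ℤ, -s ≤ j → j ≤ e → 8 * C ≤ ‖φ j z' - φ j x - a‖ ∧ 8 * C ≤ ‖φ j z' - φ j x + a‖)
    (hpos : ∀ j : ℤ, 0 ≤ j → j ≤ e →
      ‖φ j z - φ j x‖ < ‖a‖ ∨ ((φ j z - φ j x) * (starRingEnd ℂ) a).im < 0)
    (hneg : ∀ j : ℤ, -s ≤ j → j ≤ 0 →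
      ‖φ j z - φ j x‖ < ‖a‖ ∨ 0 < ((φ j z - φ j x) * (starRingEnd ℂ) a).im)
    (hende : ((φ e z - φ e x) * (starRingEnd ℂ) a).im < 0)
    (hends : 0 < ((φ (-s) z - φ (-s) x) * (starRingEnd ℂ) a).im)
    (hz'far : ∀ j : ℤ, -s ≤ j → j ≤ e → ‖a‖ < ‖φ j z' - φ j x‖)
    (Ee : ∀ y ∈ K, ‖φ e y - φ e z'‖ + ‖a‖ < ‖φ e z' - φ e x‖)
    (Es : ∀ y ∈ K, ‖φ (-s) y - φ (-s) z'‖ + ‖a‖ < ‖φ (-s) z' - φ (-s) x‖) : False := by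
  have hpi := Real.pi_pos
  have hC := h.one_le
  set N : ℕ := s + e with hN
  set w : ℂ → ℕ → ℂ := fun y k => φ ((k:ℤ) - s) y - φ ((k:ℤ) - s) x with hw
  have sh : ∀ (k : ℤ) (y : ℂ), φ k (φ (-s) y) = φ (k - s) y := by
    intro k y; rw [← h.add, sub_eq_add_neg]
  have hNs : ((N:ℕ):ℤ) - s = e := by rw [hN]; push_cast; ring
  have hp : ∀ (k : ℤ) (y : ℂ), φ k (φ (-s) y) - φ k (φ (-s) x + a) = φ (k - s) y - φ (k-s) x - a := by
    intro k y; rw [ha, h.lat, sh, sh]; ring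
  have hm : ∀ (k : ℤ) (y : ℂ), φ k (φ (-s) y) - φ k (φ (-s) x - a) = φ (k - s) y - φ (k-s) x + a := by
    intro k y
    have : φ (-s) x - a = φ (-s) x + (((-a0 : ℤ) : ℂ) + ((-b0 : ℤ) : ℂ) * Complex.I) := by
      rw [ha]; push_cast; ring
    rw [this, h.lat, sh, sh, ha]; push_cast; ring
  have hK' : IsPreconnected (φ (-s) '' K) := hK.image _ (h.cont _).continuousOn
  set c0 : ℂ := φ (-s) z' - φ (-s) x with hc0
  set c1 : ℂ := φ e z' - φ e x with hc1
  have est : ∀ (u c a : ℂ), ‖u - c‖ + ‖a‖ < ‖c‖ → ‖(u - a)/c - 1‖ < 1 ∧ ‖(u + a)/c - 1‖ < 1 := by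
    intro u c a hu
    have hcp : 0 < ‖c‖ := by have := norm_nonneg (u-c); have := norm_nonneg a; linarith
    have hc : c ≠ 0 := norm_pos_iff.1 hcp
    have e1 : (u - a)/c - 1 = ((u - c) - a)/c := by field_simp; ring
    have e2 : (u + a)/c - 1 = ((u - c) + a)/c := by field_simp; ring
    rw [e1, e2, norm_div, norm_div, div_lt_one hcp, div_lt_one hcp]
    exact ⟨(norm_sub_le _ _).trans_lt hu, (norm_add_le _ _).trans_lt hu⟩
  have est1 : ∀ y ∈ K, ‖(φ e y - φ e x - a)/c1 - 1‖ < 1 ∧ ‖(φ e y - φ e x + a)/c1 - 1‖ < 1 := by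
    intro y hy
    apply est
    have : φ e y - φ e x - c1 = φ e y - φ e z' := by rw [hc1]; ring
    rw [this]; exact Ee y hy
  have est0 : ∀ y ∈ K, ‖(φ (-s) y - φ (-s) x - a)/c0 - 1‖ < 1 ∧ ‖(φ (-s) y - φ (-s) x + a)/c0 - 1‖ < 1 := by
    intro y hy
    apply est
    have : φ (-s) y - φ (-s) x - c0 = φ (-s) y - φ (-s) z' := by rw [hc0]; ring
    rw [this]; exact Es y hy
  have wp := W1 h hK' (X := φ (-s) x + a) N (c0 := c0) (c1 := c1)
    (by rintro _ ⟨y, hy, rfl⟩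
        have := (est0 y hy).1
        rwa [show φ (-s) y - (φ (-s) x + a) = φ (-s) y - φ (-s) x - a by ring])
    (by rintro _ ⟨y, hy, rfl⟩
        rw [hp, hNs]
        exact (est1 y hy).1) (mem_image_of_mem _ hz) (mem_image_of_mem _ hz')
    (by intro k hk; rw [hp]; exact (far _ (by omega) (by omega)).1)
    (by intro k hk; rw [hp]; exact (far' _ (by omega) (by omega)).1)
  have wm := W1 h hK' (X := φ (-s) x - a) N (c0 := c0) (c1 := c1)
    (by rintro _ ⟨y, hy, rfl⟩
        have := (est0 y hy).2
        rwa [show φ (-s) y - (φ (-s) x - a) = φ (-s) y - φ (-s) x + a by ring])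
    (by rintro _ ⟨y, hy, rfl⟩
        rw [hm, hNs]
        exact (est1 y hy).2) (mem_image_of_mem _ hz) (mem_image_of_mem _ hz')
    (by intro k hk; rw [hm]; exact (far _ (by omega) (by omega)).2)
    (by intro k hk; rw [hm]; exact (far' _ (by omega) (by omega)).2)
  simp only [hp, hm, hNs] at wp wm
  have r1 : ∀ y, φ (-s) y - (φ (-s) x + a) = φ (-s) y - φ (-s) x - a := fun y => by ring
  have r2 : ∀ y, φ (-s) y - (φ (-s) x - a) = φ (-s) y - φ (-s) x + a := fun y => by ring
  rw [r1, r1] at wp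
  rw [r2, r2] at wm
  have wp' := congrArg Complex.im wp
  have wm' := congrArg Complex.im wm
  simp only [Complex.add_im, Complex.sub_im, Complex.im_sum, Complex.log_im] at wp' wm'
  -- telescoping
  have ne : ∀ {u : ℂ}, 8 * C ≤ ‖u‖ → u ≠ 0 := by
    rintro u hu rfl; simp at hu; linarith
  have stepbd : ∀ y k, ‖w y (k+1) - w y k‖ ≤ 2 * C := by
    intro y k
    have e1 : ((k + 1 : ℕ) : ℤ) - s = 1 + ((k:ℤ) - s) := by push_cast; ring
    simp only [hw]
    rw [e1, h.add, h.add]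
    have b1 := h.bd (φ ((k:ℤ)-s) y)
    have b2 := h.bd (φ ((k:ℤ)-s) x)
    calc _ = ‖(φ 1 (φ ((k:ℤ)-s) y) - φ ((k:ℤ)-s) y) - (φ 1 (φ ((k:ℤ)-s) x) - φ ((k:ℤ)-s) x)‖ := by congr 1; ring
      _ ≤ _ := (norm_sub_le _ _).trans (by linarith)
  have qn : ∀ (u v : ℂ), ‖u - v‖ ≤ 2 * C → 8 * C ≤ ‖v‖ → |(u / v).arg| ≤ Real.pi/4 := by
    intro u v huv hv
    refine (near_one ?_).2
    have e1 : u / v - 1 = (u - v)/v := by have := ne hv; field_simp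
    rw [e1, norm_div, div_le_iff₀ (by linarith)]; linarith
  have tel : ∀ (y σ : ℂ), σ ≠ 0 →
      (∀ j : ℤ, -s ≤ j → j ≤ e → 8 * C ≤ ‖φ j y - φ j x - a‖ ∧ 8 * C ≤ ‖φ j y - φ j x + a‖) →
      (∀ k < N, |(σ * ((w y (k+1) - a) / (w y (k+1) + a))).arg - (σ * ((w y k - a) / (w y k + a))).arg| < 3 * Real.pi / 2) →
      ∑ k ∈ Finset.range N, (((w y (k+1) - a) / (w y k - a)).arg - ((w y (k+1) + a) / (w y k + a)).arg)
      = (σ * ((w y N - a) / (w y N + a))).arg - (σ * ((w y 0 - a) / (w y 0 + a))).arg := by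
    intro y σ hσ hf hd
    refine telescope N hσ ?_ ?_ ?_ ?_ hd
    · intro k hk; exact ne (hf _ (by omega) (by omega)).1
    · intro k hk; exact ne (hf _ (by omega) (by omega)).2
    · intro k hk; refine qn _ _ ?_ (hf _ (by omega) (by omega)).1
      rw [show w y (k+1) - a - (w y k - a) = w y (k+1) - w y k by ring]; exact stepbd y k
    · intro k hk; refine qn _ _ ?_ (hf _ (by omega) (by omega)).2
      rw [show w y (k+1) + a - (w y k + a) = w y (k+1) - w y k by ring]; exact stepbd y k
  have sqpos : ∀ {u : ℂ}, 8 * C ≤ ‖u‖ → 0 < ‖u‖^2 := fun hu => by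
    have : 0 < ‖_‖ := norm_pos_iff.2 (ne hu)
    positivity
  have tz := tel z (-1) (by norm_num) far (by
    intro k hk
    rw [abs_lt]
    simp only [neg_mul, one_mul]
    by_cases hks : s ≤ k
    · have rng : ∀ m : ℕ, s ≤ m → m ≤ N → -(Real.pi/2) < (-((w z m - a) / (w z m + a))).arg ∧ (-((w z m - a) / (w z m + a))).arg ≤ Real.pi := by
        intro m h1 h2
        apply arg_range_pos
        have fs := sqpos (far ((m:ℤ)-s) (by omega) (by omega)).2
        rcases hpos ((m:ℤ)-s) (by omega) (by omega) with h3 | h3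
        · left
          rw [Complex.neg_re, g_re, neg_pos]
          refine div_neg_of_neg_of_pos ?_ fs
          have := norm_nonneg (w z m)
          simp only [hw] at this ⊢
          nlinarith
        · right
          rw [Complex.neg_im, g_im, neg_pos]
          exact div_neg_of_neg_of_pos (by simp only [hw]; linarith) fs
      have A := rng k hks (by omega)
      have B := rng (k+1) (by omega) (by omega)
      constructor <;> linarith
    · have rng : ∀ m : ℕ, m ≤ s → m ≤ N → -Real.pi < (-((w z m - a) / (w z m + a))).arg ∧ (-((w z m - a) / (w z m + a))).arg < Real.pi/2 := by
        intro m h1 h2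
        apply arg_range_neg
        have fs := sqpos (far ((m:ℤ)-s) (by omega) (by omega)).2
        rcases hneg ((m:ℤ)-s) (by omega) (by omega) with h3 | h3
        · left
          rw [Complex.neg_re, g_re, neg_pos]
          refine div_neg_of_neg_of_pos ?_ fs
          have := norm_nonneg (w z m)
          simp only [hw] at this ⊢
          nlinarith
        · right
          rw [Complex.neg_im, g_im, neg_lt_zero]
          exact div_pos (by simp only [hw]; linarith) fs
      have A := rng k (by omega) (by omega)
      have B := rng (k+1) (by omega) (by omega)
      constructor <;> linarith)
  have tz' := tel z' 1 one_ne_zero far' (by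
    intro k hk
    rw [abs_lt]
    simp only [one_mul]
    have rng : ∀ m : ℕ, m ≤ N → |((w z' m - a) / (w z' m + a)).arg| < Real.pi/2 := by
      intro m h2
      apply Complex.abs_arg_lt_pi_div_two_iff.2
      left
      have fs := sqpos (far' ((m:ℤ)-s) (by omega) (by omega)).2
      have h3 := hz'far ((m:ℤ)-s) (by omega) (by omega)
      rw [g_re]
      refine div_pos ?_ fs
      have := norm_nonneg a
      simp only [hw] at this ⊢
      nlinarith
    have A := abs_lt.1 (rng k (by omega))
    have B := abs_lt.1 (rng (k+1) (by omega))
    constructor <;> linarith)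
  have q : ∀ y ∈ K, ((φ e y - φ e x - a)/c1).arg - ((φ e y - φ e x + a)/c1).arg = ((φ e y - φ e x - a)/(φ e y - φ e x + a)).arg := by
    intro y hy
    rw [arg_div_of_re_pos (ball_one (est1 y hy).1) (ball_one (est1 y hy).2), div_div_div_cancel_right₀]
    rintro h0
    have := (est1 y hy).1
    rw [h0] at this; simp at this
  have q0 : ∀ y ∈ K, ((φ (-s) y - φ (-s) x - a)/c0).arg - ((φ (-s) y - φ (-s) x + a)/c0).arg = ((φ (-s) y - φ (-s) x - a)/(φ (-s) y - φ (-s) x + a)).arg := by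
    intro y hy
    rw [arg_div_of_re_pos (ball_one (est0 y hy).1) (ball_one (est0 y hy).2), div_div_div_cancel_right₀]
    rintro h0
    have := (est0 y hy).1
    rw [h0] at this; simp at this
  have qz := q z hz
  have qz' := q z' hz'
  have q0z := q0 z hz
  have q0z' := q0 z' hz'
  have hcast : ∀ k : ℕ, ((k + 1 : ℕ) : ℤ) - s = (k : ℤ) + 1 - s := by intro k; push_cast; ring
  rw [Finset.sum_sub_distrib] at tz tz'
  simp only [hw, hNs, hcast, Nat.cast_zero, zero_sub, neg_mul, one_mul] at tz tz'
  have fe := sqpos (far e (by omega) (by omega)).2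
  have fs := sqpos (far (-s) (by omega) (by omega)).2
  have ge : ((φ e z - φ e x - a)/(φ e z - φ e x + a)).im < 0 := by
    rw [g_im]; exact div_neg_of_neg_of_pos (by linarith) fe
  have gs : 0 < ((φ (-s) z - φ (-s) x - a)/(φ (-s) z - φ (-s) x + a)).im := by
    rw [g_im]; exact div_pos (by linarith) fs
  have n1 := Complex.arg_neg_eq_arg_add_pi_of_im_neg ge
  have n2 := Complex.arg_neg_eq_arg_sub_pi_of_im_pos gs
  linarith

end UBC

namespace UBC

def dot (m v : ℂ) : ℝ := m.re * v.re + m.im * v.im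

lemma dot_add (m v w : ℂ) : dot m (v + w) = dot m v + dot m w := by simp [dot]; ring
lemma dot_sub (m v w : ℂ) : dot m (v - w) = dot m v - dot m w := by simp [dot]; ring
lemma dot_neg (m v : ℂ) : dot m (-v) = - dot m v := by simp [dot]; ring
lemma dot_real (m v : ℂ) (t : ℝ) : dot m (t * v) = t * dot m v := by simp [dot]; ring
lemma dot_int (m v : ℂ) (t : ℤ) : dot m (t * v) = t * dot m v := by
  have := dot_real m v (t:ℝ)
  simpa using this
lemma norm_sq_dot (v : ℂ) : ‖v‖^2 = dot v v := by
  rw [← Complex.normSq_eq_norm_sq, Complex.normSq_apply]; rfl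
lemma dot_le (m v : ℂ) : |dot m v| ≤ ‖m‖ * ‖v‖ := by
  apply abs_le_of_sq_le_sq _ (by positivity)
  rw [mul_pow, norm_sq_dot, norm_sq_dot]
  simp only [dot]
  nlinarith [sq_nonneg (m.re * v.im - m.im * v.re)]

structure Rot (φ : ℤ → ℂ → ℂ) (P : Set ℂ) : Prop where
  D : ∀ ε > 0, ∃ S0 : ℝ, ∀ S ≥ S0, ∀ j : ℤ, 0 ≤ j → (j:ℝ) ≤ S → ∀ z, ∃ v ∈ P,
    ‖φ j z - z - j * v‖ ≤ ε * S
  R : ∀ A ∈ P, ∀ ε > 0, ∀ N : ℤ, ∃ n ≥ N, ∃ z, ‖φ n z - z - n * A‖ ≤ ε * n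

def SE (P : Set ℂ) (A m : ℂ) : Prop := A ∈ P ∧ ∀ v ∈ P, ‖v - A‖^2 ≤ 2 * dot m (A - v)

def drop (φ : ℤ → ℂ → ℂ) (A m : ℂ) (j : ℤ) (z : ℂ) : ℝ := dot m (j * A - (φ j z - z))

variable {φ : ℤ → ℂ → ℂ} {C : ℝ} {P : Set ℂ}

lemma drop_add (h : TFlow φ C) (A m : ℂ) (i j : ℤ) (z : ℂ) :
    drop φ A m (i + j) z = drop φ A m i (φ j z) + drop φ A m j z := by
  simp only [drop]
  rw [← dot_add, h.add]
  congr 1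
  push_cast; ring

lemma drop_ge {A m : ℂ} (hA : SE P A m) {j : ℤ} (hj : 0 ≤ j) {z v : ℂ} (hv : v ∈ P) {r : ℝ}
    (hr : ‖φ j z - z - j * v‖ ≤ r) : j * dot m (A - v) - ‖m‖ * r ≤ drop φ A m j z := by
  simp only [drop]
  have e : (j:ℂ) * A - (φ j z - z) = j * (A - v) - (φ j z - z - j * v) := by ring
  rw [e, dot_sub m ((j:ℂ) * (A - v)) _, dot_int]
  have := (le_abs_self _).trans (dot_le m (φ j z - z - j * v))
  have h2 : ‖m‖ * ‖φ j z - z - j * v‖ ≤ ‖m‖ * r := mul_le_mul_of_nonneg_left hr (norm_nonneg _)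
  linarith

lemma SE.dot_nonneg {A m : ℂ} (hA : SE P A m) {v : ℂ} (hv : v ∈ P) : 0 ≤ dot m (A - v) := by
  have := hA.2 v hv
  have := sq_nonneg ‖v - A‖
  linarith

lemma drop_ge' {A m : ℂ} (hA : SE P A m) {j : ℤ} (hj : 0 ≤ j) {z v : ℂ} (hv : v ∈ P) {r : ℝ}
    (hr : ‖φ j z - z - j * v‖ ≤ r) : - (‖m‖ * r) ≤ drop φ A m j z := by
  have := drop_ge hA hj hv hr
  have h2 : 0 ≤ (j:ℝ) * dot m (A - v) := mul_nonneg (by exact_mod_cast hj) (hA.dot_nonneg hv)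
  linarith

lemma small_drop (h : TFlow φ C) {A m : ℂ} (hA : SE P A m) {b : ℤ} {ε κ : ℝ}
    (hD : ∀ j : ℤ, 0 ≤ j → j ≤ b → ∀ z, ∃ v ∈ P, ‖φ j z - z - j * v‖ ≤ ε * b)
    {y : ℂ} (hy : drop φ A m b y ≤ κ * b) {i j : ℤ} (hi : 0 ≤ i) (hij : i ≤ j) (hj : j ≤ b) :
    ‖φ j y - φ i y - ((j:ℂ) - i) * A‖ ≤ (ε + Real.sqrt (2 * (κ + 3 * ‖m‖ * ε))) * b := by
  have hb : (0:ℝ) ≤ b := by exact_mod_cast (by omega : 0 ≤ b)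
  obtain ⟨v1, hv1, r1⟩ := hD i hi (by omega) y
  obtain ⟨v2, hv2, r2⟩ := hD (b - j) (by omega) (by omega) (φ j y)
  obtain ⟨v, hv, r⟩ := hD (j - i) (by omega) (by omega) (φ i y)
  have d1 := drop_ge' hA hi hv1 r1
  have d2 := drop_ge' hA (by omega : 0 ≤ b - j) hv2 r2
  have d3 := drop_ge hA (by omega : 0 ≤ j - i) hv r
  have s1 : drop φ A m b y = drop φ A m (b - j) (φ j y) + drop φ A m (j - i) (φ i y) + drop φ A m i y := by
    have e1 := drop_add h A m (b - j) j y
    have e2 := drop_add h A m (j - i) i y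
    rw [sub_add_cancel] at e1 e2
    linarith
  have hji : φ (j - i) (φ i y) = φ j y := by rw [← h.add, sub_add_cancel]
  rw [hji] at r
  set t : ℝ := ((j - i : ℤ) : ℝ) with ht
  have ht0 : 0 ≤ t := by rw [ht]; exact_mod_cast (by omega : 0 ≤ j - i)
  have htb : t ≤ b := by rw [ht]; exact_mod_cast (by omega : j - i ≤ b)
  have key : t * dot m (A - v) ≤ (κ + 3 * ‖m‖ * ε) * b := by nlinarith
  have hse := hA.2 v hv
  have hsq : (t * ‖v - A‖)^2 ≤ (2 * (κ + 3 * ‖m‖ * ε)) * b^2 := by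
    have hd := hA.dot_nonneg hv
    calc (t * ‖v - A‖)^2 = t * (t * ‖v - A‖^2) := by ring
      _ ≤ t * (t * (2 * dot m (A - v))) := by gcongr
      _ = 2 * (t * (t * dot m (A - v))) := by ring
      _ ≤ 2 * (b * ((κ + 3 * ‖m‖ * ε) * b)) := by
          have : 0 ≤ t * dot m (A - v) := mul_nonneg ht0 hd
          gcongr
      _ = _ := by ring
  have hle : t * ‖v - A‖ ≤ Real.sqrt (2 * (κ + 3 * ‖m‖ * ε)) * b := by
    have h1 := Real.le_sqrt_of_sq_le hsq
    rwa [Real.sqrt_mul' _ (sq_nonneg _), Real.sqrt_sq hb] at h1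
  have e : φ j y - φ i y - ((j:ℂ) - i) * A = (φ j y - φ i y - ((j - i : ℤ) : ℂ) * v) + (t:ℂ) * (v - A) := by
    rw [ht]; push_cast; ring
  rw [e]
  refine (norm_add_le _ _).trans ?_
  rw [norm_mul, Complex.norm_real, Real.norm_of_nonneg ht0]
  linarith

lemma pick_block (h : TFlow φ C) (A m : ℂ) (b : ℤ) (Q : ℕ) (hQ : 0 < Q) (z : ℂ) {T : ℝ}
    (hT : drop φ A m (Q * b) z ≤ Q * T) : ∃ k : ℕ, k < Q ∧ drop φ A m b (φ (k * b) z) ≤ T := by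
  have hsum : ∀ n : ℕ, drop φ A m (n * b) z = ∑ k ∈ Finset.range n, drop φ A m b (φ (k * b) z) := by
    intro n
    induction n with
    | zero => simp [drop, h.zero, dot]
    | succ n ih =>
      rw [Finset.sum_range_succ, ← ih]
      have e : ((n + 1 : ℕ) : ℤ) * b = b + n * b := by push_cast; ring
      rw [e, drop_add h, add_comm]
  by_contra hcon
  push Not at hcon
  rw [hsum] at hT
  have : ∑ k ∈ Finset.range Q, T < ∑ k ∈ Finset.range Q, drop φ A m b (φ (k * b) z) := by
    apply Finset.sum_lt_sum_of_nonempty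
    · exact Finset.nonempty_range_iff.2 hQ.ne'
    · intro k hk; exact hcon k (Finset.mem_range.1 hk)
  simp at this
  linarith

lemma exists_eps (a η : ℝ) (hη : 0 < η) : ∃ ε > 0, ε ≤ η ∧ ε + Real.sqrt (a * ε) ≤ η := by
  have hc : Tendsto (fun ε : ℝ => ε + Real.sqrt (a * ε)) (𝓝[>] 0) (𝓝 0) := by
    have : Continuous (fun ε : ℝ => ε + Real.sqrt (a * ε)) := by fun_prop
    have h0 := this.tendsto 0
    simp at h0
    exact h0.mono_left nhdsWithin_le_nhds
  have h1 := hc.eventually (gt_mem_nhds hη)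
  have h2 : ∀ᶠ ε : ℝ in 𝓝[>] 0, 0 < ε := eventually_mem_nhdsWithin
  obtain ⟨ε, h3, h4⟩ := (h1.and h2).exists
  exact ⟨ε, h4, by have := Real.sqrt_nonneg (a*ε); linarith, h3.le⟩

/-- existence of straight orbit pieces -/
lemma straight (h : TFlow φ C) (hP : Rot φ P) {A m : ℂ} (hA : SE P A m) {η : ℝ} (hη : 0 < η) :
    ∃ S0 : ℝ, ∀ S ≥ S0, ∃ x, ∀ j : ℤ, |(j:ℝ)| ≤ S → ‖φ j x - x - j * A‖ ≤ η * S := by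
  have hm := norm_nonneg m
  obtain ⟨ε, hε, -, hε2⟩ := exists_eps (2 * (6 * ‖m‖)) (η / 4) (by positivity)
  obtain ⟨S1, hS1⟩ := hP.D ε hε
  refine ⟨max S1 1, fun S hS => ?_⟩
  have hSS1 : S1 ≤ S := (le_max_left _ _).trans hS
  have hS1' : 1 ≤ S := (le_max_right _ _).trans hS
  set n : ℕ := ⌈S⌉₊ with hn
  have hn1 : S ≤ n := Nat.le_ceil S
  have hn2 : (n:ℝ) ≤ 2 * S := by have := Nat.ceil_lt_add_one (by linarith : 0 ≤ S); linarith
  set b : ℤ := 2 * n with hb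
  have hbr : (b:ℝ) = 2 * n := by rw [hb]; push_cast; ring
  have hb0 : 0 < b := by
    have : (0:ℝ) < b := by linarith
    exact_mod_cast this
  have hD : ∀ j : ℤ, 0 ≤ j → j ≤ b → ∀ z, ∃ v ∈ P, ‖φ j z - z - j * v‖ ≤ ε * b := by
    intro j h0 h1 z
    exact hS1 b (by rw [hbr]; linarith) j h0 (by exact_mod_cast h1) z
  obtain ⟨n', hn', z, hz⟩ := hP.R A hA.1 ε hε b
  set Q : ℕ := (n' / b).toNat with hQ
  have hQi : ((Q:ℕ):ℤ) = n' / b := Int.toNat_of_nonneg (Int.ediv_nonneg (by omega) hb0.le)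
  have hQ1 : 1 ≤ n' / b := by
    rw [Int.le_ediv_iff_mul_le hb0]; omega
  have hQpos : 0 < Q := by omega
  have hdecomp : (n' % b) + Q * b = n' := by rw [hQi, mul_comm]; exact Int.emod_add_mul_ediv n' b
  have hr0 := Int.emod_nonneg n' hb0.ne'
  have hrb := Int.emod_lt_of_pos n' hb0
  have hdn : drop φ A m n' z ≤ ‖m‖ * (ε * n') := by
    simp only [drop]
    have := (le_abs_self _).trans (dot_le m ((n':ℂ) * A - (φ n' z - z)))
    refine this.trans ?_
    rw [norm_sub_rev]
    gcongr
  have hds := drop_add h A m (n' % b) (Q * b) z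
  rw [hdecomp] at hds
  obtain ⟨v, hv, hvr⟩ := hD (n' % b) hr0 hrb.le (φ (Q * b) z)
  have hge := drop_ge' hA hr0 hv hvr
  have hQb : (n':ℝ) ≤ (Q + 1) * b := by
    have : n' ≤ (Q + 1) * b := by linarith
    exact_mod_cast this
  have hbpos : (0:ℝ) < b := by exact_mod_cast hb0
  have hQr : (1:ℝ) ≤ Q := by exact_mod_cast hQpos
  have hmε : 0 ≤ ‖m‖ * ε := by positivity
  obtain ⟨k, hk, hkd⟩ := pick_block h A m b Q hQpos z (T := 3 * ‖m‖ * ε * b) (by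
    have h1 : ‖m‖ * (ε * n') ≤ ‖m‖ * ε * ((Q + 1) * b) := by
      rw [← mul_assoc]; gcongr
    have h2 : ‖m‖ * ε * b * 1 ≤ ‖m‖ * ε * b * Q := by gcongr
    nlinarith)
  set y := φ (k * b) z
  have hsd := fun i j (hi : 0 ≤ i) (hij : i ≤ j) (hj : j ≤ b) =>
    small_drop h hA (b := b) (ε := ε) (κ := 3 * ‖m‖ * ε) hD hkd (i := i) (j := j) hi hij hj
  have hfin : (ε + Real.sqrt (2 * (3 * ‖m‖ * ε + 3 * ‖m‖ * ε))) * b ≤ η * S := by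
    have e : 2 * (3 * ‖m‖ * ε + 3 * ‖m‖ * ε) = 2 * (6 * ‖m‖) * ε := by ring
    rw [e]
    calc _ ≤ η / 4 * b := by gcongr
      _ ≤ η / 4 * (4 * S) := by gcongr; linarith
      _ = _ := by ring
  refine ⟨φ n y, fun j hj => ?_⟩
  have hj' : |j| ≤ n := by
    have : |(j:ℝ)| ≤ n := hj.trans hn1
    exact_mod_cast this
  have hj2 := abs_le.1 hj'
  have hadd : φ j (φ n y) = φ (j + n) y := (h.add _ _ _).symm
  rw [hadd]
  rcases le_total 0 j with h0 | h0
  · have := hsd n (j + n) (by omega) (by omega) (by omega)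
    have e : φ (j + n) y - φ n y - j * A = φ (j + n) y - φ n y - (((j + n : ℤ) : ℂ) - (n : ℤ)) * A := by
      push_cast; ring
    rw [e]; exact this.trans hfin
  · have := hsd (j + n) n (by omega) (by omega) (by omega)
    have e : φ (j + n) y - φ n y - j * A = -(φ n y - φ (j + n) y - (((n : ℤ) : ℂ) - ((j + n : ℤ) : ℂ)) * A) := by
      push_cast; ring
    rw [e, norm_neg]; exact this.trans hfin

lemma SE_of_far {o A : ℂ} (hA : A ∈ P) (hfar : ∀ v ∈ P, ‖v - o‖ ≤ ‖A - o‖) : SE P A (A - o) := by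
  refine ⟨hA, fun v hv => ?_⟩
  have h1 := hfar v hv
  have h2 : ‖v - o‖^2 ≤ ‖A - o‖^2 := by gcongr
  rw [norm_sq_dot, norm_sq_dot] at h2
  rw [norm_sq_dot]
  simp only [dot, Complex.sub_re, Complex.sub_im] at *
  nlinarith

lemma exists_far (hP : IsCompact P) (hne : P.Nonempty) (o : ℂ) : ∃ A ∈ P, ∀ v ∈ P, ‖v - o‖ ≤ ‖A - o‖ := by
  obtain ⟨A, hA, hm⟩ := hP.exists_isMaxOn hne (f := fun v => ‖v - o‖) (by fun_prop)
  exact ⟨A, hA, fun v hv => hm hv⟩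

def cross (u v : ℂ) : ℝ := u.re * v.im - u.im * v.re

lemma triple (hP : IsCompact P) (hint : (interior P).Nonempty) :
    ∃ A B D mA mB mD, SE P A mA ∧ SE P B mB ∧ SE P D mD ∧ cross (B - A) (D - A) ≠ 0 := by
  have hne : P.Nonempty := hint.mono interior_subset
  obtain ⟨p0, hp0⟩ := hint
  obtain ⟨r, hr, hball⟩ := Metric.isOpen_iff.1 isOpen_interior p0 hp0
  have hballP : ∀ v : ℂ, ‖v‖ < r → p0 + v ∈ P := fun v hv =>
    interior_subset (hball (by simpa [Metric.mem_ball, dist_eq_norm] using hv))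
  obtain ⟨A, hA, hAf⟩ := exists_far hP hne 0
  obtain ⟨B, hB, hBf⟩ := exists_far hP hne A
  have hBA : B - A ≠ 0 := by
    intro h0
    have h1 := hBf p0 (by simpa using hballP 0 (by simpa using hr))
    have h2 := hBf (p0 + (r/2 : ℝ)) (hballP _ (by rw [Complex.norm_real, Real.norm_of_nonneg (by positivity)]; linarith))
    rw [h0, norm_zero] at h1 h2
    have h1' := norm_le_zero_iff.1 h1
    have h2' := norm_le_zero_iff.1 h2
    have : ((r/2 : ℝ) : ℂ) = 0 := by linear_combination h2' - h1'
    rw [Complex.ofReal_eq_zero] at this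
    linarith
  set d := B - A with hd
  have hdn : 0 < ‖d‖ := norm_pos_iff.2 hBA
  obtain ⟨p, hp, hpc⟩ : ∃ p ∈ P, cross d (p - A) ≠ 0 := by
    by_cases hc : cross d (p0 - A) = 0
    · set τ : ℝ := r / (2 * ‖d‖) with hτ
      refine ⟨p0 + τ * (Complex.I * d), hballP _ ?_, ?_⟩
      · rw [norm_mul, norm_mul, Complex.norm_real, Complex.norm_I, Real.norm_of_nonneg (by positivity), hτ]
        field_simp; linarith
      · have e : cross d (p0 + τ * (Complex.I * d) - A) = cross d (p0 - A) + τ * ‖d‖^2 := by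
          rw [norm_sq_dot]; simp [cross, dot]; ring
        rw [e, hc, zero_add]; positivity
    · exact ⟨p0, by simpa using hballP 0 (by simpa using hr), hc⟩
  obtain ⟨N, hN1, hN2⟩ : ∃ N : ℂ, 0 < dot N (p - A) ∧ ∀ v, cross d v = 0 → dot N v = 0 := by
    rcases lt_or_gt_of_ne hpc with hc | hc
    · refine ⟨-(Complex.I * d), ?_, ?_⟩
      · simp [dot, cross] at hc ⊢; linarith
      · intro v hv; simp [dot, cross] at hv ⊢; linarith
    · refine ⟨Complex.I * d, ?_, ?_⟩
      · simp [dot, cross] at hc ⊢; linarith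
      · intro v hv; simp [dot, cross] at hv ⊢; linarith
  set t : ℝ := (‖d‖^2 + 1) / (2 * dot N (p - A)) with ht
  have ht2 : 2 * t * dot N (p - A) = ‖d‖^2 + 1 := by rw [ht]; field_simp
  obtain ⟨D, hD, hDf⟩ := exists_far hP hne (A - t * N)
  refine ⟨A, B, D, A - 0, B - A, D - (A - t * N), SE_of_far hA hAf, SE_of_far hB hBf, SE_of_far hD hDf, ?_⟩
  intro hc
  have h1 := hN2 _ hc
  have h2 : ‖p - (A - t * N)‖^2 ≤ ‖D - (A - t * N)‖^2 := by
    have := hDf p hp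
    gcongr
  have h3 : ‖D - A‖^2 ≤ ‖d‖^2 := by
    have := hBf D hD
    gcongr
  have e1 : ∀ q : ℂ, ‖q - (A - t * N)‖^2 = ‖q - A‖^2 + 2 * t * dot N (q - A) + t^2 * ‖N‖^2 := by
    intro q
    rw [norm_sq_dot, norm_sq_dot, norm_sq_dot]
    simp [dot]; ring
  rw [e1, e1, h1, ht2] at h2
  have := sq_nonneg ‖p - A‖
  linarith

end UBC

namespace UBC

variable {φ : ℤ → ℂ → ℂ} {C : ℝ} {P : Set ℂ}

lemma lin_large {c : ℝ} (hc : 0 < c) (k : ℝ) : ∀ᶠ S : ℝ in atTop, k ≤ c * S :=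
  (tendsto_id.const_mul_atTop hc).eventually_ge_atTop k

lemma round_lattice (c : ℂ) : ∃ a0 b0 : ℤ, ‖((a0:ℂ) + b0 * Complex.I) - c‖ ≤ 1 := by
  refine ⟨round c.re, round c.im, ?_⟩
  have h1 := abs_sub_round c.re
  have h2 := abs_sub_round c.im
  refine (Complex.norm_le_abs_re_add_abs_im _).trans ?_
  simp
  rw [abs_sub_comm, abs_sub_comm _ c.im]
  linarith

lemma im_post {m a w : ℂ} {η : ℝ} (hm : m ≠ 0)
    (ha : ‖a - η * (-(Complex.I * m) / ‖m‖)‖ ≤ 1) :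
    |(w * (starRingEnd ℂ) a).im - η * (dot m w / ‖m‖)| ≤ ‖w‖ := by
  have hm' : ‖m‖ ≠ 0 := norm_ne_zero_iff.2 hm
  set r := a - η * (-(Complex.I * m) / ‖m‖) with hr
  have e : (w * (starRingEnd ℂ) a).im - η * (dot m w / ‖m‖) = (w * (starRingEnd ℂ) r).im := by
    have h1 : η * (-(Complex.I * m) / ‖m‖) = ((η / ‖m‖ : ℝ) : ℂ) * (-(Complex.I * m)) := by
      push_cast; ring
    rw [hr, h1]
    simp [dot]
    ring
  rw [e]
  refine (Complex.abs_im_le_norm _).trans ?_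
  rw [norm_mul, RCLike.norm_conj]
  exact mul_le_of_le_one_right (norm_nonneg _) ha

lemma iter_bd (h : TFlow φ C) (j : ℤ) (z : ℂ) : ‖φ j z - z‖ ≤ C * |(j:ℝ)| := by
  have hnat : ∀ (n : ℕ) z, ‖φ n z - z‖ ≤ C * n := by
    intro n
    induction n with
    | zero => intro z; simp [h.zero]
    | succ n ih =>
      intro z
      have e : φ ((n + 1 : ℕ) : ℤ) z = φ 1 (φ n z) := by rw [← h.add, add_comm]; push_cast; rfl
      rw [e]
      have := h.bd (φ n z)
      have := ih z
      calc _ = ‖(φ 1 (φ n z) - φ n z) + (φ n z - z)‖ := by congr 1; ring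
        _ ≤ _ := norm_add_le _ _
        _ ≤ _ := by push_cast; linarith
  rcases le_total 0 j with h0 | h0
  · lift j to ℕ using h0
    simpa using hnat j z
  · obtain ⟨n, rfl⟩ : ∃ n : ℕ, j = -n := ⟨(-j).toNat, by omega⟩
    have := hnat n (φ (-n) z)
    rw [← h.add, add_neg_cancel, h.zero, norm_sub_rev] at this
    simpa using this

/-- two sided version of (D) -/
lemma D2 (h : TFlow φ C) (hP : Rot φ P) {ε : ℝ} (hε : 0 < ε) :
    ∀ᶠ S : ℝ in atTop, ∀ j : ℤ, |(j:ℝ)| ≤ S → ∀ z, ∃ v ∈ P, ‖φ j z - z - j * v‖ ≤ ε * S := by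
  obtain ⟨S0, hS0⟩ := hP.D ε hε
  filter_upwards [eventually_ge_atTop S0] with S hS j hj z
  rcases le_total 0 j with h0 | h0
  · have h0' : (0:ℝ) ≤ j := by exact_mod_cast h0
    exact hS0 S hS j h0 (by rwa [abs_of_nonneg h0'] at hj) z
  · have h0' : (j:ℝ) ≤ 0 := by exact_mod_cast h0
    obtain ⟨v, hv, hr⟩ := hS0 S hS (-j) (by omega) (by rw [abs_of_nonpos h0'] at hj; push_cast; exact hj) (φ j z)
    refine ⟨v, hv, ?_⟩
    rw [← h.add, neg_add_cancel, h.zero] at hr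
    have e : φ j z - z - j * v = -(z - φ j z - ((-j : ℤ) : ℂ) * v) := by push_cast; ring
    rw [e, norm_neg]
    exact hr

set_option maxHeartbeats 2000000 in
lemma LAG (h : TFlow φ C) (hP : Rot φ P) {A m : ℂ} (hA : SE P A m) (hm : m ≠ 0) {ε Λ : ℝ}
    (hε : 0 < ε) (hΛ : 1 ≤ Λ) :
    ∀ᶠ S : ℝ in atTop, ∀ K : Set ℂ, IsPreconnected K → ∀ z ∈ K, ∀ z' ∈ K, ∀ s e : ℕ,
      (s:ℝ) ≤ Λ * S → (e:ℝ) ≤ Λ * S →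
      (∀ y ∈ K, ‖φ e y - φ e z'‖ ≤ ‖φ e z' - (z + e * A)‖ / 8) →
      (∀ y ∈ K, ‖φ (-s) y - φ (-s) z'‖ ≤ ‖φ (-s) z' - (z - s * A)‖ / 8) →
      ∃ τ : ℤ, -s ≤ τ ∧ τ ≤ e ∧ ‖φ τ z' - (z + τ * A)‖ ≤ ε * S := by
  have hmn : 0 < ‖m‖ := norm_pos_iff.2 hm
  have hC := h.one_le
  set κ : ℝ := ε / 64 with hκ
  set θ : ℝ := κ^2 / (4 * Λ) with hθ
  have hκ0 : 0 < κ := by positivity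
  have hθ0 : 0 < θ := by positivity
  obtain ⟨β, hβ0, hβ1, hβ2⟩ : ∃ β > 0, β ≤ ε / 64 ∧ ‖m‖ * β ≤ θ := by
    refine ⟨min (ε/64) (θ / ‖m‖), by positivity, min_le_left _ _, ?_⟩
    calc ‖m‖ * min (ε/64) (θ / ‖m‖) ≤ ‖m‖ * (θ / ‖m‖) := by gcongr; exact min_le_right _ _
      _ = θ := by field_simp
  have hη0 : 0 < β / (3 * Λ) := by positivity
  obtain ⟨S1, hS1⟩ := straight h hP hA hη0
  have hT : Tendsto (fun S : ℝ => Λ * S) atTop atTop := tendsto_id.const_mul_atTop (by linarith)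
  filter_upwards [hT.eventually (eventually_ge_atTop S1), hT.eventually (D2 h hP hη0),
    lin_large (by positivity : 0 < β / 3) 1, lin_large (by positivity : 0 < ε / 16) 1,
    lin_large (by positivity : 0 < ε / 32) (8 * C),
    lin_large (by positivity : 0 < θ / (4 * ‖m‖)) (8 * C),
    lin_large (by positivity : 0 < ε * θ / (8 * ‖m‖)) (6 * C * Λ),
    eventually_ge_atTop (1:ℝ)] with S g1 g2 g3 g4 g5 g6 g7 g8
  intro K hK z hz z' hz' s e hs he Ee Es
  by_contra hcon
  push Not at hcon
  obtain ⟨x0, hx0⟩ := hS1 (Λ * S) g1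
  obtain ⟨p0, q0, hpq⟩ := round_lattice (z - x0)
  set x := x0 + ((p0:ℂ) + q0 * Complex.I) with hx
  have hxz : ‖x - z‖ ≤ 1 := by
    have e1 : x - z = ((p0:ℂ) + q0 * Complex.I) - (z - x0) := by rw [hx]; ring
    rw [e1]; exact hpq
  have hηT : β / (3 * Λ) * (Λ * S) = β / 3 * S := by field_simp
  have hxs : ∀ j : ℤ, |(j:ℝ)| ≤ Λ * S → ‖φ j x - x - j * A‖ ≤ β / 3 * S := by
    intro j hj
    have e1 := hx0 j hj
    rw [hηT] at e1
    rw [hx, h.lat]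
    convert e1 using 2
    ring
  rw [hηT] at g2
  have rng : ∀ j : ℤ, -s ≤ j → j ≤ e → |(j:ℝ)| ≤ Λ * S := by
    intro j h1 h2
    have h1' : -(s:ℝ) ≤ j := by exact_mod_cast h1
    have h2' : (j:ℝ) ≤ e := by exact_mod_cast h2
    rw [abs_le]; constructor <;> linarith
  have hxA : ∀ j : ℤ, |(j:ℝ)| ≤ Λ * S → ‖φ j x - (z + j * A)‖ ≤ 2 * (β / 3) * S := by
    intro j hj
    have e1 := hxs j hj
    calc _ = ‖(φ j x - x - j * A) + (x - z)‖ := by congr 1; ring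
      _ ≤ _ := norm_add_le _ _
      _ ≤ _ := by linarith
  have hw' : ∀ j : ℤ, -s ≤ j → j ≤ e → ‖φ j z' - (z + j * A)‖ - β * S ≤ ‖φ j z' - φ j x‖ := by
    intro j h1 h2
    have e1 := hxA j (rng j h1 h2)
    have e2 : ‖φ j z' - (z + j * A)‖ ≤ ‖φ j z' - φ j x‖ + ‖φ j x - (z + j * A)‖ := by
      refine le_trans (le_of_eq ?_) (norm_add_le _ _); congr 1; ring
    nlinarith
  have hβS : β * S ≤ ε / 64 * S := by gcongr
  -- the posts
  set hh : ℝ := ε * S / 8 with hhh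
  have hhpos : 0 < hh := by positivity
  obtain ⟨a0, b0, hab⟩ := round_lattice (hh * (-(Complex.I * m) / ‖m‖))
  set a : ℂ := (a0:ℂ) + b0 * Complex.I with ha
  have hcn : ‖(hh:ℂ) * (-(Complex.I * m) / ‖m‖)‖ = hh := by
    rw [norm_mul, norm_div, norm_neg, norm_mul, Complex.norm_I, Complex.norm_real, Complex.norm_real,
      Real.norm_of_nonneg hhpos.le, norm_norm, one_mul, div_self hmn.ne', mul_one]
  have ha1 : ‖a‖ ≤ hh + 1 := by
    have := norm_sub_norm_le a ((hh:ℂ) * (-(Complex.I * m) / ‖m‖))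
    rw [hcn] at this; linarith
  have ha2 : hh - 1 ≤ ‖a‖ := by
    have := norm_sub_norm_le ((hh:ℂ) * (-(Complex.I * m) / ‖m‖)) a
    rw [hcn, norm_sub_rev] at this; linarith
  have him := fun w => im_post (w := w) hm hab
  have hwbd : ∀ j : ℤ, |(j:ℝ)| ≤ Λ * S → ‖φ j z - φ j x‖ ≤ 3 * C * (Λ * S) := by
    intro j hj
    have e1 := iter_bd h j z
    have e2 := iter_bd h j x
    have e3 : C * |(j:ℝ)| ≤ C * (Λ * S) := by gcongr
    have e4 : 1 ≤ C * (Λ * S) := by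
      have : 1 ≤ Λ * S := by nlinarith
      nlinarith
    calc _ = ‖(φ j z - z) - (φ j x - x) - (x - z)‖ := by congr 1; ring
      _ ≤ ‖φ j z - z‖ + ‖φ j x - x‖ + ‖x - z‖ := (norm_sub_le _ _).trans (by gcongr; exact norm_sub_le _ _)
      _ ≤ _ := by linarith
  set Xv : ℝ := hh * (θ * S / ‖m‖) - 3 * C * (Λ * S) with hXv
  have hX2 : hh * (θ * S / ‖m‖) / 2 ≤ Xv := by
    have e1 : hh * (θ * S / ‖m‖) = (ε * θ / (8 * ‖m‖) * S) * S := by rw [hhh]; field_simp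
    have e2 : 6 * C * Λ * S ≤ (ε * θ / (8 * ‖m‖) * S) * S := by gcongr
    rw [hXv, e1]; linarith
  have hXpos : 0 < Xv := lt_of_lt_of_le (by positivity) hX2
  have hXa : 8 * C * ‖a‖ ≤ Xv := by
    have e1 : ‖a‖ ≤ 2 * hh := by
      have : 1 ≤ hh := by rw [hhh]; linarith
      linarith
    calc 8 * C * ‖a‖ ≤ (θ / (4 * ‖m‖) * S) * (2 * hh) := by gcongr
      _ = hh * (θ * S / ‖m‖) / 2 := by field_simp; ring
      _ ≤ _ := hX2
  have cone : ∀ j : ℤ, |(j:ℝ)| ≤ Λ * S → ‖φ j z - φ j x‖ ≤ ε * S / 32 ∨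
      ∃ v ∈ P, (θ * S ≤ |(j:ℝ)| * dot m (A - v) - ‖m‖ * β * S) ∧
        |dot m (φ j z - φ j x) + j * dot m (A - v)| ≤ ‖m‖ * β * S := by
    intro j hj
    obtain ⟨v, hv, hvr⟩ := g2 j hj z
    have e1 := hxA j hj
    have e2 : ‖φ j z - φ j x - j * (v - A)‖ ≤ β * S := by
      calc _ = ‖(φ j z - z - j * v) - (φ j x - (z + j * A))‖ := by congr 1; ring
        _ ≤ _ := norm_sub_le _ _
        _ ≤ _ := by linarith
    by_cases hu : |(j:ℝ)| * ‖v - A‖ ≤ κ * S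
    · left
      have e3 : ‖φ j z - φ j x‖ ≤ ‖φ j z - φ j x - j * (v - A)‖ + ‖(j:ℂ) * (v - A)‖ := by
        refine le_trans (le_of_eq ?_) (norm_add_le _ _); congr 1; ring
      rw [norm_mul, Complex.norm_intCast] at e3
      rw [hκ] at hu
      linarith
    · right
      push Not at hu
      refine ⟨v, hv, ?_, ?_⟩
      · have hse := hA.2 v hv
        have hd := hA.dot_nonneg hv
        have e3 : (κ * S)^2 ≤ 2 * (Λ * S) * (|(j:ℝ)| * dot m (A - v)) := by
          calc (κ * S)^2 ≤ (|(j:ℝ)| * ‖v - A‖)^2 := by gcongr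
            _ = |(j:ℝ)| * (|(j:ℝ)| * ‖v - A‖^2) := by ring
            _ ≤ (Λ * S) * (|(j:ℝ)| * (2 * dot m (A - v))) := by gcongr
            _ = _ := by ring
        have e4 : 2 * θ * S ≤ |(j:ℝ)| * dot m (A - v) := by
          have hpos : 0 < 2 * (Λ * S) := by positivity
          refine le_of_mul_le_mul_left ?_ hpos
          refine le_trans (le_of_eq ?_) e3
          rw [hθ]; field_simp; ring
        have e5 : ‖m‖ * β * S ≤ θ * S := by gcongr
        linarith
      · have e3 : dot m (φ j z - φ j x) + j * dot m (A - v) = dot m (φ j z - φ j x - j * (v - A)) := by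
          rw [← dot_int, ← dot_add]; congr 1; ring
        rw [e3]
        refine (dot_le _ _).trans ?_
        rw [mul_assoc]; gcongr
  have imneg : ∀ w : ℂ, dot m w ≤ -(θ * S) → ‖w‖ ≤ 3 * C * (Λ * S) → (w * (starRingEnd ℂ) a).im ≤ -Xv := by
    intro w h1 h2
    have e1 := (abs_le.1 (him w)).2
    have e2 : hh * (dot m w / ‖m‖) ≤ hh * (-(θ * S) / ‖m‖) := by gcongr
    have e3 : hh * (-(θ * S) / ‖m‖) = -(hh * (θ * S / ‖m‖)) := by ring
    rw [hXv]; linarith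
  have impos : ∀ w : ℂ, θ * S ≤ dot m w → ‖w‖ ≤ 3 * C * (Λ * S) → Xv ≤ (w * (starRingEnd ℂ) a).im := by
    intro w h1 h2
    have e1 := (abs_le.1 (him w)).1
    have e2 : hh * (θ * S / ‖m‖) ≤ hh * (dot m w / ‖m‖) := by gcongr
    rw [hXv]; linarith
  have dpos : ∀ j : ℤ, 0 ≤ j → j ≤ e → ‖φ j z - φ j x‖ ≤ ε * S / 32 ∨
      ((φ j z - φ j x) * (starRingEnd ℂ) a).im ≤ -Xv := by
    intro j h0 h1
    have hj := rng j (by omega) h1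
    rcases cone j hj with hc | ⟨v, hv, c1, c2⟩
    · exact Or.inl hc
    · right
      refine imneg _ ?_ (hwbd j hj)
      rw [abs_of_nonneg (by exact_mod_cast h0 : (0:ℝ) ≤ j)] at c1
      have := (abs_le.1 c2).2
      linarith
  have dneg : ∀ j : ℤ, -s ≤ j → j ≤ 0 → ‖φ j z - φ j x‖ ≤ ε * S / 32 ∨
      Xv ≤ ((φ j z - φ j x) * (starRingEnd ℂ) a).im := by
    intro j h0 h1
    have hj := rng j h0 (by omega)
    rcases cone j hj with hc | ⟨v, hv, c1, c2⟩
    · exact Or.inl hc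
    · right
      refine impos _ ?_ (hwbd j hj)
      rw [abs_of_nonpos (by exact_mod_cast h1 : (j:ℝ) ≤ 0)] at c1
      have := (abs_le.1 c2).1
      linarith
  have hhv : hh = ε * S / 8 := hhh
  have hsmall_a : ε * S / 32 < ‖a‖ := by linarith
  have farsmall : ∀ w : ℂ, ‖w‖ ≤ ε * S / 32 → 8 * C ≤ ‖w - a‖ ∧ 8 * C ≤ ‖w + a‖ := by
    intro w hw
    have e1 := norm_sub_norm_le a w
    have e2 := norm_sub_norm_le a (-w)
    rw [norm_sub_rev] at e1
    rw [norm_neg, sub_neg_eq_add, add_comm a w] at e2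
    constructor <;> linarith
  have hapos : 0 < ‖a‖ := lt_trans (by positivity) hsmall_a
  have farim : ∀ w : ℂ, Xv ≤ |(w * (starRingEnd ℂ) a).im| → 8 * C ≤ ‖w - a‖ ∧ 8 * C ≤ ‖w + a‖ := by
    intro w hw
    have e1 : ((w - a) * (starRingEnd ℂ) a).im = (w * (starRingEnd ℂ) a).im := by simp; ring
    have e2 : ((w + a) * (starRingEnd ℂ) a).im = (w * (starRingEnd ℂ) a).im := by simp; ring
    have f1 := Complex.abs_im_le_norm ((w - a) * (starRingEnd ℂ) a)
    have f2 := Complex.abs_im_le_norm ((w + a) * (starRingEnd ℂ) a)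
    rw [e1, norm_mul, RCLike.norm_conj] at f1
    rw [e2, norm_mul, RCLike.norm_conj] at f2
    exact ⟨le_of_mul_le_mul_right (hXa.trans (hw.trans f1)) hapos,
      le_of_mul_le_mul_right (hXa.trans (hw.trans f2)) hapos⟩
  have hcon' : ∀ j : ℤ, -s ≤ j → j ≤ e → ε * S * (3/4) < ‖φ j z' - φ j x‖ := by
    intro j h1 h2
    have := hcon j h1 h2
    have := hw' j h1 h2
    linarith
  have endbig : ∀ j : ℤ, -s ≤ j → j ≤ e → (∀ y ∈ K, ‖φ j y - φ j z'‖ ≤ ‖φ j z' - (z + j * A)‖ / 8) →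
      (∀ y ∈ K, ‖φ j y - φ j z'‖ + ‖a‖ < ‖φ j z' - φ j x‖) ∧ ε * S / 32 < ‖φ j z - φ j x‖ := by
    intro j h1 h2 hE
    have e0 := hcon j h1 h2
    have e1 := hw' j h1 h2
    have e2 := hE z hz
    constructor
    · intro y hy
      have := hE y hy
      linarith
    · have e3 : ‖φ j z' - φ j x‖ ≤ ‖φ j z - φ j x‖ + ‖φ j z - φ j z'‖ := by
        rw [norm_sub_rev (φ j z) (φ j z'), add_comm]
        refine le_trans (le_of_eq ?_) (norm_add_le _ _); congr 1; ring
      linarith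
  have Be := endbig e (by omega) le_rfl (by intro y hy; simpa using Ee y hy)
  have Bs := endbig (-s) le_rfl (by omega) (by
    intro y hy
    have := Es y hy
    have e1 : z - s * A = z + ((-(s:ℤ) : ℤ) : ℂ) * A := by push_cast; ring
    rwa [e1] at this)
  refine W2core h hK hz hz' x a a0 b0 ha s e ?_ ?_ ?_ ?_ ?_ ?_ ?_ Be.1 Bs.1
  · intro j h1 h2
    rcases le_total 0 j with h0 | h0
    · rcases dpos j h0 h2 with c | c
      · exact farsmall _ c
      · refine farim _ ?_
        rw [abs_of_nonpos (by linarith)]; linarith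
    · rcases dneg j h1 h0 with c | c
      · exact farsmall _ c
      · exact farim _ (c.trans (le_abs_self _))
  · intro j h1 h2
    have e0 := hcon' j h1 h2
    have e1 := norm_sub_norm_le (φ j z' - φ j x) a
    have e2 := norm_sub_norm_le (φ j z' - φ j x) (-a)
    rw [norm_neg, sub_neg_eq_add] at e2
    constructor <;> linarith
  · intro j h0 h1
    rcases dpos j h0 h1 with c | c
    · exact Or.inl (by linarith)
    · exact Or.inr (by linarith)
  · intro j h0 h1
    rcases dneg j h0 h1 with c | c
    · exact Or.inl (by linarith)
    · exact Or.inr (by linarith)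
  · rcases dpos e (by omega) le_rfl with c | c
    · linarith [Be.2]
    · linarith
  · rcases dneg (-s) le_rfl (by omega) with c | c
    · linarith [Bs.2]
    · linarith
  · intro j h1 h2
    have := hcon' j h1 h2
    linarith

end UBC

namespace UBC

variable {φ : ℤ → ℂ → ℂ} {C : ℝ} {P : Set ℂ}

lemma cross_le (m v : ℂ) : |cross m v| ≤ ‖m‖ * ‖v‖ := by
  apply abs_le_of_sq_le_sq _ (by positivity)
  rw [mul_pow, norm_sq_dot, norm_sq_dot]
  simp only [dot, cross]
  nlinarith [sq_nonneg (m.re * v.re + m.im * v.im)]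

lemma cross_small {u v Δ : ℂ} {τ σ r : ℝ} (hc : cross u v ≠ 0)
    (h1 : ‖Δ - τ * u‖ ≤ r) (h2 : ‖Δ - σ * v‖ ≤ r) :
    ‖Δ‖ ≤ (1 + 2 * ‖u‖ * ‖v‖ / |cross u v|) * r := by
  have hcp : 0 < |cross u v| := abs_pos.2 hc
  have e1 : cross v (Δ - σ * v) - cross v (Δ - τ * u) = - (τ * cross u v) := by
    simp [cross]; ring
  have b1 := (cross_le v (Δ - σ * v)).trans (mul_le_mul_of_nonneg_left h2 (norm_nonneg v))
  have b2 := (cross_le v (Δ - τ * u)).trans (mul_le_mul_of_nonneg_left h1 (norm_nonneg v))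
  have b3 : |τ| * |cross u v| ≤ 2 * (‖v‖ * r) := by
    rw [← abs_mul, ← abs_neg, ← e1]
    refine (abs_sub _ _).trans ?_
    linarith
  have b4 : |τ| ≤ 2 * (‖v‖ * r) / |cross u v| := by rwa [le_div_iff₀ hcp]
  calc ‖Δ‖ = ‖(Δ - τ * u) + τ * u‖ := by congr 1; ring
    _ ≤ ‖Δ - τ * u‖ + ‖(τ:ℂ) * u‖ := norm_add_le _ _
    _ = ‖Δ - τ * u‖ + |τ| * ‖u‖ := by rw [norm_mul, Complex.norm_real, Real.norm_eq_abs]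
    _ ≤ r + 2 * (‖v‖ * r) / |cross u v| * ‖u‖ := by gcongr
    _ = _ := by ring

lemma recenter (h : TFlow φ C) {A : ℂ} {q : ℕ} {y : ℂ} {r : ℝ}
    (hs : ∀ i j : ℤ, 0 ≤ i → i ≤ j → j ≤ 2 * q → ‖φ j y - φ i y - ((j:ℂ) - i) * A‖ ≤ r)
    {τ : ℤ} (hτ : |τ| ≤ q) : ‖φ τ (φ q y) - φ q y - τ * A‖ ≤ r := by
  have hj2 := abs_le.1 hτ
  have hadd : φ τ (φ q y) = φ (τ + q) y := (h.add _ _ _).symm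
  rw [hadd]
  rcases le_total 0 τ with h0 | h0
  · have := hs q (τ + q) (by omega) (by omega) (by omega)
    have e : φ (τ + q) y - φ q y - τ * A = φ (τ + q) y - φ q y - (((τ + q : ℤ) : ℂ) - (q : ℤ)) * A := by
      push_cast; ring
    rw [e]; exact this
  · have := hs (τ + q) q (by omega) (by omega) (by omega)
    have e : φ (τ + q) y - φ q y - τ * A = -(φ q y - φ (τ + q) y - (((q : ℤ) : ℂ) - ((τ + q : ℤ) : ℂ)) * A) := by
      push_cast; ring
    rw [e, norm_neg]; exact this

/-- lag along a straight piece of type `A` with respect to another type `B` -/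
lemma lag_cross (h : TFlow φ C) (hP : Rot φ P) {A B m : ℂ} (hB : SE P B m) (hm : m ≠ 0) {ε Λ : ℝ}
    (hε : 0 < ε) (hε1 : ε ≤ 1) (hΛ : 1 ≤ Λ) (hΛ2 : 10 ≤ Λ * ‖A - B‖) :
    ∀ᶠ S : ℝ in atTop, ∀ K : Set ℂ, IsPreconnected K →
      (∀ j : ℤ, ∀ y ∈ K, ∀ y' ∈ K, ‖φ j y - φ j y'‖ ≤ S) → ∀ z ∈ K, ∀ z' ∈ K, ∀ q : ℕ,
      Λ * S ≤ q → (q:ℝ) ≤ 2 * Λ * S →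
      (∀ τ : ℤ, |τ| ≤ q → ‖φ τ z' - z' - τ * A‖ ≤ ε * S) →
      ∃ τ : ℤ, ‖(z - z') - (τ:ℝ) * (A - B)‖ ≤ 2 * ε * S := by
  filter_upwards [LAG h hP hB hm hε (by linarith : 1 ≤ 2 * Λ), eventually_ge_atTop (1:ℝ)] with S hS hS1
  intro K hK hd z hz z' hz' q hq1 hq2 hst
  have hend : ∀ τ : ℤ, |τ| = q → ∀ y ∈ K, ‖φ τ y - φ τ z'‖ ≤ ‖φ τ z' - (z + τ * B)‖ / 8 := by
    intro τ hτ y hy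
    have e1 := hd τ y hy z' hz'
    have e2 := hst τ hτ.le
    have e3 := hd 0 z hz z' hz'
    rw [h.zero, h.zero] at e3
    have e4 : ‖(τ:ℂ) * (A - B)‖ ≤ ‖φ τ z' - (z + τ * B)‖ + ‖φ τ z' - z' - τ * A‖ + ‖z - z'‖ := by
      calc _ = ‖(φ τ z' - (z + τ * B)) - (φ τ z' - z' - τ * A) + (z - z')‖ := by congr 1; ring
        _ ≤ _ := (norm_add_le _ _).trans (by gcongr; exact norm_sub_le _ _)
    rw [norm_mul, Complex.norm_intCast] at e4
    have e5 : |(τ:ℝ)| = q := by exact_mod_cast hτ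
    rw [e5] at e4
    have e6 : 10 * S ≤ q * ‖A - B‖ := by
      calc 10 * S ≤ Λ * ‖A - B‖ * S := by gcongr
        _ = (Λ * S) * ‖A - B‖ := by ring
        _ ≤ _ := by gcongr
    have e7 : ε * S ≤ 1 * S := by gcongr
    linarith
  obtain ⟨τ, h1, h2, h3⟩ := hS K hK z hz z' hz' q q hq2 hq2
    (by intro y hy; simpa using hend q (by simp) y hy)
    (by intro y hy
        have := hend (-q) (by simp) y hy
        have e : z - q * B = z + ((-(q:ℤ) : ℤ) : ℂ) * B := by push_cast; ring
        rwa [e])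
  refine ⟨τ, ?_⟩
  have e2 := hst τ (abs_le.2 ⟨h1, h2⟩)
  calc _ = ‖(φ τ z' - z' - τ * A) - (φ τ z' - (z + τ * B))‖ := by congr 1; push_cast; ring
    _ ≤ _ := norm_sub_le _ _
    _ ≤ _ := by linarith

set_option maxHeartbeats 1000000 in
lemma SMALL (h : TFlow φ C) (hP : Rot φ P) {A B D mA mB mD : ℂ} (hA : SE P A mA) (hB : SE P B mB)
    (hD : SE P D mD) (hmB : mB ≠ 0) (hmD : mD ≠ 0) (hc : cross (A - B) (A - D) ≠ 0)
    {ε₂ : ℝ} (hε₂ : 0 < ε₂) :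
    ∃ Λ : ℝ, 1 ≤ Λ ∧ ∀ᶠ S : ℝ in atTop, ∃ L : ℕ, (L:ℝ) ≤ Λ * S ∧ ∀ K : Set ℂ, IsPreconnected K →
      (∀ j : ℤ, ∀ y ∈ K, ∀ y' ∈ K, ‖φ j y - φ j y'‖ ≤ S) → ∀ z' ∈ K, ∀ t0 : ℤ,
      ‖φ (t0 + L) z' - φ t0 z' - L * A‖ ≤ 10 * S →
      ∃ e : ℤ, t0 ≤ e ∧ e ≤ t0 + L ∧ ∀ y ∈ K, ‖φ e y - φ e z'‖ ≤ ε₂ * S := by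
  have hAB : 0 < ‖A - B‖ := by
    rw [norm_pos_iff]; intro h0; rw [h0] at hc; simp [cross] at hc
  have hAD : 0 < ‖A - D‖ := by
    rw [norm_pos_iff]; intro h0; rw [h0] at hc; simp [cross] at hc
  set Λ' : ℝ := 1 + 10 / ‖A - B‖ + 10 / ‖A - D‖ with hΛ'
  have hΛ1 : 1 ≤ Λ' := by
    have : 0 < 10 / ‖A - B‖ := by positivity
    have : 0 < 10 / ‖A - D‖ := by positivity
    linarith
  have hΛB : 10 ≤ Λ' * ‖A - B‖ := by
    have e : 10 / ‖A - B‖ * ‖A - B‖ = 10 := by field_simp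
    calc 10 = 10 / ‖A - B‖ * ‖A - B‖ := e.symm
      _ ≤ _ := by
        gcongr
        have : 0 < 10 / ‖A - D‖ := by positivity
        linarith
  have hΛD : 10 ≤ Λ' * ‖A - D‖ := by
    have e : 10 / ‖A - D‖ * ‖A - D‖ = 10 := by field_simp
    calc 10 = 10 / ‖A - D‖ * ‖A - D‖ := e.symm
      _ ≤ _ := by
        gcongr
        have : 0 < 10 / ‖A - B‖ := by positivity
        linarith
  set W : ℝ := 1 + 2 * ‖A - B‖ * ‖A - D‖ / |cross (A - B) (A - D)| with hW
  have hW0 : 0 < W := by positivity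
  set ε₃ : ℝ := min 1 (ε₂ / (2 * W)) with hε₃
  have hε₃0 : 0 < ε₃ := by positivity
  have hε₃1 : ε₃ ≤ 1 := min_le_left _ _
  have hε₃2 : W * (2 * ε₃) ≤ ε₂ := by
    calc W * (2 * ε₃) ≤ W * (2 * (ε₂ / (2 * W))) := by gcongr; exact min_le_right _ _
      _ = ε₂ := by field_simp
  have hmA := norm_nonneg mA
  obtain ⟨κ, hκ0, -, hκ⟩ := exists_eps (2 * (1 + 3 * ‖mA‖)) (ε₃ / (4 * Λ')) (by positivity)
  obtain ⟨Q, hQ⟩ := exists_nat_ge (10 * ‖mA‖ / κ + 1)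
  have hQ1 : (1:ℝ) ≤ Q := by
    have : 0 ≤ 10 * ‖mA‖ / κ := by positivity
    linarith
  have hQpos : 0 < Q := by exact_mod_cast (by linarith : (0:ℝ) < Q)
  have hQκ : 10 * ‖mA‖ ≤ Q * κ := by
    rw [← div_le_iff₀ hκ0]; linarith
  obtain ⟨S1, hS1⟩ := hP.D κ hκ0
  refine ⟨Q * (4 * Λ'), by nlinarith, ?_⟩
  filter_upwards [lag_cross h hP (A := A) hB hmB hε₃0 hε₃1 hΛ1 hΛB,
    lag_cross h hP (A := A) hD hmD hε₃0 hε₃1 hΛ1 hΛD, eventually_ge_atTop (1:ℝ),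
    eventually_ge_atTop S1] with S lB lD gS1 gS
  set q : ℕ := ⌈Λ' * S⌉₊ with hq
  have hΛS : 1 ≤ Λ' * S := by nlinarith
  have hq1 : Λ' * S ≤ q := Nat.le_ceil _
  have hq2 : (q:ℝ) ≤ 2 * Λ' * S := by
    have := Nat.ceil_lt_add_one (by linarith : 0 ≤ Λ' * S); linarith
  have hqS : S ≤ q := by nlinarith
  refine ⟨Q * (2 * q), ?_, ?_⟩
  · push_cast
    calc (Q:ℝ) * (2 * q) ≤ Q * (2 * (2 * Λ' * S)) := by gcongr
      _ = _ := by ring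
  intro K hK hd z' hz' t0 hL
  set b : ℤ := 2 * q with hb
  have hbr : (b:ℝ) = 2 * q := by rw [hb]; push_cast; ring
  have hDb : ∀ j : ℤ, 0 ≤ j → j ≤ b → ∀ z, ∃ v ∈ P, ‖φ j z - z - j * v‖ ≤ κ * b := by
    intro j h0 h1 z
    exact hS1 b (by rw [hbr]; linarith) j h0 (by exact_mod_cast h1) z
  have hcast : ((Q * (2 * q) : ℕ) : ℤ) = Q * b := by rw [hb]; push_cast; ring
  have hdrop : drop φ A mA (Q * b) (φ t0 z') ≤ Q * (κ * b) := by
    simp only [drop]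
    refine ((le_abs_self _).trans (dot_le _ _)).trans ?_
    have e1 : ‖(((Q:ℤ) * b : ℤ) : ℂ) * A - (φ (Q * b) (φ t0 z') - φ t0 z')‖ ≤ 10 * S := by
      rw [norm_sub_rev, ← h.add, add_comm, ← hcast]
      simpa using hL
    calc _ ≤ ‖mA‖ * (10 * S) := by gcongr
      _ = (10 * ‖mA‖) * S := by ring
      _ ≤ (Q * κ) * b := by gcongr; rw [hbr]; linarith
      _ = _ := by ring
  obtain ⟨k, hk, hkd⟩ := pick_block h A mA b Q hQpos (φ t0 z') hdrop
  set y0 := φ (k * b) (φ t0 z') with hy0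
  have hfin : (κ + Real.sqrt (2 * (κ + 3 * ‖mA‖ * κ))) * b ≤ ε₃ * S := by
    have e : 2 * (κ + 3 * ‖mA‖ * κ) = 2 * (1 + 3 * ‖mA‖) * κ := by ring
    rw [e]
    have hb0 : (0:ℝ) ≤ b := by rw [hbr]; positivity
    calc _ ≤ ε₃ / (4 * Λ') * b := by gcongr
      _ ≤ ε₃ / (4 * Λ') * (4 * Λ' * S) := by gcongr; rw [hbr]; linarith
      _ = _ := by field_simp
  have hst : ∀ τ : ℤ, |τ| ≤ q → ‖φ τ (φ q y0) - φ q y0 - τ * A‖ ≤ ε₃ * S := by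
    intro τ hτ
    refine recenter h ?_ hτ
    intro i j hi hij hj
    exact (small_drop h hA (b := b) (ε := κ) (κ := κ) hDb hkd hi hij hj).trans hfin
  set e : ℤ := q + (k * b + t0) with he
  have hey : ∀ y, φ q (φ (k * b) (φ t0 y)) = φ e y := by
    intro y; rw [← h.add, ← h.add, he, add_assoc]
  have hzy : φ q y0 = φ e z' := hey z'
  rw [hzy] at hst
  have hkQ : (k:ℤ) + 1 ≤ Q := by exact_mod_cast hk
  have hb0 : 0 ≤ b := by rw [hb]; positivity
  have hkb : (k:ℤ) * b + b ≤ Q * b := by nlinarith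
  have hkb0 : 0 ≤ (k:ℤ) * b := by positivity
  refine ⟨e, by omega, by rw [hcast]; omega, fun y hy => ?_⟩
  have hKe : IsPreconnected (φ e '' K) := hK.image _ (h.cont e).continuousOn
  have hde : ∀ j : ℤ, ∀ y ∈ φ e '' K, ∀ y' ∈ φ e '' K, ‖φ j y - φ j y'‖ ≤ S := by
    rintro j _ ⟨y, hy, rfl⟩ _ ⟨y', hy', rfl⟩
    rw [← h.add, ← h.add]; exact hd _ y hy y' hy'
  obtain ⟨τ, hτ⟩ := lB _ hKe hde (φ e y) (mem_image_of_mem _ hy) (φ e z') (mem_image_of_mem _ hz') q hq1 hq2 hst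
  obtain ⟨σ, hσ⟩ := lD _ hKe hde (φ e y) (mem_image_of_mem _ hy) (φ e z') (mem_image_of_mem _ hz') q hq1 hq2 hst
  have := cross_small hc hτ hσ
  refine this.trans ?_
  calc W * (2 * ε₃ * S) = (W * (2 * ε₃)) * S := by ring
    _ ≤ _ := by gcongr

/-- lag for every pair -/
lemma lag_all (h : TFlow φ C) (hP : Rot φ P) {A B D mA mB mD : ℂ} (hA : SE P A mA) (hB : SE P B mB)
    (hD : SE P D mD) (hmA : mA ≠ 0) (hmB : mB ≠ 0) (hmD : mD ≠ 0) (hc : cross (A - B) (A - D) ≠ 0)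
    {ε : ℝ} (hε : 0 < ε) :
    ∃ Λ : ℝ, 1 ≤ Λ ∧ ∀ᶠ S : ℝ in atTop, ∀ K : Set ℂ, IsPreconnected K →
      (∀ j : ℤ, ∀ y ∈ K, ∀ y' ∈ K, ‖φ j y - φ j y'‖ ≤ S) → ∀ z ∈ K, ∀ z' ∈ K,
      ∃ τ : ℤ, |(τ:ℝ)| ≤ Λ * S ∧ ‖φ τ z' - (z + τ * A)‖ ≤ ε * S := by
  obtain ⟨Λ, hΛ, hsm⟩ := SMALL h hP hA hB hD hmB hmD hc (by positivity : 0 < ε / 8)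
  refine ⟨Λ, hΛ, ?_⟩
  filter_upwards [hsm, LAG h hP hA hmA hε hΛ, eventually_ge_atTop (1:ℝ)] with S ⟨L, hLS, hSM⟩ hLAG hS1
  intro K hK hd z hz z' hz'
  have hd0 := hd 0 z hz z' hz'
  rw [h.zero, h.zero] at hd0
  by_contra hcon
  push Not at hcon
  have hE : ∃ e : ℕ, e ≤ L ∧ ∀ y ∈ K, ‖φ e y - φ e z'‖ ≤ ‖φ e z' - (z + e * A)‖ / 8 := by
    by_cases hbig : 8 * S ≤ ‖φ L z' - (z + L * A)‖
    · refine ⟨L, le_rfl, fun y hy => ?_⟩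
      have := hd L y hy z' hz'
      linarith
    · push Not at hbig
      obtain ⟨e, he0, heL, hy⟩ := hSM K hK hd z' hz' 0 (by
        rw [zero_add, h.zero]
        calc _ = ‖(φ L z' - (z + L * A)) + (z - z')‖ := by congr 1; ring
          _ ≤ _ := norm_add_le _ _
          _ ≤ _ := by linarith)
      lift e to ℕ using he0
      refine ⟨e, by omega, fun y hyK => ?_⟩
      have e1 := hy y hyK
      have e2 : (e:ℝ) ≤ L := by exact_mod_cast (by omega : e ≤ L)
      have e3 := hcon e (by simp; linarith)
      simp only [Int.cast_natCast] at e3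
      linarith
  have hE' : ∃ s : ℕ, s ≤ L ∧ ∀ y ∈ K, ‖φ (-s) y - φ (-s) z'‖ ≤ ‖φ (-s) z' - (z - s * A)‖ / 8 := by
    by_cases hbig : 8 * S ≤ ‖φ (-L) z' - (z - L * A)‖
    · refine ⟨L, le_rfl, fun y hy => ?_⟩
      have := hd (-L) y hy z' hz'
      linarith
    · push Not at hbig
      obtain ⟨e, he0, heL, hy⟩ := hSM K hK hd z' hz' (-L) (by
        rw [neg_add_cancel, h.zero]
        calc _ = ‖-(φ (-L) z' - (z - L * A)) - (z - z')‖ := by congr 1; ring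
          _ ≤ _ := norm_sub_le _ _
          _ ≤ _ := by rw [norm_neg]; linarith)
      obtain ⟨s, rfl⟩ : ∃ s : ℕ, e = -s := ⟨(-e).toNat, by omega⟩
      refine ⟨s, by omega, fun y hyK => ?_⟩
      have e1 := hy y hyK
      have e2 : (s:ℝ) ≤ L := by exact_mod_cast (by omega : s ≤ L)
      have e3 := hcon (-s) (by simp; linarith)
      have e4 : z - s * A = z + ((-(s:ℤ) : ℤ) : ℂ) * A := by push_cast; ring
      rw [e4]
      linarith
  obtain ⟨e, he, hEe⟩ := hE
  obtain ⟨s, hs, hEs⟩ := hE'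
  have her : (e:ℝ) ≤ L := by exact_mod_cast he
  have hsr : (s:ℝ) ≤ L := by exact_mod_cast hs
  obtain ⟨τ, h1, h2, h3⟩ := hLAG K hK z hz z' hz' s e (by linarith) (by linarith) hEe hEs
  have h1' : -(s:ℝ) ≤ τ := by exact_mod_cast h1
  have h2' : (τ:ℝ) ≤ e := by exact_mod_cast h2
  have := hcon τ (abs_le.2 ⟨by linarith, by linarith⟩)
  linarith

end UBC

namespace UBC

variable {φ : ℤ → ℂ → ℂ} {C : ℝ} {P : Set ℂ}

def cst (C : ℝ) (A₁ m₁ A₂ : ℂ) : ℝ := 3 * ‖m₁‖ * (C + ‖A₂‖) / dot m₁ (A₁ - A₂) + 1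

lemma SE.dot_pos {A m B : ℂ} (hA : SE P A m) (hB : B ∈ P) (hne : A - B ≠ 0) : 0 < dot m (A - B) := by
  have h1 := hA.2 B hB
  have h2 : 0 < ‖B - A‖ := by rw [norm_sub_rev]; exact norm_pos_iff.2 hne
  have : 0 < ‖B - A‖^2 := by positivity
  linarith

lemma ne_of_dot_pos {m v : ℂ} (h : 0 < dot m v) : m ≠ 0 := by
  rintro rfl
  simp [dot] at h

lemma sign_pair1 (h : TFlow φ C) {A₁ m₁ A₂ : ℂ} (h1 : SE P A₁ m₁) (hg : 0 < dot m₁ (A₁ - A₂)) {S ε Λ : ℝ}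
    (hS : 0 ≤ S) (hε : 0 ≤ ε)
    (hD : ∀ j : ℤ, |(j:ℝ)| ≤ 2 * Λ * S → ∀ z, ∃ v ∈ P, ‖φ j z - z - j * v‖ ≤ ε * S)
    {z z' : ℂ} {τ₁ τ₂ : ℤ} (ht1 : |(τ₁:ℝ)| ≤ Λ * S) (ht2 : |(τ₂:ℝ)| ≤ Λ * S)
    (l1 : ‖φ τ₁ z' - (z + τ₁ * A₁)‖ ≤ ε * S) (l2 : ‖φ τ₂ z' - (z + τ₂ * A₂)‖ ≤ ε * S)
    (hs : (0 ≤ τ₂ ∧ τ₂ ≤ τ₁) ∨ (τ₁ ≤ τ₂ ∧ τ₂ ≤ 0)) :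
    ‖z - z'‖ ≤ cst C A₁ m₁ A₂ * (ε * S) := by
  have hC := h.one_le
  have hr : |((τ₁ - τ₂ : ℤ) : ℝ)| ≤ 2 * Λ * S := by
    push_cast
    refine (abs_sub _ _).trans ?_
    linarith
  obtain ⟨v, hv, hvr⟩ := hD _ hr (φ τ₂ z')
  rw [← h.add, sub_add_cancel] at hvr
  have hdv := h1.dot_nonneg hv
  set E : ℂ := ((τ₁ - τ₂ : ℤ) : ℂ) * (A₁ - v) + τ₂ * (A₁ - A₂) with hE
  have hEn : ‖E‖ ≤ 3 * (ε * S) := by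
    have e : E = (φ τ₁ z' - φ τ₂ z' - ((τ₁ - τ₂ : ℤ) : ℂ) * v) - (φ τ₁ z' - (z + τ₁ * A₁)) + (φ τ₂ z' - (z + τ₂ * A₂)) := by
      rw [hE]; push_cast; ring
    rw [e]
    refine (norm_add_le _ _).trans ?_
    have := norm_sub_le (φ τ₁ z' - φ τ₂ z' - ((τ₁ - τ₂ : ℤ) : ℂ) * v) (φ τ₁ z' - (z + τ₁ * A₁))
    linarith
  have hdE : |dot m₁ E| ≤ ‖m₁‖ * (3 * (ε * S)) := (dot_le _ _).trans (by gcongr)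
  have hdE2 : dot m₁ E = ((τ₁ - τ₂ : ℤ) : ℝ) * dot m₁ (A₁ - v) + τ₂ * dot m₁ (A₁ - A₂) := by
    rw [hE, dot_add, dot_int, dot_int]
  have hτ : |(τ₂:ℝ)| * dot m₁ (A₁ - A₂) ≤ ‖m₁‖ * (3 * (ε * S)) := by
    have hb := abs_le.1 hdE
    rw [hdE2] at hb
    rcases hs with ⟨a, b⟩ | ⟨a, b⟩
    · have a' : (0:ℝ) ≤ τ₂ := by exact_mod_cast a
      have b' : (0:ℝ) ≤ ((τ₁ - τ₂ : ℤ) : ℝ) := by exact_mod_cast (by omega : 0 ≤ τ₁ - τ₂)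
      rw [abs_of_nonneg a']
      have := mul_nonneg b' hdv
      linarith
    · have a' : (τ₂:ℝ) ≤ 0 := by exact_mod_cast b
      have b' : ((τ₁ - τ₂ : ℤ) : ℝ) ≤ 0 := by exact_mod_cast (by omega : τ₁ - τ₂ ≤ 0)
      rw [abs_of_nonpos a']
      have := mul_nonneg (neg_nonneg.2 b') hdv
      linarith
  have hτ' : |(τ₂:ℝ)| ≤ ‖m₁‖ * (3 * (ε * S)) / dot m₁ (A₁ - A₂) := by rwa [le_div_iff₀ hg]
  have hzz : ‖z - z'‖ ≤ (C + ‖A₂‖) * |(τ₂:ℝ)| + ε * S := by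
    have e1 := iter_bd h τ₂ z'
    calc _ = ‖(φ τ₂ z' - z') - (φ τ₂ z' - (z + τ₂ * A₂)) - τ₂ * A₂‖ := by congr 1; ring
      _ ≤ ‖φ τ₂ z' - z'‖ + ‖φ τ₂ z' - (z + τ₂ * A₂)‖ + ‖(τ₂:ℂ) * A₂‖ :=
          (norm_sub_le _ _).trans (by gcongr; exact norm_sub_le _ _)
      _ ≤ C * |(τ₂:ℝ)| + ε * S + |(τ₂:ℝ)| * ‖A₂‖ := by
          rw [norm_mul, Complex.norm_intCast]; gcongr
      _ = _ := by ring
  refine hzz.trans ?_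
  have hA2 := norm_nonneg A₂
  calc _ ≤ (C + ‖A₂‖) * (‖m₁‖ * (3 * (ε * S)) / dot m₁ (A₁ - A₂)) + ε * S := by gcongr
    _ = _ := by simp only [cst]; ring

lemma cst_nonneg (hC : 1 ≤ C) {A₁ m₁ A₂ : ℂ} (hg : 0 < dot m₁ (A₁ - A₂)) : 0 < cst C A₁ m₁ A₂ := by
  have := norm_nonneg A₂
  have : 0 < C + ‖A₂‖ := by linarith
  simp only [cst]
  positivity

lemma sign_pair (h : TFlow φ C) {A₁ m₁ A₂ m₂ : ℂ} (h1 : SE P A₁ m₁) (h2 : SE P A₂ m₂)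
    (hg1 : 0 < dot m₁ (A₁ - A₂)) (hg2 : 0 < dot m₂ (A₂ - A₁)) {S ε Λ : ℝ}
    (hS : 0 ≤ S) (hε : 0 ≤ ε)
    (hD : ∀ j : ℤ, |(j:ℝ)| ≤ 2 * Λ * S → ∀ z, ∃ v ∈ P, ‖φ j z - z - j * v‖ ≤ ε * S)
    {z z' : ℂ} {τ₁ τ₂ : ℤ} (ht1 : |(τ₁:ℝ)| ≤ Λ * S) (ht2 : |(τ₂:ℝ)| ≤ Λ * S)
    (l1 : ‖φ τ₁ z' - (z + τ₁ * A₁)‖ ≤ ε * S) (l2 : ‖φ τ₂ z' - (z + τ₂ * A₂)‖ ≤ ε * S)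
    (hs : (0 ≤ τ₂ ∧ 0 ≤ τ₁) ∨ (τ₁ ≤ 0 ∧ τ₂ ≤ 0)) :
    ‖z - z'‖ ≤ (cst C A₁ m₁ A₂ + cst C A₂ m₂ A₁) * (ε * S) := by
  have c1 := cst_nonneg h.one_le hg1
  have c2 := cst_nonneg h.one_le hg2
  have hεS : 0 ≤ ε * S := by positivity
  have p1 := mul_nonneg c1.le hεS
  have p2 := mul_nonneg c2.le hεS
  by_cases hc : (0 ≤ τ₂ ∧ τ₂ ≤ τ₁) ∨ (τ₁ ≤ τ₂ ∧ τ₂ ≤ 0)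
  · have := sign_pair1 h h1 hg1 hS hε hD ht1 ht2 l1 l2 hc
    linarith
  · have := sign_pair1 h h2 hg2 hS hε hD ht2 ht1 l2 l1 (by omega)
    linarith

lemma main_bound (h : TFlow φ C) (hP : Rot φ P) (hPc : IsCompact P) (hint : (interior P).Nonempty) :
    ∃ M0 : ℝ, 0 < M0 ∧ ∀ S ≥ M0, ∀ K : Set ℂ, IsPreconnected K →
      (∀ j : ℤ, ∀ y ∈ K, ∀ y' ∈ K, ‖φ j y - φ j y'‖ ≤ S) → ∀ z ∈ K, ∀ z' ∈ K, ‖z - z'‖ < S / 2 := by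
  obtain ⟨A, B, D, mA, mB, mD, hA, hB, hD, hc⟩ := triple hPc hint
  have hAB : A - B ≠ 0 := by
    intro h0
    have : B - A = 0 := by linear_combination -h0
    rw [this] at hc; simp [cross] at hc
  have hAD : A - D ≠ 0 := by
    intro h0
    have : D - A = 0 := by linear_combination -h0
    rw [this] at hc; simp [cross] at hc
  have hBD : B - D ≠ 0 := by
    intro h0
    have : B = D := by linear_combination h0
    rw [this] at hc; simp [cross, mul_comm] at hc
  have hBA : B - A ≠ 0 := by rw [← neg_sub]; exact neg_ne_zero.2 hAB
  have hDA : D - A ≠ 0 := by rw [← neg_sub]; exact neg_ne_zero.2 hAD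
  have hDB : D - B ≠ 0 := by rw [← neg_sub]; exact neg_ne_zero.2 hBD
  have gAB := hA.dot_pos hB.1 hAB
  have gAD := hA.dot_pos hD.1 hAD
  have gBA := hB.dot_pos hA.1 hBA
  have gBD := hB.dot_pos hD.1 hBD
  have gDA := hD.dot_pos hA.1 hDA
  have gDB := hD.dot_pos hB.1 hDB
  have mA0 := ne_of_dot_pos gAB
  have mB0 := ne_of_dot_pos gBA
  have mD0 := ne_of_dot_pos gDA
  have hC := h.one_le
  have kAB := cst_nonneg hC gAB
  have kAD := cst_nonneg hC gAD
  have kBA := cst_nonneg hC gBA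
  have kBD := cst_nonneg hC gBD
  have kDA := cst_nonneg hC gDA
  have kDB := cst_nonneg hC gDB
  set c : ℝ := cst C A mA B + cst C B mB A + (cst C A mA D + cst C D mD A) + (cst C B mB D + cst C D mD B) with hcdef
  have hc0 : 0 < c := by positivity
  set ε : ℝ := 1 / (4 * c) with hε
  have hε0 : 0 < ε := by positivity
  have hcε : c * ε = 1 / 4 := by rw [hε]; field_simp
  have cA : cross (A - B) (A - D) ≠ 0 := by
    intro h0; apply hc; rw [← h0]; simp [cross]; ring
  have cB : cross (B - A) (B - D) ≠ 0 := by
    intro h0; apply hc; rw [← neg_eq_zero, ← h0]; simp [cross]; ring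
  have cD : cross (D - A) (D - B) ≠ 0 := by
    intro h0; apply hc; rw [← h0]; simp [cross]; ring
  obtain ⟨ΛA, hΛA, fA⟩ := lag_all h hP hA hB hD mA0 mB0 mD0 cA hε0
  obtain ⟨ΛB, hΛB, fB⟩ := lag_all h hP hB hA hD mB0 mA0 mD0 cB hε0
  obtain ⟨ΛD, hΛD, fD⟩ := lag_all h hP hD hA hB mD0 mA0 mB0 cD hε0
  set Λ : ℝ := ΛA + ΛB + ΛD with hΛ
  have hΛ0 : 0 < Λ := by positivity
  have hT : Tendsto (fun S : ℝ => 2 * Λ * S) atTop atTop := tendsto_id.const_mul_atTop (by positivity)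
  have hev := (fA.and (fB.and (fD.and ((hT.eventually (D2 h hP (by positivity : 0 < ε / (2 * Λ)))).and
    (eventually_ge_atTop (1:ℝ))))))
  obtain ⟨M0, hM0⟩ := eventually_atTop.1 hev
  refine ⟨max M0 1, by positivity, fun S hS => ?_⟩
  obtain ⟨f1, f2, f3, f4, hS1⟩ := hM0 S ((le_max_left _ _).trans hS)
  intro K hK hd z hz z' hz'
  have eT : ε / (2 * Λ) * (2 * Λ * S) = ε * S := by field_simp
  rw [eT] at f4
  obtain ⟨τA, tA, lA⟩ := f1 K hK hd z hz z' hz'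
  obtain ⟨τB, tB, lB⟩ := f2 K hK hd z hz z' hz'
  obtain ⟨τD, tD, lD⟩ := f3 K hK hd z hz z' hz'
  have bA : ΛA * S ≤ Λ * S := by gcongr; linarith
  have bB : ΛB * S ≤ Λ * S := by gcongr; linarith
  have bD : ΛD * S ≤ Λ * S := by gcongr; linarith
  have tA' := tA.trans bA
  have tB' := tB.trans bB
  have tD' := tD.trans bD
  have hS0 : 0 ≤ S := by linarith
  have hεS : 0 ≤ ε * S := by positivity
  have key : ‖z - z'‖ ≤ c * (ε * S) := by
    rcases (by omega : ((0 ≤ τB ∧ 0 ≤ τA) ∨ (τA ≤ 0 ∧ τB ≤ 0)) ∨ ((0 ≤ τD ∧ 0 ≤ τA) ∨ (τA ≤ 0 ∧ τD ≤ 0)) ∨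
      ((0 ≤ τD ∧ 0 ≤ τB) ∨ (τB ≤ 0 ∧ τD ≤ 0))) with hs | hs | hs
    · refine (sign_pair h hA hB gAB gBA hS0 hε0.le f4 tA' tB' lA lB hs).trans ?_
      gcongr; linarith
    · refine (sign_pair h hA hD gAD gDA hS0 hε0.le f4 tA' tD' lA lD hs).trans ?_
      gcongr; linarith
    · refine (sign_pair h hB hD gBD gDB hS0 hε0.le f4 tB' tD' lB lD hs).trans ?_
      gcongr; linarith
  rw [← mul_assoc, hcε] at key
  linarith

/-- dynamically bounded connected sets are uniformly bounded -/
lemma bounded_sets (h : TFlow φ C) (hP : Rot φ P) (hPc : IsCompact P) (hint : (interior P).Nonempty) :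
    ∃ M0 : ℝ, 0 < M0 ∧ ∀ K : Set ℂ, IsPreconnected K →
      (∃ S, ∀ j : ℤ, ∀ y ∈ K, ∀ y' ∈ K, ‖φ j y - φ j y'‖ ≤ S) → ∀ z ∈ K, ∀ z' ∈ K, ‖z - z'‖ ≤ M0 := by
  obtain ⟨M0, hM0, hb⟩ := main_bound h hP hPc hint
  refine ⟨M0, hM0, ?_⟩
  rintro K hK ⟨S, hS⟩ z hz z' hz'
  -- halve the bound repeatedly
  have step : ∀ T, M0 ≤ T → (∀ j : ℤ, ∀ y ∈ K, ∀ y' ∈ K, ‖φ j y - φ j y'‖ ≤ T) →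
      ∀ j : ℤ, ∀ y ∈ K, ∀ y' ∈ K, ‖φ j y - φ j y'‖ ≤ T / 2 := by
    intro T hT hd j y hy y' hy'
    refine (hb T hT (φ j '' K) (hK.image _ (h.cont j).continuousOn) ?_ _ (mem_image_of_mem _ hy) _
      (mem_image_of_mem _ hy')).le
    rintro i _ ⟨u, hu, rfl⟩ _ ⟨u', hu', rfl⟩
    rw [← h.add, ← h.add]
    exact hd _ u hu u' hu'
  have claim : ∀ n : ℕ, ∀ j : ℤ, ∀ y ∈ K, ∀ y' ∈ K, ‖φ j y - φ j y'‖ ≤ max M0 (|S| / 2^n) := by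
    intro n
    induction n with
    | zero =>
      intro j y hy y' hy'
      refine (hS j y hy y' hy').trans ((le_abs_self S).trans ?_)
      simp
    | succ n ih =>
      intro j y hy y' hy'
      refine (step _ (le_max_left _ _) ih j y hy y' hy').trans ?_
      rcases le_total M0 (|S| / 2^n) with h1 | h1
      · rw [max_eq_right h1]
        refine le_trans (le_of_eq ?_) (le_max_right _ _)
        rw [pow_succ]; ring
      · rw [max_eq_left h1]
        exact le_trans (by linarith) (le_max_left _ _)
  obtain ⟨n, hn⟩ := pow_unbounded_of_one_lt (|S| / M0) (by norm_num : (1:ℝ) < 2)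
  have := claim n 0 z hz z' hz'
  rw [h.zero, h.zero, max_eq_left] at this
  · exact this
  · rw [div_le_iff₀ (by positivity)]
    rw [div_lt_iff₀ hM0] at hn
    linarith

end UBC


namespace UBC

variable {φ : ℤ → ℂ → ℂ} {C : ℝ} {P : Set ℂ}

def rotQ (φ : ℤ → ℂ → ℂ) : Set ℂ :=
  {v | ∃ (z : ℕ → ℂ) (n : ℕ → ℕ), Tendsto n atTop atTop ∧
    Tendsto (fun k => ((n k : ℝ))⁻¹ • (φ (n k) (z k) - z k)) atTop (nhds v)}

lemma quot_bd (h : TFlow φ C) (n : ℕ) (z : ℂ) : ‖((n : ℝ))⁻¹ • (φ n z - z)‖ ≤ C := by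
  have hC := h.one_le
  have h1 := iter_bd h n z
  rw [norm_smul, norm_inv, Real.norm_natCast]
  rcases Nat.eq_zero_or_pos n with hn | hn
  · subst hn; simp; linarith
  · have hn' : (0:ℝ) < n := by exact_mod_cast hn
    rw [inv_mul_le_iff₀ hn']
    simp only [Int.cast_natCast, Nat.abs_cast] at h1
    linarith

lemma rotQ_bd (h : TFlow φ C) : rotQ φ ⊆ closedBall 0 C := by
  rintro v ⟨z, n, hn, hv⟩
  exact isClosed_closedBall.mem_of_tendsto hv (Eventually.of_forall fun k => by
    simpa using quot_bd h (n k) (z k))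

lemma quot_norm (n : ℕ) (hn : 0 < n) (d v : ℂ) :
    ‖d - (n:ℂ) * v‖ = n * ‖((n : ℝ))⁻¹ • d - v‖ := by
  have hn' : (n:ℂ) ≠ 0 := by exact_mod_cast hn.ne'
  have : d - (n:ℂ) * v = (n:ℂ) * (((n : ℝ))⁻¹ • d - v) := by
    rw [Complex.real_smul]; push_cast; field_simp
  rw [this, norm_mul, Complex.norm_natCast]

lemma rot_of (h : TFlow φ C) (hne : (rotQ φ).Nonempty) : Rot φ (closure (rotQ φ)) where
  D := by
    intro ε hε
    by_contra hcon
    push Not at hcon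
    choose S hS j hj0 hjS z hz using fun k : ℕ => hcon (k:ℝ)
    obtain ⟨v0, hv0⟩ := hne
    have hC := h.one_le
    have hlow : ∀ k, ε * k ≤ (C + ‖v0‖) * (j k : ℝ) := by
      intro k
      have h1 := hz k v0 (subset_closure hv0)
      have h2 := iter_bd h (j k) (z k)
      have h0 : (0:ℝ) ≤ j k := by exact_mod_cast hj0 k
      rw [abs_of_nonneg h0] at h2
      have h3 : ‖φ (j k) (z k) - z k - (j k) * v0‖ ≤ ‖φ (j k) (z k) - z k‖ + ‖(j k : ℂ) * v0‖ :=
        norm_sub_le _ _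
      rw [norm_mul, Complex.norm_intCast, abs_of_nonneg h0] at h3
      have h4 : ε * k ≤ ε * S k := mul_le_mul_of_nonneg_left (hS k) hε.le
      nlinarith
    obtain ⟨n, hn⟩ : ∃ n : ℕ → ℕ, ∀ k, j k = (n k : ℤ) :=
      ⟨fun k => (j k).toNat, fun k => (Int.toNat_of_nonneg (hj0 k)).symm⟩
    have hpos : 0 < C + ‖v0‖ := by positivity
    have hnt : Tendsto n atTop atTop := by
      rw [← tendsto_natCast_atTop_iff (R := ℝ)]
      refine tendsto_atTop_mono (f := fun k : ℕ => (ε / (C + ‖v0‖)) * (k:ℝ)) ?_ ?_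
      · intro k
        have := hlow k
        rw [hn k] at this
        push_cast at this
        rw [div_mul_eq_mul_div, div_le_iff₀ hpos]
        linarith
      · exact (tendsto_natCast_atTop_atTop).const_mul_atTop (by positivity)
    obtain ⟨v, -, s, hs, hv⟩ := (isCompact_closedBall (0:ℂ) C).tendsto_subseq
      (x := fun k => ((n k : ℝ))⁻¹ • (φ (n k) (z k) - z k))
      (fun k => by simpa using quot_bd h (n k) (z k))
    have hvQ : v ∈ rotQ φ := ⟨z ∘ s, n ∘ s, hnt.comp hs.tendsto_atTop, hv⟩
    have e1 := (Metric.tendsto_nhds.1 hv) ε hε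
    have e2 := (hnt.comp hs.tendsto_atTop).eventually_ge_atTop 1
    obtain ⟨k, hk1, hk2⟩ := (e1.and e2).exists
    have h5 := hz (s k) v (subset_closure hvQ)
    have h6 := hjS (s k)
    rw [hn (s k)] at h5 h6
    push_cast at h5 h6
    rw [quot_norm (n (s k)) hk2] at h5
    rw [dist_eq_norm] at hk1
    simp only [Function.comp] at hk1
    have : (0:ℝ) ≤ n (s k) := by positivity
    nlinarith
  R := by
    intro A hA ε hε N
    obtain ⟨v, ⟨z, n, hn, hv⟩, hAv⟩ := Metric.mem_closure_iff.1 hA (ε/2) (by positivity)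
    have e1 := (Metric.tendsto_nhds.1 hv) (ε/2) (by positivity)
    have e2 := hn.eventually_ge_atTop (max 1 N.toNat)
    obtain ⟨k, hk1, hk2⟩ := (e1.and e2).exists
    refine ⟨n k, ?_, z k, ?_⟩
    · have : N.toNat ≤ n k := le_trans (le_max_right _ _) hk2
      omega
    · push_cast
      rw [quot_norm _ (lt_of_lt_of_le Nat.one_pos (le_trans (le_max_left _ _) hk2))]
      rw [mul_comm ε]
      apply mul_le_mul_of_nonneg_left _ (by positivity)
      rw [← dist_eq_norm]
      have := dist_triangle_right (((n k : ℝ))⁻¹ • (φ (n k) (z k) - z k)) A v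
      linarith

lemma iterZ_eq {X : Type*} [TopologicalSpace X] (F : X ≃ₜ X) (j : ℤ) :
    iterZ F j = ⇑((F.toEquiv : Equiv.Perm X) ^ j) := by
  cases j with
  | ofNat n => 
    simp only [iterZ, Int.ofNat_eq_natCast, zpow_natCast]
    rw [← Equiv.Perm.iterate_eq_pow]; rfl
  | negSucc n =>
    simp only [iterZ, zpow_negSucc]
    rw [← inv_pow, ← Equiv.Perm.iterate_eq_pow]; rfl

lemma iterZ_cont {X : Type*} [TopologicalSpace X] (F : X ≃ₜ X) (j : ℤ) :
    Continuous (iterZ F j) := by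
  cases j with
  | ofNat n => exact F.continuous.iterate n
  | negSucc n => exact F.symm.continuous.iterate (n+1)

lemma iterZ_lat (F : R2 ≃ₜ R2) (w : R2) (hw : ∀ x, F (x + w) = F x + w) (j : ℤ) (x : R2) :
    iterZ F j (x + w) = iterZ F j x + w := by
  have hw' : ∀ x, F.symm (x + w) = F.symm x + w := by
    intro x
    apply F.injective
    rw [hw]; simp
  have gen : ∀ g : R2 → R2, (∀ x, g (x + w) = g x + w) → ∀ n : ℕ, ∀ x,
      g^[n] (x + w) = g^[n] x + w := by
    intro g hg n
    induction n with
    | zero => intro x; rfl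
    | succ n ih => intro x; rw [Function.iterate_succ_apply, hg, ih, Function.iterate_succ_apply]
  cases j with
  | ofNat n => exact gen _ hw n x
  | negSucc n => exact gen _ hw' (n+1) x

def T : ℂ ≃L[ℝ] ℝ × ℝ := Complex.equivRealProdCLM

lemma T_apply (z : ℂ) : T z = (z.re, z.im) := rfl

def phi (F : R2 ≃ₜ R2) (j : ℤ) (z : ℂ) : ℂ := T.symm (iterZ F j (T z))

lemma disp_bd (F : R2 ≃ₜ R2)
    (hF : ∀ (x : R2) (v : ℤ × ℤ), F (x + ((v.1 : ℝ), (v.2 : ℝ))) = F x + ((v.1 : ℝ), (v.2 : ℝ))) :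
    ∃ C : ℝ, 1 ≤ C ∧ ∀ z : ℂ, ‖phi F 1 z - z‖ ≤ C := by
  have hc : Continuous (fun x : R2 => ‖T.symm (F x - x)‖) :=
    (T.symm.continuous.comp (F.continuous.sub continuous_id)).norm
  obtain ⟨B, hB⟩ := (isCompact_Icc (a := ((0:ℝ),(0:ℝ))) (b := ((1:ℝ),(1:ℝ)))).bddAbove_image
    hc.continuousOn
  refine ⟨max B 1, le_max_right _ _, fun z => le_trans ?_ (le_max_left _ _)⟩
  have h1 : phi F 1 z - z = T.symm (F (T z) - T z) := by
    rw [map_sub, T.symm_apply_apply]; rfl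
  have h2 : T z = (Int.fract z.re, Int.fract z.im) + (((⌊z.re⌋ : ℤ) : ℝ), ((⌊z.im⌋ : ℤ) : ℝ)) := by
    rw [T_apply]; ext <;> simp
  have h3 : F (T z) - T z = F (Int.fract z.re, Int.fract z.im) - (Int.fract z.re, Int.fract z.im) := by
    rw [h2]
    have := hF (Int.fract z.re, Int.fract z.im) (⌊z.re⌋, ⌊z.im⌋)
    simp only at this
    rw [this]; abel
  rw [h1, h3]
  apply hB
  refine ⟨(Int.fract z.re, Int.fract z.im), ⟨⟨?_, ?_⟩, ⟨?_, ?_⟩⟩, rfl⟩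
  · exact Int.fract_nonneg _
  · exact Int.fract_nonneg _
  · exact (Int.fract_lt_one _).le
  · exact (Int.fract_lt_one _).le

lemma tflow (F : R2 ≃ₜ R2)
    (hF : ∀ (x : R2) (v : ℤ × ℤ), F (x + ((v.1 : ℝ), (v.2 : ℝ))) = F x + ((v.1 : ℝ), (v.2 : ℝ))) :
    ∃ C : ℝ, TFlow (phi F) C := by
  obtain ⟨C, hC, hb⟩ := disp_bd F hF
  refine ⟨C, ?_, ?_, ?_, ?_, hC, hb⟩
  · intro z; simp [phi, iterZ_eq]
  · intro i j z
    simp [phi, iterZ_eq, zpow_add]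
  · intro j
    exact T.symm.continuous.comp ((iterZ_cont F j).comp T.continuous)
  · intro j z a b
    have h1 : T (z + (a + b * Complex.I)) = T z + ((a:ℝ), (b:ℝ)) := by
      simp [T_apply]
    have h2 : ((a:ℂ) + b * Complex.I) = T.symm ((a:ℝ), (b:ℝ)) := by
      rw [ContinuousLinearEquiv.eq_symm_apply]; simp [T_apply]
    unfold phi
    rw [h1, iterZ_lat F _ (fun x => hF x (a, b)), map_add, h2]

lemma rotQ_eq (F : R2 ≃ₜ R2) : rotQ (phi F) = T.symm '' rotSet F := by
  ext v
  constructor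
  · rintro ⟨z, n, hn, hv⟩
    refine ⟨T v, ⟨fun k => T (z k), n, hn, ?_⟩, by simp⟩
    have := (T.continuous.tendsto v).comp hv
    refine this.congr fun k => ?_
    simp only [Function.comp, phi, map_smul, map_sub, T.apply_symm_apply]
    rfl
  · rintro ⟨w, ⟨z, n, hn, hv⟩, rfl⟩
    refine ⟨fun k => T.symm (z k), n, hn, ?_⟩
    have := (T.symm.continuous.tendsto w).comp hv
    refine this.congr fun k => ?_
    simp only [Function.comp, phi, map_smul, map_sub, T.apply_symm_apply]
    rfl

lemma norm_T_symm (x : R2) : ‖T.symm x‖ ≤ 2 * ‖x‖ := by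
  have h := Complex.norm_le_abs_re_add_abs_im (T.symm x)
  have h1 : (T.symm x).re = x.1 := rfl
  have h2 : (T.symm x).im = x.2 := rfl
  rw [h1, h2] at h
  have h3 := norm_fst_le x
  have h4 := norm_snd_le x
  rw [Real.norm_eq_abs] at h3 h4
  linarith

lemma norm_T (z : ℂ) : ‖T z‖ ≤ ‖z‖ := by
  rw [T_apply, Prod.norm_def]
  exact max_le (Complex.abs_re_le_norm z) (Complex.abs_im_le_norm z)

end UBC

/-- **Uniformly bounded classes.** The equivalence classes of the dynamically-bounded
relation have uniformly bounded diameter. -/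
theorem uniformly_bounded_classes
    (f : Torus ≃ₜ Torus) (F : R2 ≃ₜ R2) (hF : IsLiftFun ⇑f ⇑F)
    (hrot : (interior (rotSet F)).Nonempty) :
    ∃ M : ℝ, 0 < M ∧ ∀ z : R2, EMetric.diam (dynClass F z) < ENNReal.ofReal M := by
  obtain ⟨C, h⟩ := UBC.tflow F hF.2
  have hint : (interior (closure (UBC.rotQ (UBC.phi F)))).Nonempty := by
    have h1 : (interior (UBC.rotQ (UBC.phi F))).Nonempty := by
      rw [UBC.rotQ_eq]
      have := UBC.T.symm.toHomeomorph.image_interior (rotSet F)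
      have e : (UBC.T.symm.toHomeomorph '' rotSet F) = UBC.T.symm '' rotSet F := rfl
      rw [e] at this
      rw [← this]
      exact hrot.image _
    exact h1.mono (interior_mono subset_closure)
  have hne : (UBC.rotQ (UBC.phi F)).Nonempty := closure_nonempty_iff.1 (hint.mono interior_subset)
  have hcomp : IsCompact (closure (UBC.rotQ (UBC.phi F))) :=
    (isCompact_closedBall (0:ℂ) C).of_isClosed_subset isClosed_closure
      (closure_minimal (UBC.rotQ_bd h) isClosed_closedBall)
  obtain ⟨M0, hM0, hM⟩ := UBC.bounded_sets h (UBC.rot_of h hne) hcomp hint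
  have key : ∀ z z', z' ∈ dynClass F z → dist z z' ≤ M0 := by
    rintro z z' ⟨K, ⟨hKc, hKconn⟩, hz, hz', hd⟩
    have hpre : IsPreconnected (UBC.T.symm '' K) :=
      hKconn.isPreconnected.image _ UBC.T.symm.continuous.continuousOn
    have h1 := hM _ hpre ⟨2 * (dynDiam F K).toReal, ?_⟩ _ (mem_image_of_mem _ hz) _
      (mem_image_of_mem _ hz')
    · rw [← map_sub] at h1
      have h2 := UBC.norm_T (UBC.T.symm (z - z'))
      rw [UBC.T.apply_symm_apply] at h2
      rw [dist_eq_norm]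
      exact h2.trans h1
    · rintro j _ ⟨y, hy, rfl⟩ _ ⟨y', hy', rfl⟩
      simp only [UBC.phi, UBC.T.apply_symm_apply]
      rw [← map_sub]
      refine (UBC.norm_T_symm _).trans ?_
      apply mul_le_mul_of_nonneg_left _ (by norm_num)
      rw [← dist_eq_norm, dist_edist]
      apply ENNReal.toReal_mono hd
      refine le_trans ?_ (le_iSup (fun j : ℤ => EMetric.diam (iterZ F j '' K)) j)
      exact EMetric.edist_le_diam_of_mem (mem_image_of_mem _ hy) (mem_image_of_mem _ hy')
  refine ⟨2 * M0 + 1, by linarith, fun z => ?_⟩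
  refine lt_of_le_of_lt (b := ENNReal.ofReal (2 * M0)) ?_
    ((ENNReal.ofReal_lt_ofReal_iff (by linarith)).2 (by linarith))
  apply EMetric.diam_le
  intro x hx y hy
  rw [edist_dist]
  apply ENNReal.ofReal_le_ofReal
  have h1 := key z x hx
  have h2 := key z y hy
  have h3 := dist_triangle_left x y z
  linarith
end
end

section
/- Let f be a homeomorphism of T² homotopic to the identity such that ρ(f) has nonempty interior, let f̂ be a lift, and let K̂ ⊂ ℝ² be a dynamically bounded continuum for f̂. Then (K̂ + v) ∩ K̂ = ∅ for every v ∈ ℤ² with v ≠ (0,0). -/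
open Metric Filter Topology MeasureTheory Set ENNReal

noncomputable section

/-- A continuous function whose sine is positive stays in one interval `(2πk, 2πk+π)`. -/
lemma sin_pos_trap (g : ℝ → ℝ) (hg : Continuous g) (h : ∀ t, 0 < Real.sin (g t)) :
    ∃ k : ℤ, ∀ t, 2 * (k : ℝ) * Real.pi < g t ∧ g t < (2 * (k : ℝ) + 1) * Real.pi := by
  have hpi := Real.pi_pos
  have hne : ∀ (m : ℤ) (t : ℝ), g t ≠ m * Real.pi := by
    intro m t hm
    have := h t
    rw [hm, Real.sin_int_mul_pi] at this
    exact lt_irrefl _ this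
  have key : ∀ (m : ℤ) (s t : ℝ), g s < m * Real.pi → g t < m * Real.pi := by
    intro m s t hs
    by_contra hcon
    push Not at hcon
    have : (m * Real.pi : ℝ) ∈ range g :=
      mem_range_of_exists_le_of_exists_ge hg ⟨s, hs.le⟩ ⟨t, hcon⟩
    obtain ⟨u, hu⟩ := this
    exact hne m u hu
  set j : ℤ := ⌊g 0 / Real.pi⌋ with hj
  have h1 : (j : ℝ) * Real.pi ≤ g 0 := by
    have := Int.floor_le (g 0 / Real.pi)
    rwa [le_div_iff₀ hpi] at this
  have h2 : g 0 < ((j + 1 : ℤ) : ℝ) * Real.pi := by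
    have := Int.lt_floor_add_one (g 0 / Real.pi)
    rw [div_lt_iff₀ hpi] at this
    push_cast
    exact this
  have hall : ∀ t, (j : ℝ) * Real.pi < g t ∧ g t < ((j + 1 : ℤ) : ℝ) * Real.pi := by
    intro t
    refine ⟨?_, key _ 0 t h2⟩
    by_contra hcon
    push Not at hcon
    have := key j t 0 (lt_of_le_of_ne hcon (hne j t))
    linarith
  rcases Int.even_or_odd' j with ⟨k, hk | hk⟩
  · refine ⟨k, fun t => ?_⟩
    have := hall t
    rw [hk] at this
    push_cast at this
    exact this
  · exfalso
    have h0 := h 0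
    have h3 := hall 0
    rw [hk] at h3
    push_cast at h3
    have h4 : Real.sin (g 0 - (2 * k + 1 : ℤ) * Real.pi) > 0 := by
      apply Real.sin_pos_of_pos_of_lt_pi
      · push_cast; linarith [h3.1]
      · push_cast; linarith [h3.2]
    have h5 : Real.sin (g 0 - (2 * k + 1 : ℤ) * Real.pi) = - Real.sin (g 0) := by
      have : g 0 - ((2 * k + 1 : ℤ) : ℝ) * Real.pi = (g 0 - Real.pi) - k * (2 * Real.pi) := by
        push_cast; ring
      rw [this, Real.sin_sub_int_mul_two_pi, Real.sin_sub_pi]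
    linarith

/-- Crossing lemma in winding-number form. -/
lemma no_winding (Φ : ℝ × ℝ → ℂ) (hΦ : Continuous Φ) (h0 : ∀ x, Φ x ≠ 0)
    (hl : ∀ t, (Φ (0, t)).re < 0) (hr : ∀ t, 0 < (Φ (1, t)).re)
    (hb : ∀ s, 0 < (Φ (s, 0)).im) (ht : ∀ s, (Φ (s, 1)).im < 0) : False := by
  have hpi := Real.pi_pos
  obtain ⟨G, ⟨-, hG⟩, -⟩ := Complex.isCoveringMap_exp.existsUnique_continuousMap_lifts
    (A := ℝ × ℝ) ⟨fun x => ⟨Φ x, h0 x⟩, by fun_prop⟩ (0, 0) (Complex.log (Φ (0, 0)))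
    (by simp [Complex.exp_log (h0 _)])
  have hexp : ∀ x, Complex.exp (G x) = Φ x := by
    intro x
    have := congrFun hG x
    simpa using congrArg Subtype.val this
  have hre : ∀ x, (Φ x).re = Real.exp (G x).re * Real.cos (G x).im := fun x => by
    rw [← hexp, Complex.exp_re]
  have him : ∀ x, (Φ x).im = Real.exp (G x).re * Real.sin (G x).im := fun x => by
    rw [← hexp, Complex.exp_im]
  have hGc : Continuous fun x => (G x).im := Complex.continuous_im.comp G.continuous
  obtain ⟨k1, hk1⟩ := sin_pos_trap (fun s => (G (s, 0)).im) (hGc.comp (by fun_prop)) (fun s => by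
    have := hb s
    rw [him] at this
    exact (pos_iff_pos_of_mul_pos this).1 (Real.exp_pos _))
  obtain ⟨k2, hk2⟩ := sin_pos_trap (fun t => (G (1, t)).im + Real.pi / 2)
    ((hGc.comp (f := fun t : ℝ => ((1 : ℝ), t)) (by fun_prop)).add continuous_const) (fun t => by
    have := hr t
    rw [hre] at this
    rw [Real.sin_add_pi_div_two]
    exact (pos_iff_pos_of_mul_pos this).1 (Real.exp_pos _))
  obtain ⟨k3, hk3⟩ := sin_pos_trap (fun s => (G (s, 1)).im + Real.pi)
    ((hGc.comp (f := fun t : ℝ => (t, (1 : ℝ))) (by fun_prop)).add continuous_const) (fun s => by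
    have := ht s
    rw [him] at this
    rw [Real.sin_add_pi]
    by_contra hcon
    nlinarith [mul_nonneg (Real.exp_pos (G (s, 1)).re).le (by linarith : 0 ≤ Real.sin (G (s, 1)).im)])
  obtain ⟨k4, hk4⟩ := sin_pos_trap (fun t => (G (0, t)).im - Real.pi / 2)
    ((hGc.comp (f := fun t : ℝ => ((0 : ℝ), t)) (by fun_prop)).sub continuous_const) (fun t => by
    have := hl t
    rw [hre] at this
    rw [Real.sin_sub_pi_div_two]
    by_contra hcon
    nlinarith [mul_nonneg (Real.exp_pos (G (0, t)).re).le (by linarith : 0 ≤ Real.cos (G (0, t)).im)])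
  have cmp : ∀ (a b : ℤ) (c : ℝ), c ≤ 2 → 2 * (a : ℝ) * Real.pi < (2 * (b : ℝ) + c) * Real.pi →
      a ≤ b := by
    intro a b c hc h
    have h' := lt_of_mul_lt_mul_right h hpi.le
    have : (a : ℝ) < ((b + 1 : ℤ) : ℝ) := by push_cast; linarith
    have := Int.cast_lt.1 this
    omega
  have e1 : k1 ≤ k2 := cmp k1 k2 (1/2) (by norm_num) (by linarith [(hk1 1).1, (hk2 0).2])
  have e2 : k2 ≤ k3 := cmp k2 k3 (1/2) (by norm_num) (by linarith [(hk2 1).1, (hk3 1).2])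
  have e3 : k4 + 1 ≤ k3 :=
    cmp (k4 + 1) k3 (3/2) (by norm_num) (by push_cast; linarith [(hk4 1).1, (hk3 0).2])
  have e3' : k3 ≤ k4 + 1 :=
    cmp k3 (k4 + 1) (1/2) (by norm_num) (by push_cast; linarith [(hk4 1).2, (hk3 0).1])
  have e4 : k1 ≤ k4 := cmp k1 k4 (3/2) (by norm_num) (by linarith [(hk1 0).1, (hk4 0).2])
  have e4' : k4 ≤ k1 := cmp k4 k1 (1/2) (by norm_num) (by linarith [(hk1 0).2, (hk4 0).1])
  have e1' : k2 ≤ k1 := cmp k2 k1 (3/2) (by norm_num) (by linarith [(hk1 1).2, (hk2 0).1])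
  have e2' : k3 ≤ k2 := cmp k3 k2 (3/2) (by norm_num) (by linarith [(hk2 1).2, (hk3 1).1])
  omega

/-- Height transverse to the direction `v`. -/
def hgt (v : ℤ × ℤ) (x : R2) : ℝ := v.1 * x.2 - v.2 * x.1

/-- Coordinate along the direction `v`. -/
def lng (v : ℤ × ℤ) (x : R2) : ℝ := v.1 * x.1 + v.2 * x.2

/-- The integer vector as a point of the plane. -/
def vec (v : ℤ × ℤ) : R2 := ((v.1 : ℝ), (v.2 : ℝ))

lemma nsq_pos {v : ℤ × ℤ} (hv : v ≠ 0) : (0 : ℝ) < v.1 ^ 2 + v.2 ^ 2 := by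
  by_contra h
  push Not at h
  have h1 : (v.1 : ℝ) ^ 2 = 0 := by nlinarith [sq_nonneg (v.1 : ℝ), sq_nonneg (v.2 : ℝ)]
  have h2 : (v.2 : ℝ) ^ 2 = 0 := by nlinarith [sq_nonneg (v.1 : ℝ), sq_nonneg (v.2 : ℝ)]
  apply hv
  ext
  · simpa using h1
  · simpa using h2

lemma continuous_hgt (v : ℤ × ℤ) : Continuous (hgt v) := by unfold hgt; fun_prop
lemma continuous_lng (v : ℤ × ℤ) : Continuous (lng v) := by unfold lng; fun_prop

/-- A path crossing a strip meets any connected set that runs along the strip. -/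
lemma crossing {v : ℤ × ℤ} (hv : v ≠ 0) (L : Set R2) (hL : IsPreconnected L) (z : R2)
    (hz : ∀ m : ℤ, z + (m : ℝ) • vec v ∈ L) (a b : ℝ)
    (hab : ∀ x ∈ L, a < hgt v x ∧ hgt v x < b) (γ : ℝ → R2) (hγ : Continuous γ)
    (h0 : hgt v (γ 0) < a) (h1 : b < hgt v (γ 1)) : ∃ t ∈ Icc (0 : ℝ) 1, γ t ∈ L := by
  by_contra hcon
  push Not at hcon
  have hn := nsq_pos hv
  have hcpt : IsCompact (γ '' Icc 0 1) := isCompact_Icc.image hγ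
  set U : Set R2 := (hgt v ⁻¹' Ioo a b) ∩ (γ '' Icc 0 1)ᶜ with hU
  have hUo : IsOpen U := (isOpen_Ioo.preimage (continuous_hgt v)).inter hcpt.isClosed.isOpen_compl
  have hLU : L ⊆ U := by
    intro x hx
    refine ⟨hab x hx, ?_⟩
    rintro ⟨t, ht, rfl⟩
    exact hcon t ht hx
  have hzL : z ∈ L := by simpa using hz 0
  have hsub : L ⊆ connectedComponentIn U z := hL.subset_connectedComponentIn hzL hLU
  have hpc : IsPathConnected (connectedComponentIn U z) :=
    hUo.connectedComponentIn.isConnected_iff_isPathConnected.1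
      (isConnected_connectedComponentIn_iff.2 (hLU hzL))
  obtain ⟨M, hM⟩ := (isCompact_Icc.image ((continuous_lng v).comp hγ)).isBounded.exists_norm_le
    (s := (lng v ∘ γ) '' Icc (0 : ℝ) 1)
  obtain ⟨N, hN⟩ := exists_int_gt ((M + |lng v z|) / ((v.1 : ℝ) ^ 2 + v.2 ^ 2))
  rw [div_lt_iff₀ hn] at hN
  have hlng : ∀ m : ℤ, lng v (z + (m : ℝ) • vec v) = lng v z + m * ((v.1 : ℝ) ^ 2 + v.2 ^ 2) := by
    intro m; simp [lng, vec]; ring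
  obtain ⟨α, hα⟩ := hpc.joinedIn _ (hsub (hz (-N))) _ (hsub (hz N))
  have hαU : ∀ s : ℝ, α.extend s ∈ U := fun s =>
    connectedComponentIn_subset U z (by
      have := hα (projIcc 0 1 zero_le_one s)
      simpa [Path.extend, IccExtend] using this)
  let c : ℝ → ℝ := fun t => projIcc (0 : ℝ) 1 zero_le_one t
  have hc : Continuous c := continuous_subtype_val.comp continuous_projIcc
  have hcm : ∀ t, c t ∈ Icc (0 : ℝ) 1 := fun t => (projIcc (0 : ℝ) 1 zero_le_one t).2
  have hc0 : c 0 = 0 := by simp [c]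
  have hc1 : c 1 = 1 := by simp [c]
  have hMb : ∀ t, |lng v (γ (c t))| ≤ M := fun t => hM _ ⟨c t, hcm t, rfl⟩
  have hαc : Continuous α.extend := α.continuous_extend
  have hgc := continuous_hgt v
  have hlc := continuous_lng v
  refine no_winding (fun x => ⟨lng v (α.extend x.1) - lng v (γ (c x.2)),
    hgt v (α.extend x.1) - hgt v (γ (c x.2))⟩) ?_ ?_ ?_ ?_ ?_ ?_
  · have : (fun x : ℝ × ℝ => (⟨lng v (α.extend x.1) - lng v (γ (c x.2)),
        hgt v (α.extend x.1) - hgt v (γ (c x.2))⟩ : ℂ)) =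
      fun x => ((lng v (α.extend x.1) - lng v (γ (c x.2)) : ℝ) : ℂ) +
        ((hgt v (α.extend x.1) - hgt v (γ (c x.2)) : ℝ) : ℂ) * Complex.I := by
      funext x
      exact Complex.mk_eq_add_mul_I _ _
    rw [this]
    fun_prop
  · intro x hx
    have e1 := congrArg Complex.re hx
    have e2 := congrArg Complex.im hx
    simp only [Complex.zero_re, Complex.zero_im, lng, hgt] at e1 e2
    apply (hαU x.1).2
    refine ⟨c x.2, hcm _, ?_⟩
    ext
    · have : ((v.1 : ℝ) ^ 2 + v.2 ^ 2) * ((γ (c x.2)).1 - (α.extend x.1).1) = 0 := by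
        linear_combination -(v.1 : ℝ) * e1 + (v.2 : ℝ) * e2
      have := (mul_eq_zero.1 this).resolve_left hn.ne'
      linarith
    · have : ((v.1 : ℝ) ^ 2 + v.2 ^ 2) * ((γ (c x.2)).2 - (α.extend x.1).2) = 0 := by
        linear_combination -(v.2 : ℝ) * e1 - (v.1 : ℝ) * e2
      have := (mul_eq_zero.1 this).resolve_left hn.ne'
      linarith
  · intro t
    simp only [Path.extend_zero, hlng]
    have := (abs_le.1 (hMb t)).1
    have := le_abs_self (lng v z)
    push_cast
    linarith
  · intro t
    simp only [Path.extend_one, hlng]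
    have := (abs_le.1 (hMb t)).2
    have := neg_abs_le (lng v z)
    linarith
  · intro s
    have := (hαU s).1.1
    simp only [hc0]
    linarith
  · intro s
    have := (hαU s).1.2
    simp only [hc1]
    linarith

lemma iterate_vec {F : R2 → R2}
    (hF : ∀ (x : R2) (v : ℤ × ℤ), F (x + ((v.1 : ℝ), (v.2 : ℝ))) = F x + ((v.1 : ℝ), (v.2 : ℝ)))
    (n : ℕ) (x : R2) (w : ℤ × ℤ) : F^[n] (x + vec w) = F^[n] x + vec w := by
  induction n generalizing x with
  | zero => rfl
  | succ n ih =>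
    rw [Function.iterate_succ_apply, Function.iterate_succ_apply]
    have : F (x + vec w) = F x + vec w := hF x w
    rw [this, ih]

lemma smul_vec (m : ℤ) (v : ℤ × ℤ) : (m : ℝ) • vec v = vec (m • v) := by
  ext <;> simp [vec]

/-- One-sided control of the transverse displacement. -/
lemma disp_lower (F : R2 ≃ₜ R2)
    (hF : ∀ (x : R2) (v : ℤ × ℤ), F (x + ((v.1 : ℝ), (v.2 : ℝ))) = F x + ((v.1 : ℝ), (v.2 : ℝ)))
    (K : Set R2) (hK : IsPreconnected K) (D : ℝ)
    (hD : ∀ n : ℕ, ∀ x ∈ K, ∀ y ∈ K, dist ((⇑F)^[n] x) ((⇑F)^[n] y) ≤ D)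
    (v : ℤ × ℤ) (hv : v ≠ 0) (y : R2) (hy : y ∈ K) (hyv : y + vec v ∈ K) (z : R2) (hz : z ∈ K) :
    ∃ E : ℝ, ∀ (n : ℕ) (x : R2),
      hgt v ((⇑F)^[n] z) - hgt v z - E ≤ hgt v ((⇑F)^[n] x) - hgt v x := by
  have hn := nsq_pos hv
  have hgv : ∀ (m : ℤ) (x : R2), hgt v (x + (m : ℝ) • vec v) = hgt v x := by
    intro m x; simp [hgt, vec]; ring
  set w : ℤ × ℤ := (-v.2, v.1) with hw
  have hgw : ∀ (r : ℝ) (x : R2), hgt v (x + r • vec w) = hgt v x + r * ((v.1 : ℝ) ^ 2 + v.2 ^ 2) := by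
    intro r x; simp [hgt, vec, hw]; ring
  set C : ℝ := (|(v.1 : ℝ)| + |(v.2 : ℝ)|) * D + 1 with hC
  have hdist : ∀ n : ℕ, ∀ x ∈ K, |hgt v ((⇑F)^[n] x) - hgt v ((⇑F)^[n] z)| < C := by
    intro n x hx
    have h := hD n x hx z hz
    rw [Prod.dist_eq, max_le_iff, Real.dist_eq, Real.dist_eq] at h
    have e : hgt v ((⇑F)^[n] x) - hgt v ((⇑F)^[n] z) =
      v.1 * (((⇑F)^[n] x).2 - ((⇑F)^[n] z).2) - v.2 * (((⇑F)^[n] x).1 - ((⇑F)^[n] z).1) := by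
      simp only [hgt]; ring
    rw [e]
    refine lt_of_le_of_lt (abs_sub _ _) ?_
    rw [abs_mul, abs_mul]
    have h1 := mul_le_mul_of_nonneg_left h.2 (abs_nonneg (v.1 : ℝ))
    have h2 := mul_le_mul_of_nonneg_left h.1 (abs_nonneg (v.2 : ℝ))
    rw [hC]
    linarith
  set T : Set R2 := ⋃ m : ℤ, (fun x : R2 => x + (m : ℝ) • vec v) '' K with hT
  have hTc : IsPreconnected T := by
    apply IsPreconnected.iUnion_of_chain
    · intro m
      exact hK.image _ (by fun_prop)
    · intro m
      refine ⟨y + ((m + 1 : ℤ) : ℝ) • vec v, ⟨y + vec v, hyv, ?_⟩, ⟨y, hy, ?_⟩⟩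
      · push_cast; module
      · rfl
  have hiter : ∀ (n : ℕ) (m : ℤ) (x : R2),
      (⇑F)^[n] (x + (m : ℝ) • vec v) = (⇑F)^[n] x + (m : ℝ) • vec v := by
    intro n m x
    rw [smul_vec, iterate_vec hF]
  have hstrip : ∀ (n : ℕ), ∀ x ∈ (⇑F)^[n] '' T, hgt v ((⇑F)^[n] z) - C < hgt v x ∧
      hgt v x < hgt v ((⇑F)^[n] z) + C := by
    rintro n _ ⟨_, hxT, rfl⟩
    obtain ⟨m, x, hx, rfl⟩ := mem_iUnion.1 hxT
    simp only [hiter, hgv]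
    have := abs_lt.1 (hdist n x hx)
    constructor <;> linarith
  have hcont : ∀ n : ℕ, Continuous (⇑F)^[n] := fun n => F.continuous.iterate n
  have hinj : ∀ n : ℕ, Function.Injective (⇑F)^[n] := fun n => F.injective.iterate n
  have key : ∀ (n : ℕ) (x : R2), hgt v z + C ≤ hgt v x →
      hgt v ((⇑F)^[n] z) - C ≤ hgt v ((⇑F)^[n] x) := by
    intro n x hx
    by_contra hcon
    push Not at hcon
    obtain ⟨N, hN⟩ := exists_nat_gt
      ((hgt v ((⇑F)^[n] z) + C - hgt v ((⇑F)^[n] x)) / ((v.1 : ℝ) ^ 2 + v.2 ^ 2))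
    rw [div_lt_iff₀ hn] at hN
    obtain ⟨t, ht, htL⟩ := crossing hv ((⇑F)^[n] '' T) (hTc.image _ (hcont n).continuousOn)
      ((⇑F)^[n] z) (fun m => ⟨z + (m : ℝ) • vec v, mem_iUnion.2 ⟨m, z, hz, rfl⟩, hiter n m z⟩)
      _ _ (hstrip n) (fun t => (⇑F)^[n] (x + (t * N) • vec w))
      ((hcont n).comp (by fun_prop)) (by simpa using hcon) (by
        have : (⇑F)^[n] (x + ((1 : ℝ) * N) • vec w) = (⇑F)^[n] x + (N : ℝ) • vec w := by
          have := iterate_vec hF n x ((N : ℤ) • w)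
          rw [← smul_vec] at this
          simpa using this
        rw [this, hgw]
        linarith)
    obtain ⟨u, hu, hue⟩ := htL
    have hux := hinj n hue
    have := (hstrip 0 u ⟨u, hu, rfl⟩).2
    rw [hux, hgw] at this
    have h3 : 0 ≤ t * N * ((v.1 : ℝ) ^ 2 + v.2 ^ 2) :=
      mul_nonneg (mul_nonneg ht.1 (Nat.cast_nonneg _)) hn.le
    simp only [Function.iterate_zero, id] at this
    linarith
  refine ⟨2 * C + ((v.1 : ℝ) ^ 2 + v.2 ^ 2), fun n x => ?_⟩
  set S : ℝ := (v.1 : ℝ) ^ 2 + v.2 ^ 2 with hS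
  set m : ℤ := ⌈(hgt v z + C - hgt v x) / S⌉ with hm
  have m1 : hgt v z + C - hgt v x ≤ m * S := by
    have := Int.le_ceil ((hgt v z + C - hgt v x) / S)
    rwa [div_le_iff₀ hn] at this
  have m2 : (m : ℝ) * S < hgt v z + C - hgt v x + S := by
    have := Int.ceil_lt_add_one ((hgt v z + C - hgt v x) / S)
    calc (m : ℝ) * S < ((hgt v z + C - hgt v x) / S + 1) * S := by
          exact mul_lt_mul_of_pos_right this hn
      _ = _ := by field_simp
  have := key n (x + (m : ℝ) • vec w) (by rw [hgw]; linarith)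
  rw [smul_vec, iterate_vec hF, ← smul_vec, hgw] at this
  linarith

/-- Dynamically bounded continua are disjoint from all their nontrivial integer translates. -/
theorem dynamically_bounded_continua_inessential
    (f : Torus ≃ₜ Torus) (F : R2 ≃ₜ R2) (hF : IsLiftFun ⇑f ⇑F)
    (hrot : (interior (rotSet F)).Nonempty)
    (K : Set R2) (hK : IsContinuum K) (hbd : dynDiam F K ≠ ⊤) :
    ∀ v : ℤ × ℤ, v ≠ 0 →
      ((fun x : R2 => x + ((v.1 : ℝ), (v.2 : ℝ))) '' K) ∩ K = ∅ := by
  intro v hv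
  by_contra hne
  obtain ⟨y', ⟨y, hy, rfl⟩, hyv⟩ := nonempty_iff_ne_empty.2 hne
  have hyv : y + vec v ∈ K := hyv
  have hn := nsq_pos hv
  have hD : ∀ n : ℕ, ∀ x ∈ K, ∀ y ∈ K,
      dist ((⇑F)^[n] x) ((⇑F)^[n] y) ≤ (dynDiam F K).toReal := by
    intro n x hx y hy
    rw [dist_edist]
    refine ENNReal.toReal_mono hbd ?_
    refine le_trans (edist_le_ediam_of_mem (s := iterZ F (n : ℤ) '' K) ⟨x, hx, rfl⟩ ⟨y, hy, rfl⟩) ?_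
    exact le_iSup (fun j : ℤ => ediam (iterZ F j '' K)) (n : ℤ)
  obtain ⟨E1, hE1⟩ := disp_lower F hF.2 K hK.2.isPreconnected _ hD v hv y hy hyv y hy
  obtain ⟨E2, hE2⟩ := disp_lower F hF.2 K hK.2.isPreconnected _ hD (-v) (neg_ne_zero.2 hv)
    (y + vec v) hyv (by
      have : y + vec v + vec (-v) = y := by ext <;> simp [vec]
      rw [this]; exact hy) y hy
  have hneg : ∀ x, hgt (-v) x = - hgt v x := by intro x; simp [hgt]; ring
  simp only [hneg] at hE2
  set E := max E1 E2 with hE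
  set a : ℕ → ℝ := fun n => hgt v ((⇑F)^[n] y) - hgt v y with ha
  have hb : ∀ (n : ℕ) (x : R2), |hgt v ((⇑F)^[n] x) - hgt v x - a n| ≤ E := by
    intro n x
    have h1 := hE1 n x
    have h2 := hE2 n x
    have := le_max_left E1 E2
    have := le_max_right E1 E2
    rw [abs_le]
    constructor <;> simp only [ha] <;> linarith
  have hmul : ∀ (n m : ℕ), |a (m * n) - m * a n| ≤ m * E := by
    intro n m
    induction m with
    | zero => simp [ha]
    | succ m ih =>
      have h1 := hb n ((⇑F)^[m * n] y)
      rw [← Function.iterate_add_apply] at h1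
      have e : (m + 1) * n = n + m * n := by ring
      rw [e]
      have e2 : a (n + m * n) - ((m + 1 : ℕ) : ℝ) * a n =
        (hgt v ((⇑F)^[n + m * n] y) - hgt v ((⇑F)^[m * n] y) - a n) + (a (m * n) - m * a n) := by
        simp only [ha]; push_cast; ring
      rw [e2]
      refine (abs_add_le _ _).trans ?_
      push_cast
      linarith
  have hcomp : ∀ (n m : ℕ), 0 < n → 0 < m →
      |(n : ℝ)⁻¹ * a n - (m : ℝ)⁻¹ * a m| ≤ (n : ℝ)⁻¹ * E + (m : ℝ)⁻¹ * E := by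
    intro n m hn hm
    have hn' : (0 : ℝ) < n := Nat.cast_pos.2 hn
    have hm' : (0 : ℝ) < m := Nat.cast_pos.2 hm
    have h1 := hmul n m
    have h2 := hmul m n
    rw [mul_comm n m] at h2
    have h3 : |(m : ℝ) * a n - n * a m| ≤ m * E + n * E := by
      have e : (m : ℝ) * a n - n * a m = (a (m * n) - n * a m) - (a (m * n) - m * a n) := by ring
      rw [e]
      refine (abs_sub _ _).trans ?_
      linarith
    have e : (n : ℝ)⁻¹ * a n - (m : ℝ)⁻¹ * a m = ((n : ℝ)⁻¹ * (m : ℝ)⁻¹) * (m * a n - n * a m) := by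
      field_simp
    rw [e, abs_mul, abs_of_pos (by positivity : 0 < (n : ℝ)⁻¹ * (m : ℝ)⁻¹)]
    calc _ ≤ ((n : ℝ)⁻¹ * (m : ℝ)⁻¹) * (m * E + n * E) :=
          mul_le_mul_of_nonneg_left h3 (by positivity)
      _ = _ := by field_simp
  have hlin : ∀ (r : ℝ) (x u : R2), hgt v (r • (x - u)) = r * (hgt v x - hgt v u) := by
    intro r x u; simp [hgt]; ring
  -- the height is constant on the rotation set
  have hconst : ∀ u ∈ rotSet F, ∀ u' ∈ rotSet F, hgt v u = hgt v u' := by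
    have hlim : ∀ u ∈ rotSet F, ∃ n : ℕ → ℕ, Tendsto n atTop atTop ∧
        Tendsto (fun k => ((n k : ℝ))⁻¹ * a (n k)) atTop (nhds (hgt v u)) := by
      rintro u ⟨z, n, hnt, hzt⟩
      refine ⟨n, hnt, ?_⟩
      have h1 := ((continuous_hgt v).tendsto u).comp hzt
      have h0 : Tendsto (fun k => ((n k : ℝ))⁻¹ * E) atTop (nhds 0) := by
        simpa using
          (tendsto_inv_atTop_zero.comp (tendsto_natCast_atTop_atTop.comp hnt)).mul_const E
      have h2 : Tendsto (fun k => hgt v (((n k : ℝ))⁻¹ • ((⇑F)^[n k] (z k) - z k)) -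
          ((n k : ℝ))⁻¹ * a (n k)) atTop (nhds 0) := by
        refine squeeze_zero_norm (fun k => ?_) h0
        rw [hlin, ← mul_sub, norm_mul, Real.norm_eq_abs, Real.norm_eq_abs,
          abs_of_nonneg (by positivity : 0 ≤ ((n k : ℝ))⁻¹)]
        exact mul_le_mul_of_nonneg_left (hb (n k) (z k)) (by positivity)
      have h3 := h1.sub h2
      simpa using h3
    intro u hu u' hu'
    obtain ⟨n, hnt, hna⟩ := hlim u hu
    obtain ⟨m, hmt, hma⟩ := hlim u' hu'
    have h0 : Tendsto (fun k => ((n k : ℝ))⁻¹ * E + ((m k : ℝ))⁻¹ * E) atTop (nhds 0) := by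
      simpa using
        ((tendsto_inv_atTop_zero.comp (tendsto_natCast_atTop_atTop.comp hnt)).mul_const E).add
        ((tendsto_inv_atTop_zero.comp (tendsto_natCast_atTop_atTop.comp hmt)).mul_const E)
    have h1 := (hna.sub hma).abs
    have h2 := le_of_tendsto_of_tendsto h1 h0 (by
      filter_upwards [hnt.eventually_gt_atTop 0, hmt.eventually_gt_atTop 0] with k hk hk'
      exact hcomp _ _ hk hk')
    have := abs_nonpos_iff.1 h2
    linarith
  obtain ⟨u, hu⟩ := hrot
  have hmem : ∀ᶠ r : ℝ in 𝓝 0, u + r • vec (-v.2, v.1) ∈ rotSet F := by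
    have hc : ContinuousAt (fun r : ℝ => u + r • vec (-v.2, v.1)) 0 := by fun_prop
    apply hc.eventually_mem
    simpa using mem_interior_iff_mem_nhds.1 hu
  obtain ⟨r, hr, hr0⟩ := ((hmem.filter_mono nhdsWithin_le_nhds).and
    (self_mem_nhdsWithin : Ioi (0 : ℝ) ∈ 𝓝[>] 0)).exists
  have := hconst _ (interior_subset hu) _ hr
  have e : hgt v (u + r • vec (-v.2, v.1)) = hgt v u + r * ((v.1 : ℝ) ^ 2 + v.2 ^ 2) := by
    simp [hgt, vec]; ring
  rw [e] at this
  have := mul_pos (show 0 < r from hr0) hn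
  linarith
end
end

section
/- Let g be a frice homeomorphism of T². Then for every nontrivial continuum K ⊂ T² one has h_±(g,K) > 0. -/
open Metric Filter Topology MeasureTheory Set ENNReal

noncomputable section

/-! ### Iterates -/

lemma iterZ_eq {X : Type*} [TopologicalSpace X] (F : X ≃ₜ X) (j : ℤ) (x : X) :
    iterZ F j x = (F ^ j) x := by
  have h : ∀ (H : X ≃ₜ X) (n : ℕ), (⇑H)^[n] x = (H ^ n) x := by
    intro H n
    induction n with
    | zero => simp
    | succ n ih => rw [Function.iterate_succ_apply', ih, pow_succ']; rfl
  cases j with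
  | ofNat n => simp [iterZ, h]
  | negSucc n =>
    rw [zpow_negSucc, ← inv_pow]
    exact h F.symm (n + 1)

lemma pow_commute {X Y : Type*} [TopologicalSpace X] [TopologicalSpace Y] (p : X → Y)
    (F : X ≃ₜ X) (f : Y ≃ₜ Y) (h : ∀ x, p (F x) = f (p x)) (j : ℤ) (x : X) :
    p ((F ^ j) x) = (f ^ j) (p x) := by
  have hinv : ∀ x, p (F⁻¹ x) = f⁻¹ (p x) := by
    intro x
    apply f.injective
    rw [← h]
    change p (F (F.symm x)) = f (f.symm (p x))
    simp
  induction j generalizing x with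
  | zero => simp
  | succ n ih =>
    rw [zpow_add_one, zpow_add_one]
    change p ((F ^ (n : ℤ)) (F x)) = (f ^ (n : ℤ)) (f (p x))
    rw [ih, h]
  | pred n ih =>
    rw [zpow_sub_one, zpow_sub_one]
    change p ((F ^ (-(n : ℤ))) (F⁻¹ x)) = (f ^ (-(n : ℤ))) (f⁻¹ (p x))
    rw [ih, hinv]

/-! ### Boundary bumping -/

lemma bump_clopen {S : Type*} [TopologicalSpace S] [CompactSpace S] [T2Space S] (A B : Set S)
    (hA : IsClosed A) (hB : IsClosed B)
    (h : ∀ a ∈ A, ∀ b ∈ B, connectedComponent a ≠ connectedComponent b) :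
    ∃ C : Set S, IsClopen C ∧ A ⊆ C ∧ Disjoint C B := by
  have hq : Continuous (ConnectedComponents.mk : S → ConnectedComponents S) :=
    ConnectedComponents.continuous_coe
  have hA' := (hA.isCompact.image hq).isClosed
  have hB' := (hB.isCompact.image hq).isClosed
  obtain ⟨C, hC, hAC, hCB⟩ := exists_clopen_of_closed_subset_open hA' hB'.isOpen_compl (by
    rintro _ ⟨a, ha, rfl⟩ ⟨b, hb, hab⟩
    exact h a ha b hb (ConnectedComponents.coe_eq_coe.1 hab).symm)
  refine ⟨ConnectedComponents.mk ⁻¹' C, hC.preimage hq, fun a ha => hAC ⟨a, ha, rfl⟩, ?_⟩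
  rw [Set.disjoint_left]
  intro x hx hxB
  exact hCB hx ⟨x, hxB, rfl⟩

lemma bump {X : Type*} [TopologicalSpace X] [T2Space X] (L : Set X) (hL : IsContinuum L)
    (p : X → ℝ) (hp : Continuous p) (a b : ℝ) (hab : a < b)
    (x y : X) (hx : x ∈ L) (hy : y ∈ L) (hxa : p x ≤ a) (hyb : b ≤ p y) :
    ∃ M : Set X, M ⊆ L ∧ IsContinuum M ∧ (∀ z ∈ M, a ≤ p z ∧ p z ≤ b) ∧
      (∃ u ∈ M, p u = a) ∧ ∃ v ∈ M, p v = b := by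
  have hSc : IsCompact (L ∩ p ⁻¹' Icc a b) := hL.1.inter_right (isClosed_Icc.preimage hp)
  set S : Set X := L ∩ p ⁻¹' Icc a b with hS
  have : CompactSpace S := isCompact_iff_compactSpace.1 hSc
  have hpS : Continuous (fun s : S => p s) := hp.comp continuous_subtype_val
  by_cases hc : ∃ u v : S, p u = a ∧ p v = b ∧ connectedComponent u = connectedComponent v
  · obtain ⟨u, v, hu, hv, huv⟩ := hc
    refine ⟨(fun s : S => (s : X)) '' connectedComponent u, ?_, ⟨?_, ?_⟩, ?_, ?_, ?_⟩
    · rintro _ ⟨s, -, rfl⟩; exact s.2.1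
    · exact isClosed_connectedComponent.isCompact.image continuous_subtype_val
    · exact isConnected_connectedComponent.image _ continuous_subtype_val.continuousOn
    · rintro _ ⟨s, -, rfl⟩; exact s.2.2
    · exact ⟨u, ⟨u, mem_connectedComponent, rfl⟩, hu⟩
    · exact ⟨v, ⟨v, huv ▸ mem_connectedComponent, rfl⟩, hv⟩
  · exfalso
    push Not at hc
    obtain ⟨C, hC, hAC, hCB⟩ := bump_clopen {s : S | p s = a} {s : S | p s = b}
      (isClosed_eq hpS continuous_const) (isClosed_eq hpS continuous_const)
      (fun u hu v hv => hc u v hu hv)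
    have hC1 : IsClosed ((fun s : S => (s : X)) '' C) :=
      (hC.1.isCompact.image continuous_subtype_val).isClosed
    have hC2 : IsClosed ((fun s : S => (s : X)) '' Cᶜ) :=
      (hC.compl.1.isCompact.image continuous_subtype_val).isClosed
    have := isPreconnected_closed_iff.1 hL.2.isPreconnected
      ((fun s : S => (s : X)) '' C ∪ (L ∩ {z | p z ≤ a}))
      ((fun s : S => (s : X)) '' Cᶜ ∪ (L ∩ {z | b ≤ p z}))
      (hC1.union (hL.1.isClosed.inter (isClosed_le hp continuous_const)))
      (hC2.union (hL.1.isClosed.inter (isClosed_le continuous_const hp)))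
      (by
        intro z hz
        by_cases h1 : p z ≤ a
        · exact Or.inl (Or.inr ⟨hz, h1⟩)
        by_cases h2 : b ≤ p z
        · exact Or.inr (Or.inr ⟨hz, h2⟩)
        push Not at h1 h2
        have hzS : z ∈ S := ⟨hz, h1.le, h2.le⟩
        by_cases h3 : (⟨z, hzS⟩ : S) ∈ C
        · exact Or.inl (Or.inl ⟨_, h3, rfl⟩)
        · exact Or.inr (Or.inl ⟨⟨z, hzS⟩, h3, rfl⟩))
      ⟨x, hx, Or.inr ⟨hx, hxa⟩⟩ ⟨y, hy, Or.inr ⟨hy, hyb⟩⟩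
    obtain ⟨z, hz, h1, h2⟩ := this
    rcases h1 with ⟨s, hs, rfl⟩ | ⟨-, h1⟩
    · rcases h2 with ⟨t, ht, hts⟩ | ⟨-, h2⟩
      · have : t = s := Subtype.ext hts
        exact ht (this ▸ hs)
      · exact (Set.disjoint_left.1 hCB) hs (le_antisymm s.2.2.2 h2)
    · rcases h2 with ⟨t, ht, rfl⟩ | ⟨-, h2⟩
      · exact ht (hAC (le_antisymm h1 t.2.2.1))
      · simp only [mem_ofPred_eq] at h1 h2
        linarith

/-! ### Torus distances -/

lemma proj_continuous : Continuous proj := by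
  unfold proj
  exact ((AddCircle.continuous_mk' (1:ℝ)).comp continuous_fst).prodMk
    ((AddCircle.continuous_mk' (1:ℝ)).comp continuous_snd)

lemma circle_dist (s t : ℝ) (h : |s - t| ≤ 1 / 2) :
    dist (s : AddCircle (1:ℝ)) (t : AddCircle (1:ℝ)) = |s - t| := by
  rw [dist_eq_norm, ← AddCircle.coe_sub]
  exact (AddCircle.norm_coe_eq_abs_iff (1:ℝ) one_ne_zero).2 (by simpa using h)

lemma circle_lift (s : ℝ) (t : AddCircle (1:ℝ)) :
    ∃ u : ℝ, (u : AddCircle (1:ℝ)) = t ∧ |u - s| = dist t (s : AddCircle (1:ℝ)) := by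
  obtain ⟨w, rfl⟩ := QuotientAddGroup.mk_surjective t
  refine ⟨w - round (w - s), ?_, ?_⟩
  · have : (((round (w - s) : ℤ) : ℝ) : AddCircle (1:ℝ)) = 0 := by
      have := AddCircle.coe_eq_zero_iff (1:ℝ) (x := ((round (w - s) : ℤ) : ℝ))
      exact this.2 ⟨round (w - s), by simp⟩
    rw [AddCircle.coe_sub, this, sub_zero]
  · change _ = dist ((w : ℝ) : AddCircle (1:ℝ)) (s : AddCircle (1:ℝ))
    rw [dist_eq_norm, ← AddCircle.coe_sub, AddCircle.norm_eq]
    simp only [inv_one, one_mul, mul_one]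
    congr 1; ring

/-! ### Splitting a large continuum -/

lemma split_aux (L : Set R2) (hL : IsContinuum L) (p : R2 → ℝ) (hp : Continuous p)
    (hp1 : ∀ x y, |p x - p y| ≤ dist x y)
    (hp2 : ∀ x y, |p x - p y| ≤ 1 / 2 → |p x - p y| ≤ dist (proj x) (proj y))
    (x y : R2) (hx : x ∈ L) (hy : y ∈ L) (hxy : 1 / 2 ≤ p y - p x) :
    ∃ M₁ M₂ : Set R2, M₁ ⊆ L ∧ M₂ ⊆ L ∧ IsContinuum M₁ ∧ IsContinuum M₂ ∧
      (∃ u ∈ M₁, ∃ v ∈ M₁, 1 / 8 ≤ dist u v) ∧ (∃ u ∈ M₂, ∃ v ∈ M₂, 1 / 8 ≤ dist u v) ∧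
      ∀ u ∈ M₁, ∀ v ∈ M₂, 1 / 16 < dist (proj u) (proj v) := by
  obtain ⟨M₁, h1, h1', h1'', ⟨u, hu, hu'⟩, v, hv, hv'⟩ :=
    bump L hL p hp (p x) (p x + 1 / 8) (by linarith) x y hx hy le_rfl (by linarith)
  obtain ⟨M₂, h2, h2', h2'', ⟨s, hs, hs'⟩, t, ht, ht'⟩ :=
    bump L hL p hp (p x + 1 / 4) (p x + 3 / 8) (by linarith) x y hx hy (by linarith)
      (by linarith)
  refine ⟨M₁, M₂, h1, h2, h1', h2', ⟨v, hv, u, hu, ?_⟩, ⟨t, ht, s, hs, ?_⟩, ?_⟩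
  · refine le_trans ?_ (hp1 v u)
    rw [hu', hv']
    exact le_trans (by linarith) (le_abs_self _)
  · refine le_trans ?_ (hp1 t s)
    rw [hs', ht']
    exact le_trans (by linarith) (le_abs_self _)
  · intro u hu v hv
    have a1 := h1'' u hu
    have a2 := h2'' v hv
    have a3 : |p u - p v| ≤ 1 / 2 := by rw [abs_le]; constructor <;> linarith
    have a4 : 1 / 8 ≤ |p u - p v| := by rw [abs_sub_comm]; exact le_trans (by linarith) (le_abs_self _)
    have := hp2 u v a3
    linarith

lemma split (L : Set R2) (hL : IsContinuum L)
    (x y : R2) (hx : x ∈ L) (hy : y ∈ L) (hxy : 1 / 2 ≤ dist x y) :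
    ∃ M₁ M₂ : Set R2, M₁ ⊆ L ∧ M₂ ⊆ L ∧ IsContinuum M₁ ∧ IsContinuum M₂ ∧
      (∃ u ∈ M₁, ∃ v ∈ M₁, 1 / 8 ≤ dist u v) ∧ (∃ u ∈ M₂, ∃ v ∈ M₂, 1 / 8 ≤ dist u v) ∧
      ∀ u ∈ M₁, ∀ v ∈ M₂, 1 / 16 < dist (proj u) (proj v) := by
  have key1 := split_aux L hL Prod.fst continuous_fst
    (fun x y => by rw [Prod.dist_eq, ← Real.dist_eq]; exact le_max_left _ _)
    (fun x y h => by
      rw [Prod.dist_eq, ← circle_dist _ _ h]; exact le_max_left _ _)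
  have key2 := split_aux L hL Prod.snd continuous_snd
    (fun x y => by rw [Prod.dist_eq, ← Real.dist_eq]; exact le_max_right _ _)
    (fun x y h => by
      rw [Prod.dist_eq, ← circle_dist _ _ h]; exact le_max_right _ _)
  rw [Prod.dist_eq, le_max_iff, Real.dist_eq, Real.dist_eq, le_abs, le_abs] at hxy
  rcases hxy with (h | h) | (h | h)
  · exact key1 y x hy hx h
  · exact key1 x y hx hy (by linarith)
  · exact key2 y x hy hx h
  · exact key2 x y hx hy (by linarith)

/-! ### Uniform expansion -/

lemma dynDiam_large (G : R2 ≃ₜ R2) (L : Set R2) (h : dynDiam G L = ⊤) :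
    ∃ (j : ℤ), ∃ x ∈ L, ∃ y ∈ L, 1 / 2 < dist ((G ^ j) x) ((G ^ j) y) := by
  by_contra hcon
  push Not at hcon
  have : dynDiam G L ≤ ENNReal.ofReal (1 / 2) := by
    refine iSup_le fun j => ?_
    refine EMetric.diam_le ?_
    rintro _ ⟨x, hx, rfl⟩ _ ⟨y, hy, rfl⟩
    rw [iterZ_eq, iterZ_eq, edist_dist]
    exact ENNReal.ofReal_le_ofReal (hcon j x hx y hy)
  rw [h] at this
  exact ENNReal.ofReal_ne_top (top_le_iff.1 this)

lemma ultra_limit (G : R2 ≃ₜ R2)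
    (L : ℕ → Set R2) (hL : ∀ n, IsContinuum (L n)) (B : Set R2) (hB : IsCompact B)
    (hLB : ∀ n, L n ⊆ B) (hd : ∀ n, ∃ x ∈ L n, ∃ y ∈ L n, 1 / 8 ≤ dist x y)
    (hs : ∀ n : ℕ, ∀ j : ℤ, |j| ≤ n → ∀ x ∈ L n, ∀ y ∈ L n,
      dist ((G ^ j) x) ((G ^ j) y) ≤ 1 / 2) :
    ∃ M : Set R2, IsContinuum M ∧ M.Nontrivial ∧
      ∀ j : ℤ, ∀ x ∈ M, ∀ y ∈ M, dist ((G ^ j) x) ((G ^ j) y) ≤ 1 / 2 := by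
  let U : Ultrafilter ℕ := hyperfilter ℕ
  have hU : (U : Filter ℕ) ≤ atTop := by
    rw [← Nat.cofinite_eq_atTop]; exact hyperfilter_le_cofinite
  let M : Set R2 := {x | ∀ V : Set R2, IsOpen V → x ∈ V → ∀ᶠ n in (U : Filter ℕ), (L n ∩ V).Nonempty}
  -- ultralimits of points
  have hlim : ∀ z : ℕ → R2, (∀ᶠ n in (U : Filter ℕ), z n ∈ L n) →
      ∃ x ∈ M, Tendsto z (U : Filter ℕ) (𝓝 x) := by
    intro z hz
    obtain ⟨x, -, hx⟩ := hB.ultrafilter_le_nhds (U.map z) (by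
      rw [le_principal_iff]
      exact hz.mono fun n hn => hLB n hn)
    have hx' : Tendsto z (U : Filter ℕ) (𝓝 x) := hx
    refine ⟨x, ?_, hx'⟩
    intro V hV hxV
    filter_upwards [hz, hx'.eventually (hV.mem_nhds hxV)] with n h1 h2
    exact ⟨z n, h1, h2⟩
  have hMcl : IsClosed M := by
    rw [← isOpen_compl_iff, isOpen_iff_mem_nhds]
    intro x hx
    simp only [M, mem_compl_iff, mem_ofPred_eq, not_forall] at hx
    obtain ⟨V, hV, hxV, hn⟩ := hx
    filter_upwards [hV.mem_nhds hxV] with y hy hyM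
    exact hn (hyM V hV hy)
  have hMB : M ⊆ B := by
    intro x hx
    by_contra hxB
    obtain ⟨n, w, hw, hw'⟩ := (hx Bᶜ hB.isClosed.isOpen_compl hxB).exists
    exact hw' (hLB n hw)
  choose x hx y hy hxy using hd
  obtain ⟨x₀, hx₀, hx₀'⟩ := hlim x (Eventually.of_forall hx)
  obtain ⟨y₀, hy₀, hy₀'⟩ := hlim y (Eventually.of_forall hy)
  have hMc : IsCompact M := hB.of_isClosed_subset hMcl hMB
  refine ⟨M, ⟨hMc, ⟨x₀, hx₀⟩, ?_⟩, ⟨x₀, hx₀, y₀, hy₀, ?_⟩, ?_⟩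
  · rw [isPreconnected_iff_subset_of_disjoint_closed]
    by_contra hcon
    push Not at hcon
    obtain ⟨P, Q, hP, hQ, hPQ, hdis, hnP, hnQ⟩ := hcon
    have hMP : IsCompact (M ∩ P) := hMc.inter_right hP
    have hMQ : IsCompact (M ∩ Q) := hMc.inter_right hQ
    obtain ⟨V, W, hV, hW, hPV, hQW, hVW⟩ := SeparatedNhds.of_isCompact_isCompact hMP hMQ (by
      rw [Set.disjoint_left]
      intro z hz hz'
      have : z ∈ M ∩ (P ∩ Q) := ⟨hz.1, hz.2, hz'.2⟩
      rw [hdis] at this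
      exact this)
    obtain ⟨q, hqM, hqP⟩ := Set.not_subset.1 hnP
    obtain ⟨r, hrM, hrQ⟩ := Set.not_subset.1 hnQ
    have hqQ : q ∈ Q := (hPQ hqM).resolve_left hqP
    have hrP : r ∈ P := (hPQ hrM).resolve_right hrQ
    have e1 := hqM W hW (hQW ⟨hqM, hqQ⟩)
    have e2 := hrM V hV (hPV ⟨hrM, hrP⟩)
    have e3 : ∀ᶠ n in (U : Filter ℕ), L n ⊆ V ∪ W := by
      by_contra hne
      have hne' : ∀ᶠ n in (U : Filter ℕ), ¬ L n ⊆ V ∪ W := Ultrafilter.eventually_not.2 hne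
      have : ∀ n, ∃ z, ¬ L n ⊆ V ∪ W → z ∈ L n ∧ z ∉ V ∪ W := by
        intro n
        by_cases h : L n ⊆ V ∪ W
        · exact ⟨0, fun h' => absurd h h'⟩
        · obtain ⟨z, hz, hz'⟩ := Set.not_subset.1 h
          exact ⟨z, fun _ => ⟨hz, hz'⟩⟩
      choose z hz using this
      obtain ⟨z₀, hz₀, hz₀'⟩ := hlim z (hne'.mono fun n hn => (hz n hn).1)
      have hin : z₀ ∈ V ∪ W := by
        rcases hPQ hz₀ with h | h
        · exact Or.inl (hPV ⟨hz₀, h⟩)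
        · exact Or.inr (hQW ⟨hz₀, h⟩)
      obtain ⟨n, h1, h2⟩ :=
        ((hz₀'.eventually ((hV.union hW).mem_nhds hin)).and hne').exists
      exact (hz n h2).2 h1
    obtain ⟨n, ⟨h1, h2⟩, h3⟩ := ((e1.and e2).and e3).exists
    obtain ⟨w, -, hw1, hw2⟩ := (hL n).2.isPreconnected V W hV hW h3 h2 h1
    exact (Set.disjoint_left.1 hVW) hw1 hw2
  · intro h
    have ht : Tendsto (fun n => dist (x n) (y n)) (U : Filter ℕ) (𝓝 (dist x₀ y₀)) :=
      hx₀'.dist hy₀'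
    have := ge_of_tendsto' ht hxy
    rw [h, dist_self] at this
    norm_num at this
  · intro j a ha b hb
    by_contra hcon
    push Not at hcon
    have hop : IsOpen {q : R2 × R2 | 1 / 2 < dist ((G ^ j) q.1) ((G ^ j) q.2)} :=
      isOpen_lt continuous_const (((G ^ j).continuous.comp continuous_fst).dist
        ((G ^ j).continuous.comp continuous_snd))
    obtain ⟨V, W, hV, hW, haV, hbW, hVW⟩ := isOpen_prod_iff.1 hop a b hcon
    have e3 : ∀ᶠ n : ℕ in (U : Filter ℕ), j.natAbs ≤ n := hU (eventually_ge_atTop _)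
    obtain ⟨n, ⟨⟨u, hu, huV⟩, v, hv, hvW⟩, hn⟩ :=
      (((ha V hV haV).and (hb W hW hbW)).and e3).exists
    have h1 := hs n j (by rw [Int.abs_eq_natAbs]; exact_mod_cast hn) u hu v hv
    have h2 : 1 / 2 < dist ((G ^ j) u) ((G ^ j) v) := hVW (show (u, v) ∈ V ×ˢ W from ⟨huV, hvW⟩)
    linarith

lemma uniform_exp (g : Torus ≃ₜ Torus) (G : R2 ≃ₜ R2) (hG : IsLiftFun ⇑g ⇑G)
    (hexp : ∀ K : Set R2, IsContinuum K → K.Nontrivial → dynDiam G K = ⊤) :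
    ∃ N : ℕ, ∀ L : Set R2, IsContinuum L → (∃ x ∈ L, ∃ y ∈ L, 1 / 8 ≤ dist x y) →
      ∃ j : ℤ, |j| ≤ N ∧ ∃ x ∈ L, ∃ y ∈ L, 1 / 2 ≤ dist ((G ^ j) x) ((G ^ j) y) := by
  by_contra hcon
  push Not at hcon
  have hbox : ∀ N : ℕ, ∃ L : Set R2, IsContinuum L ∧ L ⊆ closedBall 0 2 ∧
      (∃ x ∈ L, ∃ y ∈ L, 1 / 8 ≤ dist x y) ∧ ∀ j : ℤ, |j| ≤ N → ∀ x ∈ L, ∀ y ∈ L,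
      dist ((G ^ j) x) ((G ^ j) y) ≤ 1 / 2 := by
    intro N
    obtain ⟨L, hL, ⟨x, hx, y, hy, hxy⟩, hj⟩ := hcon N
    let v : R2 := (((-⌊x.1⌋ : ℤ) : ℝ), ((-⌊x.2⌋ : ℤ) : ℝ))
    have hv : ∀ (j : ℤ) (z : R2), (G ^ j) (z + v) = (G ^ j) z + v := fun j z =>
      (pow_commute (fun z => z + v) G G (fun z => (hG.2 z (-⌊x.1⌋, -⌊x.2⌋)).symm) j z).symm
    refine ⟨(fun z => z + v) '' L, ⟨hL.1.image (by fun_prop), hL.2.image _ (by fun_prop)⟩,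
      ?_, ⟨_, ⟨x, hx, rfl⟩, _, ⟨y, hy, rfl⟩, by simpa using hxy⟩, ?_⟩
    · rintro _ ⟨z, hz, rfl⟩
      have h0 : dist z x < 1 / 2 := by simpa using hj 0 (by simp) z hz x hx
      have h1 : dist (x + v) 0 ≤ 1 := by
        have := Int.fract_nonneg x.1
        have := Int.fract_lt_one x.1
        have := Int.fract_nonneg x.2
        have := Int.fract_lt_one x.2
        have e1 : (x + v).1 = Int.fract x.1 := by simp [v, Int.fract, sub_eq_add_neg]
        have e2 : (x + v).2 = Int.fract x.2 := by simp [v, Int.fract, sub_eq_add_neg]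
        rw [Prod.dist_eq, e1, e2, Real.dist_eq, Real.dist_eq]
        simp only [Prod.fst_zero, Prod.snd_zero, sub_zero]
        exact max_le (by rw [abs_of_nonneg] <;> linarith) (by rw [abs_of_nonneg] <;> linarith)
      have h2 := dist_triangle (z + v) (x + v) 0
      rw [dist_add_right] at h2
      rw [mem_closedBall]
      linarith
    · rintro j hjN _ ⟨a, ha, rfl⟩ _ ⟨b, hb, rfl⟩
      simp only [hv, dist_add_right]
      exact (hj j hjN a ha b hb).le
  choose L h1 h2 h3 h4 using hbox
  obtain ⟨M, hM, hMn, hMs⟩ := ultra_limit G L h1 _ (isCompact_closedBall (0:R2) 2) h2 h3 h4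
  obtain ⟨j, x, hx, y, hy, hxy⟩ := dynDiam_large G M (hexp M hM hMn)
  have := hMs j x hx y hy
  linarith

/-! ### Exponentially many separated points -/

lemma many_points (G : R2 ≃ₜ R2) (N : ℕ)
    (hN : ∀ L : Set R2, IsContinuum L → (∃ x ∈ L, ∃ y ∈ L, 1 / 8 ≤ dist x y) →
      ∃ j : ℤ, |j| ≤ N ∧ ∃ x ∈ L, ∃ y ∈ L, 1 / 2 ≤ dist ((G ^ j) x) ((G ^ j) y)) (k : ℕ) :
    ∀ L : Set R2, IsContinuum L → (∃ x ∈ L, ∃ y ∈ L, 1 / 8 ≤ dist x y) →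
      ∃ Y : Finset R2, ↑Y ⊆ L ∧ Y.card = 2 ^ k ∧ ∀ y ∈ Y, ∀ y' ∈ Y, y ≠ y' →
        ∃ i : ℤ, |i| ≤ (k * N : ℕ) ∧ 1 / 16 < dist (proj ((G ^ i) y)) (proj ((G ^ i) y')) := by
  classical
  induction k with
  | zero =>
    rintro L - ⟨x, hx, -⟩
    refine ⟨{x}, by simpa using hx, by simp, ?_⟩
    intro y hy y' hy' hne
    rw [Finset.mem_singleton] at hy hy'
    exact absurd (hy.trans hy'.symm) hne
  | succ k ih =>
    intro L hL hd
    obtain ⟨j, hj, x, hx, y, hy, hxy⟩ := hN L hL hd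
    obtain ⟨M₁, M₂, s1, s2, c1, c2, d1, d2, hsep⟩ := split ((G ^ j) '' L)
      ⟨hL.1.image (G ^ j).continuous, hL.2.image _ (G ^ j).continuous.continuousOn⟩
      _ _ ⟨x, hx, rfl⟩ ⟨y, hy, rfl⟩ hxy
    obtain ⟨Y₁, i1, n1, p1⟩ := ih M₁ c1 d1
    obtain ⟨Y₂, i2, n2, p2⟩ := ih M₂ c2 d2
    have hdisj : Disjoint Y₁ Y₂ := by
      rw [Finset.disjoint_left]
      intro z h1 h2
      have := hsep z (i1 h1) z (i2 h2)
      rw [dist_self] at this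
      norm_num at this
    have hinv : ∀ z, (G ^ j) ((G ^ j).symm z) = z := fun z => (G ^ j).apply_symm_apply z
    have hmul : ∀ (i : ℤ) z, (G ^ (i + j)) ((G ^ j).symm z) = (G ^ i) z := by
      intro i z
      rw [zpow_add]
      change (G ^ i) ((G ^ j) ((G ^ j).symm z)) = _
      rw [hinv]
    refine ⟨(Y₁ ∪ Y₂).image (G ^ j).symm, ?_, ?_, ?_⟩
    · intro w hw
      rw [Finset.mem_coe, Finset.mem_image] at hw
      obtain ⟨z, hz, rfl⟩ := hw
      have hzL : z ∈ (G ^ j) '' L := by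
        rcases Finset.mem_union.1 hz with h | h
        · exact s1 (i1 h)
        · exact s2 (i2 h)
      obtain ⟨w, hw, rfl⟩ := hzL
      rw [Homeomorph.symm_apply_apply]
      exact hw
    · rw [Finset.card_image_of_injective _ (G ^ j).symm.injective,
        Finset.card_union_of_disjoint hdisj, n1, n2]
      ring
    · have hkN : (((k + 1) * N : ℕ) : ℤ) = ((k * N : ℕ) : ℤ) + N := by push_cast; ring
      have hkN0 : (0:ℤ) ≤ ((k * N : ℕ) : ℤ) := Int.natCast_nonneg _
      have hlift : ∀ i : ℤ, |i| ≤ ((k * N : ℕ) : ℤ) → |i + j| ≤ (((k + 1) * N : ℕ) : ℤ) := by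
        intro i hi
        rw [hkN]
        exact (abs_add_le i j).trans (add_le_add hi hj)
      have hj' : |j| ≤ (((k + 1) * N : ℕ) : ℤ) := by rw [hkN]; omega
      intro w hw w' hw' hne
      rw [Finset.mem_image] at hw hw'
      obtain ⟨z, hz, rfl⟩ := hw
      obtain ⟨z', hz', rfl⟩ := hw'
      have hne' : z ≠ z' := fun h => hne (by rw [h])
      rcases Finset.mem_union.1 hz with h | h <;> rcases Finset.mem_union.1 hz' with h' | h'
      · obtain ⟨i, hi, hd⟩ := p1 z h z' h' hne'
        exact ⟨i + j, hlift i hi, by rwa [hmul, hmul]⟩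
      · exact ⟨j, hj', by rw [hinv, hinv]; exact hsep z (i1 h) z' (i2 h')⟩
      · exact ⟨j, hj', by rw [hinv, hinv, dist_comm]; exact hsep z' (i1 h') z (i2 h)⟩
      · obtain ⟨i, hi, hd⟩ := p2 z h z' h' hne'
        exact ⟨i + j, hlift i hi, by rwa [hmul, hmul]⟩

/-! ### Lifting a small subcontinuum -/

lemma lift_continuum (K : Set Torus) (hK : IsContinuum K) (hnt : K.Nontrivial) :
    ∃ L : Set R2, IsContinuum L ∧ L.Nontrivial ∧ proj '' L ⊆ K := by
  obtain ⟨x, hx, y, hy, hxy⟩ := hnt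
  have hr : 0 < min (dist x y) (1 / 4) := lt_min (dist_pos.2 hxy) (by norm_num)
  obtain ⟨M, hMK, hM, hMb, ⟨u, hu, hu0⟩, v, hv, hvr⟩ := bump K hK (fun z => dist x z)
    (by fun_prop) 0 (min (dist x y) (1 / 4)) hr x y hx hy (by simp) (min_le_left _ _)
  obtain ⟨a, ha⟩ := QuotientAddGroup.mk_surjective x.1
  obtain ⟨b, hb⟩ := QuotientAddGroup.mk_surjective x.2
  have hab : proj (a, b) = x := Prod.ext ha hb
  let B : Set R2 := closedBall (a, b) (1 / 4)
  have : CompactSpace B := isCompact_iff_compactSpace.1 (isCompact_closedBall _ _)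
  let f : B → Torus := fun z => proj z
  have hf : Continuous f := proj_continuous.comp continuous_subtype_val
  have hinj : Function.Injective f := by
    rintro ⟨z, hz⟩ ⟨w, hw⟩ h
    have hzw : dist z w ≤ 1 / 2 := by
      have h1 := mem_closedBall.1 hz
      have h2 := mem_closedBall.1 hw
      have := dist_triangle_right z w (a, b)
      linarith
    rw [Prod.dist_eq, max_le_iff, Real.dist_eq, Real.dist_eq] at hzw
    have e1 := circle_dist _ _ hzw.1
    have e2 := circle_dist _ _ hzw.2
    have g1 : (z.1 : AddCircle (1:ℝ)) = w.1 := congrArg Prod.fst h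
    have g2 : (z.2 : AddCircle (1:ℝ)) = w.2 := congrArg Prod.snd h
    rw [g1, dist_self] at e1
    rw [g2, dist_self] at e2
    refine Subtype.ext (Prod.ext ?_ ?_)
    · exact sub_eq_zero.1 (abs_eq_zero.1 e1.symm)
    · exact sub_eq_zero.1 (abs_eq_zero.1 e2.symm)
  have hsurj : M ⊆ range f := by
    intro z hz
    have h1 : dist x z ≤ 1 / 4 := (hMb z hz).2.trans (min_le_right _ _)
    rw [dist_comm, ← hab, Prod.dist_eq, max_le_iff] at h1
    obtain ⟨s, hs, hs'⟩ := circle_lift a z.1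
    obtain ⟨t, ht, ht'⟩ := circle_lift b z.2
    refine ⟨⟨(s, t), ?_⟩, Prod.ext hs ht⟩
    rw [mem_closedBall, Prod.dist_eq, Real.dist_eq, Real.dist_eq]
    exact max_le (hs'.le.trans h1.1) (ht'.le.trans h1.2)
  have hpre := hM.2.isPreconnected.preimage_of_isClosedMap hinj hf.isClosedMap hsurj
  obtain ⟨u', hu'⟩ := hsurj hu
  obtain ⟨v', hv'⟩ := hsurj hv
  refine ⟨(fun z : B => (z : R2)) '' (f ⁻¹' M), ⟨?_, ?_, ?_⟩, ?_, ?_⟩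
  · exact (hM.1.isClosed.preimage hf).isCompact.image continuous_subtype_val
  · exact ⟨u', u', by rw [mem_preimage, hu']; exact hu, rfl⟩
  · exact hpre.image _ continuous_subtype_val.continuousOn
  · refine ⟨u', ⟨u', by rw [mem_preimage, hu']; exact hu, rfl⟩, v',
      ⟨v', by rw [mem_preimage, hv']; exact hv, rfl⟩, ?_⟩
    intro h
    have : u' = v' := Subtype.ext h
    have huv : u = v := by rw [← hu', ← hv', this]
    simp only [huv] at hu0
    rw [hu0] at hvr
    exact hr.ne hvr
  · rintro _ ⟨_, ⟨z, hz, rfl⟩, rfl⟩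
    exact hMK hz

/-! ### Counting -/

lemma sep_bdd (g : Torus ≃ₜ Torus) (n : ℕ) (ε : ℝ) (hε : 0 < ε) (K : Set Torus) :
    BddAbove {m : ℕ | ∃ Y : Finset Torus, ↑Y ⊆ K ∧ Y.card = m ∧
    ∀ y ∈ Y, ∀ y' ∈ Y, y ≠ y' →
      ∃ i : ℤ, |i| ≤ (n : ℤ) ∧ ε < dist (iterZ g i y) (iterZ g i y')} := by
  let V : Torus → Set Torus := fun x =>
    ⋂ i ∈ Finset.Icc (-(n:ℤ)) n, (g ^ i) ⁻¹' (ball ((g ^ i) x) (ε / 2))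
  have hV : ∀ x, V x ∈ 𝓝 x := by
    intro x
    refine (Filter.biInter_finset_mem _).2 fun i _ => ?_
    exact (g ^ i).continuous.continuousAt.preimage_mem_nhds (ball_mem_nhds _ (half_pos hε))
  obtain ⟨t, -, ht⟩ := isCompact_univ.elim_nhds_subcover V (fun x _ => hV x)
  have hcov : ∀ y : Torus, ∃ x ∈ t, y ∈ V x := by
    intro y
    simpa using ht (mem_univ y)
  choose c hc hcV using hcov
  refine ⟨t.card, ?_⟩
  rintro m ⟨Y, -, rfl, hY⟩
  refine Finset.card_le_card_of_injOn c (fun y _ => hc y) ?_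
  intro y hy y' hy' hcc
  by_contra hne
  obtain ⟨i, hi, hd⟩ := hY y hy y' hy' hne
  rw [iterZ_eq, iterZ_eq] at hd
  have hi' : i ∈ Finset.Icc (-(n:ℤ)) n := Finset.mem_Icc.2 (abs_le.1 hi)
  have h1 : dist ((g ^ i) y) ((g ^ i) (c y)) < ε / 2 := by
    have := hcV y
    simp only [V, mem_iInter] at this
    exact this i hi'
  have h2 : dist ((g ^ i) y') ((g ^ i) (c y)) < ε / 2 := by
    have := hcV y'
    rw [← hcc] at this
    simp only [V, mem_iInter] at this
    exact this i hi'
  have := dist_triangle_right ((g ^ i) y) ((g ^ i) y') ((g ^ i) (c y))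
  linarith

/-- **Tightness.** A frice torus homeomorphism carries positive two-sided entropy on every
nontrivial continuum. -/
theorem frice_tight
    (g : Torus ≃ₜ Torus) (G : R2 ≃ₜ R2) (hG : IsLiftFun ⇑g ⇑G)
    (hrot : (interior (rotSet G)).Nonempty)
    (hexp : ∀ K : Set R2, IsContinuum K → K.Nontrivial → dynDiam G K = ⊤)
    (K : Set Torus) (hK : IsContinuum K) (hnt : K.Nontrivial) :
    0 < entropyPM g K := by
  classical
  obtain ⟨L, hL, hLn, hLK⟩ := lift_continuum K hK hnt
  obtain ⟨N, hN⟩ := uniform_exp g G hG hexp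
  obtain ⟨j, x, hx, y, hy, hxy⟩ := dynDiam_large G L (hexp L hL hLn)
  have hsemi : ∀ (i : ℤ) (z : R2), proj ((G ^ i) z) = (g ^ i) (proj z) :=
    fun i z => pow_commute proj G g hG.1 i z
  have hinv : ∀ z, (G ^ j) ((G ^ j).symm z) = z := fun z => (G ^ j).apply_symm_apply z
  have hmul : ∀ (i : ℤ) z, (G ^ (i + j)) ((G ^ j).symm z) = (G ^ i) z := by
    intro i z
    rw [zpow_add]
    change (G ^ i) ((G ^ j) ((G ^ j).symm z)) = _
    rw [hinv]
  have hcount : ∀ k n : ℕ, k * N + j.natAbs ≤ n → 2 ^ k ≤ sepCount g n (1 / 16) K := by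
    intro k n hn
    obtain ⟨Y, hYL, hYc, hYs⟩ := many_points G N hN k ((G ^ j) '' L)
      ⟨hL.1.image (G ^ j).continuous, hL.2.image _ (G ^ j).continuous.continuousOn⟩
      ⟨_, ⟨x, hx, rfl⟩, _, ⟨y, hy, rfl⟩, by linarith⟩
    have hsep : ∀ z ∈ Y, ∀ z' ∈ Y, z ≠ z' → ∃ i : ℤ, |i| ≤ (n : ℤ) ∧
        1 / 16 < dist ((g ^ i) (proj ((G ^ j).symm z))) ((g ^ i) (proj ((G ^ j).symm z'))) := by
      intro z hz z' hz' hne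
      obtain ⟨i, hi, hd⟩ := hYs z hz z' hz' hne
      refine ⟨i + j, ?_, ?_⟩
      · have := abs_add_le i j
        have hja := Int.abs_eq_natAbs j
        omega
      · rwa [← hsemi, ← hsemi, hmul, hmul]
    have hinjOn : Set.InjOn (fun z => proj ((G ^ j).symm z)) (Y : Set R2) := by
      intro z hz z' hz' h
      by_contra hne
      obtain ⟨i, -, hd⟩ := hsep z hz z' hz' hne
      simp only at h
      rw [h, dist_self] at hd
      norm_num at hd
    refine le_csSup (sep_bdd g n (1 / 16) (by norm_num) K)
      ⟨Y.image (fun z => proj ((G ^ j).symm z)), ?_, ?_, ?_⟩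
    · intro w hw
      rw [Finset.mem_coe, Finset.mem_image] at hw
      obtain ⟨z, hz, rfl⟩ := hw
      obtain ⟨w, hw, rfl⟩ := hYL hz
      rw [Homeomorph.symm_apply_apply]
      exact hLK ⟨w, hw, rfl⟩
    · rw [Finset.card_image_of_injOn hinjOn, hYc]
    · intro w hw w' hw' hne
      rw [Finset.mem_image] at hw hw'
      obtain ⟨z, hz, rfl⟩ := hw
      obtain ⟨z', hz', rfl⟩ := hw'
      obtain ⟨i, hi, hd⟩ := hsep z hz z' hz' (fun h => hne (by rw [h]))
      exact ⟨i, hi, by rwa [iterZ_eq, iterZ_eq]⟩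
  -- conclude with `n = k * T`
  let T : ℕ := N + j.natAbs + 1
  have hT : 0 < T := Nat.succ_pos _
  have hTR : (0:ℝ) < T := by exact_mod_cast hT
  have hlog : 0 < Real.log 2 := Real.log_pos (by norm_num)
  have hc : 0 < Real.log 2 / T := div_pos hlog hTR
  have hfreq : ∃ᶠ n : ℕ in atTop, ((Real.log 2 / T : ℝ) : EReal) ≤
      ((Real.log (sepCount g n (1 / 16) K) / n : ℝ) : EReal) := by
    rw [frequently_atTop]
    intro m
    refine ⟨(m + 1) * T, ?_, ?_⟩
    · nlinarith
    · rw [EReal.coe_le_coe_iff]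
      have h1 := hcount (m + 1) ((m + 1) * T) (by
        have : (m + 1) * T = (m + 1) * N + (m + 1) * j.natAbs + (m + 1) := by
          simp only [T]; ring
        have h2 : j.natAbs ≤ (m + 1) * j.natAbs := Nat.le_mul_of_pos_left _ (Nat.succ_pos m)
        omega)
      have h2 : ((2:ℝ) ^ (m + 1)) ≤ (sepCount g ((m + 1) * T) (1 / 16) K : ℝ) := by
        exact_mod_cast h1
      have h3 := Real.log_le_log (by positivity) h2
      rw [Real.log_pow] at h3
      have hm : (0:ℝ) < ((m + 1 : ℕ) : ℝ) := by positivity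
      rw [Nat.cast_mul, div_le_div_iff₀ hTR (mul_pos hm hTR)]
      nlinarith
  have h0 : (0 : EReal) < ((Real.log 2 / T : ℝ) : EReal) := by exact_mod_cast hc
  refine lt_of_lt_of_le h0 ((le_limsup_of_frequently_le' hfreq).trans ?_)
  unfold entropyPM
  exact le_iSup₂ (f := fun (ε : ℝ) (_ : 0 < ε) =>
    limsup (fun n : ℕ => ((Real.log (sepCount g n ε K) / n : ℝ) : EReal)) atTop)
    (1 / 16 : ℝ) (by norm_num)
end
end
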